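/- Let N ≥ 1 and let (Z_α)_{α ∈ LP_N} be a family of functions 𝔛_{2N} → ℂ satisfying the meander relations at size N. Then for every α ∈ LP_N and every x ∈ 𝔛_{2N}, the value Z_α(x) is a strictly positive real number: Im Z_α(x) = 0 and Re Z_α(x) > 0. -/

import Mathlib

open MeasureTheory

/-- A planar link pattern of size `N`: a noncrossing perfect matching of `{1,…,2N}`,
with the links `{a r, b r}` satisfying `a r < b r` and `a` strictly increasing. -/
structure LinkPattern (N : ℕ) where
  a : Fin N → ℕ
  b : Fin N → ℕ
  a_lt_b : ∀ r, a r < b r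
  a_mono : StrictMono a
  inj : Function.Injective (fun p : Fin N × Bool => if p.2 then b p.1 else a p.1)
  cover : ∀ k : ℕ, (∃ p : Fin N × Bool, (if p.2 then b p.1 else a p.1) = k) ↔ (1 ≤ k ∧ k ≤ 2 * N)
  noncross : ∀ r s : Fin N, ¬ (a r < a s ∧ a s < b r ∧ b r < b s)

/-- The (unordered) link relation of a link pattern. -/
def LinkPattern.Linked {N : ℕ} (β : LinkPattern N) (p q : ℕ) : Prop :=
  ∃ r, (β.a r = p ∧ β.b r = q) ∨ (β.a r = q ∧ β.b r = p)

/-- The positive real integral `ρ_{k_1,…,k_N}(x)`. -/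
noncomputable def rho (N : ℕ) (k : Fin N → ℕ) (x : ℕ → ℝ) : ℝ :=
  (∏ p ∈ (Finset.Icc 1 (2 * N) ×ˢ Finset.Icc 1 (2 * N)).filter fun p => p.1 < p.2,
      (x p.2 - x p.1) ^ ((4 : ℝ)⁻¹)) *
  ∫ u : Fin N → ℝ in Set.univ.pi fun r => Set.Ioo (x (k r)) (x (k r + 1)),
    (∏ p ∈ (Finset.univ ×ˢ Finset.univ : Finset (Fin N × Fin N)).filter fun p => p.1 < p.2,
        (u p.2 - u p.1)) *
      ∏ r, ∏ i ∈ Finset.Icc 1 (2 * N), |u r - x i| ^ (-(2 : ℝ)⁻¹)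

/-- The coefficient `c_β(k_1,…,k_N)`. -/
noncomputable def linkCoeff (N : ℕ) (β : LinkPattern N) (k : Fin N → ℕ) : ℂ :=
  Complex.I ^ ((∑ r, (k r : ℤ)) - ∑ r, (β.a r : ℤ)) *
    ∑ σ : Equiv.Perm (Fin N),
      ((Equiv.Perm.sign σ : ℤ) : ℂ) *
        ∏ r, if β.a r ≤ k (σ r) ∧ k (σ r) < β.b r then (1 : ℂ) else 0

/-- The Coulomb gas integral `F_β(x)`. -/
noncomputable def coulomb (N : ℕ) (β : LinkPattern N) (x : ℕ → ℝ) : ℂ :=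
  ∑ k ∈ (Fintype.piFinset fun _ : Fin N => Finset.Icc 1 (2 * N - 1)).filter
      fun k => ∀ r s : Fin N, r < s → k r < k s,
    linkCoeff N β k * (rho N k x : ℂ)

/-- Membership in the open chamber `𝔛_{2N}` (only coordinates `1,…,2N` are relevant). -/
def IsChamber (N : ℕ) (x : ℕ → ℝ) : Prop :=
  ∀ i k : ℕ, 1 ≤ i → i < k → k ≤ 2 * N → x i < x k

/-- The meander matrix entry `M_{α,β}` equals `1`, i.e. the graph on `{1,…,2N}` with edge set
`α ∪ β` is connected. -/
def MeanderOne (N : ℕ) (α β : LinkPattern N) : Prop :=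
  ∀ p q : ℕ, 1 ≤ p → p ≤ 2 * N → 1 ≤ q → q ≤ 2 * N →
    Relation.ReflTransGen (fun u v => α.Linked u v ∨ β.Linked u v) p q

/-- The family `(Z_α)_{α ∈ LP_N}` satisfies the meander relations at size `N`:
`F_β = Σ_α M_{α,β} Z_α` on the chamber, for every `β ∈ LP_N`. -/
def MeanderRelations (N : ℕ) (Z : LinkPattern N → (ℕ → ℝ) → ℂ) : Prop :=
  ∀ (β : LinkPattern N) (x : ℕ → ℝ), IsChamber N x →
    coulomb N β x = ∑ᶠ α ∈ {α : LinkPattern N | MeanderOne N α β}, Z α x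

/-- A noncrossing perfect matching of `{1,…,2N}`, encoded as an involution of `ℕ` fixing exactly
the points outside `{1,…,2N}`. -/
@[ext]
structure NCInv (N : ℕ) where
  toFun : ℕ → ℕ
  invol : ∀ x, toFun (toFun x) = x
  fixed : ∀ x, toFun x ≠ x ↔ 1 ≤ x ∧ x ≤ 2 * N
  nc : ∀ x y, x < y → y < toFun x → ¬ toFun x < toFun y

namespace NCInv

variable {N : ℕ}

instance : CoeFun (NCInv N) (fun _ => ℕ → ℕ) := ⟨NCInv.toFun⟩

theorem ext' {α β : NCInv N} (h : ∀ x, α x = β x) : α = β := NCInv.ext (funext h)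

theorem inj (β : NCInv N) {x y : ℕ} (h : β x = β y) : x = y := by
  rw [← β.invol x, h, β.invol]

theorem mem_range (β : NCInv N) {x : ℕ} (h : 1 ≤ x ∧ x ≤ 2 * N) : 1 ≤ β x ∧ β x ≤ 2 * N := by
  have h1 := (β.fixed x).2 h
  refine (β.fixed (β x)).1 ?_
  rw [β.invol]
  exact h1.symm

theorem fix_of_gt (β : NCInv N) {x : ℕ} (h : 2 * N < x) : β x = x := by
  by_contra h1
  have := (β.fixed x).1 h1
  omega

theorem fix_zero (β : NCInv N) : β 0 = 0 := by
  by_contra h1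
  have := (β.fixed 0).1 h1
  omega

/-- Points of a link nested below another link have their partners below it too. -/
theorem nested (β : NCInv N) {x y : ℕ} (h1 : x < y) (h2 : y < β x) : x < β y ∧ β y < β x := by
  have a1 := β.nc x y h1 h2
  have a2 : β y ≠ β x := fun h => by have := β.inj h; omega
  have a3 : β y ≠ x := fun h => by have := β.invol y; rw [h] at this; omega
  by_contra hc
  have a4 : β y < x := by omega
  have := β.nc (β y) x a4 (by rw [β.invol]; omega)
  rw [β.invol] at this
  omega

/-- The gap `x` (between `x` and `x+1`) is covered by the link through `z`. -/
def Covers (β : NCInv N) (z x : ℕ) : Prop := (z ≤ x ∧ x < β z) ∨ (β z ≤ x ∧ x < z)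

/-- The set of points whose link covers the gap `x`. -/
def cov (β : NCInv N) (x : ℕ) : Set ℕ := {z | β.Covers z x}

theorem cov_eq_iff (β : NCInv N) {x y : ℕ} :
    β.cov x = β.cov y ↔ ∀ z, β.Covers z x ↔ β.Covers z y := Set.ext_iff

theorem covers_partner (β : NCInv N) (z x : ℕ) : β.Covers (β z) x ↔ β.Covers z x := by
  unfold Covers
  rw [β.invol]
  tauto

theorem cov_eq_of_le (β : NCInv N) {x y : ℕ} (h : ∀ z, z ≤ β z → (β.Covers z x ↔ β.Covers z y)) :
    β.cov x = β.cov y := by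
  rw [cov_eq_iff]
  intro z
  rcases le_total z (β z) with hz | hz
  · exact h z hz
  · rw [← β.covers_partner z x, ← β.covers_partner z y]
    exact h _ (by rw [β.invol]; exact hz)

/-- Crossing the point `m` and then its partner leads back to the same region. -/
theorem cov_partner (β : NCInv N) {k : ℕ} (hk : k + 1 ≤ 2 * N) :
    β.cov (β (k + 1)) = β.cov k := by
  refine β.cov_eq_of_le fun z hz => ?_
  have h1 := β.nested (x := z) (y := k + 1)
  have h2 := β.nested (x := z) (y := β (k + 1))
  have h3 := (β.fixed (k + 1)).2 ⟨by omega, hk⟩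
  have h5 : β z = β (k + 1) → z = k + 1 := β.inj
  have h10 : β z = k + 1 → β (k + 1) = z := fun h => by rw [← h, β.invol]
  have h8 := β.nested (x := k + 1) (y := z)
  have h9 := β.nested (x := β (k + 1)) (y := z)
  have h6 : z = β (k + 1) → β z = k + 1 := fun h => by rw [h, β.invol]
  rw [β.invol] at h2 h9
  unfold Covers
  have h7 : z = k + 1 → β z = β (k + 1) := fun h => by rw [h]
  omega

theorem cov_partner' (β : NCInv N) {k : ℕ} (hk : k + 1 ≤ 2 * N) :
    β.cov (β (k + 1) - 1) = β.cov (k + 1) := by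
  have h := β.mem_range (x := k + 1) ⟨by omega, hk⟩
  have := β.cov_partner (k := β (k + 1) - 1) (by omega)
  rw [Nat.sub_add_cancel h.1, β.invol] at this
  exact this.symm

theorem cov_zero (β : NCInv N) : β.cov 0 = ∅ := by
  ext z
  have := β.fix_zero
  have h2 : β z = 0 → z = 0 := fun h => by rw [← β.invol z, h, this]
  simp only [cov, Covers, Set.mem_ofPred_eq, Set.mem_empty_iff_false, iff_false]
  rcases Nat.eq_zero_or_pos z with h | h
  · subst h; omega
  · omega

theorem cov_last (β : NCInv N) {x : ℕ} (hx : 2 * N ≤ x) : β.cov x = ∅ := by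
  ext z
  simp only [cov, Covers, Set.mem_ofPred_eq, Set.mem_empty_iff_false, iff_false]
  by_cases h : 1 ≤ z ∧ z ≤ 2 * N
  · have := β.mem_range h; omega
  · have : β z = z := by by_contra h1; exact h ((β.fixed z).1 h1)
    omega

instance : Finite (NCInv N) := by
  refine Finite.of_injective
    (fun (β : NCInv N) (i : Fin (2 * N + 1)) => (⟨min (β i) (2 * N), by omega⟩ : Fin (2 * N + 1))) ?_
  intro α β h
  refine ext' fun x => ?_
  rcases Nat.lt_or_ge (2 * N) x with hx | hx
  · rw [α.fix_of_gt hx, β.fix_of_gt hx]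
  · have := congrFun h ⟨x, by omega⟩
    simp only [Fin.mk.injEq] at this
    rcases Nat.eq_zero_or_pos x with h0 | h0
    · subst h0; rw [α.fix_zero, β.fix_zero]
    · have h1 := α.mem_range ⟨h0, hx⟩
      have h2 := β.mem_range ⟨h0, hx⟩
      omega

noncomputable instance : Fintype (NCInv N) := Fintype.ofFinite _

/-- The openers of `β`. -/
def openers (β : NCInv N) : Finset ℕ := (Finset.Icc 1 (2 * N)).filter fun x => x < β x

theorem card_openers (β : NCInv N) : β.openers.card = N := by
  have h1 : ((Finset.Icc 1 (2 * N)).filter fun x => ¬ x < β x).card = β.openers.card := by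
    refine Finset.card_nbij' β β ?_ ?_ (fun x _ => β.invol x) (fun x _ => β.invol x)
    · intro x hx
      simp only [openers, Finset.coe_filter, Finset.mem_Icc, Set.mem_ofPred_eq] at hx ⊢
      have := β.mem_range hx.1
      have := (β.fixed x).2 hx.1
      rw [β.invol]
      omega
    · intro x hx
      simp only [openers, Finset.coe_filter, Finset.mem_Icc, Set.mem_ofPred_eq] at hx ⊢
      have := β.mem_range hx.1
      rw [β.invol]
      omega
  have h2 := Finset.card_filter_add_card_filter_not (s := Finset.Icc 1 (2 * N)) (fun x => x < β x)
  rw [h1, Nat.card_Icc] at h2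
  unfold openers at *
  omega

/-- Every region is entered by an opener, or is the unbounded one. -/
theorem exists_opener (β : NCInv N) (x : ℕ) :
    ∃ o ∈ insert 0 β.openers, β.cov o = β.cov x ∧ o ≤ x := by
  induction x using Nat.strong_induction_on with
  | _ x ih =>
    rcases Nat.eq_zero_or_pos x with h0 | h0
    · exact ⟨0, by simp, by rw [h0], by omega⟩
    rcases Nat.lt_or_ge (2 * N) x with h1 | h1
    · exact ⟨0, by simp, by rw [β.cov_zero, β.cov_last h1.le], by omega⟩
    rcases Nat.lt_or_ge x (β x) with h2 | h2
    · exact ⟨x, by simp [openers]; omega, rfl, le_rfl⟩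
    · have h3 := (β.fixed x).2 ⟨h0, h1⟩
      obtain ⟨o, ho, h4, h5⟩ := ih (β x - 1) (by omega)
      refine ⟨o, ho, h4.trans ?_, by omega⟩
      have := β.cov_partner' (k := x - 1) (by omega)
      rwa [Nat.sub_add_cancel h0] at this

theorem injOn_openers (β : NCInv N) : Set.InjOn β.cov (insert 0 β.openers : Finset ℕ) := by
  have key : ∀ x y, x < y → y ∈ (insert 0 β.openers : Finset ℕ) → β.cov x ≠ β.cov y := by
    intro x y hxy hy h
    have := (β.cov_eq_iff.1 h) y
    simp only [openers, Finset.mem_insert, Finset.mem_filter] at hy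
    unfold Covers at this
    omega
  intro x hx y hy h
  rcases lt_trichotomy x y with h1 | h1 | h1
  · exact absurd h (key x y h1 hy)
  · exact h1
  · exact absurd h.symm (key y x h1 hx)

theorem card_le (β : NCInv N) {T : Finset ℕ} (hT : Set.InjOn β.cov T) : T.card ≤ N + 1 := by
  choose o ho h1 h2 using β.exists_opener
  have : T.card ≤ (insert 0 β.openers).card :=
    Finset.card_le_card_of_injOn o (fun x _ => ho x) fun x hx y hy h =>
      hT hx hy (by rw [← h1 x, ← h1 y, h])
  have h3 := Finset.card_insert_le 0 β.openers
  rw [β.card_openers] at h3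
  omega

theorem exists_mem_cov_eq (β : NCInv N) {T : Finset ℕ} (hT : Set.InjOn β.cov T)
    (hc : T.card = N + 1) (x : ℕ) : ∃ t ∈ T, β.cov t = β.cov x := by
  by_contra h
  push Not at h
  have hx : x ∉ T := fun hx => h x hx rfl
  have : Set.InjOn β.cov (insert x T : Finset ℕ) := by
    rw [Finset.coe_insert, Set.injOn_insert (by simpa using hx)]
    refine ⟨hT, ?_⟩
    rintro ⟨t, ht, h2⟩
    exact h t ht h2
  have := β.card_le this
  rw [Finset.card_insert_of_notMem hx] at this
  omega

theorem cov_ne_of_link (β : NCInv N) {k x : ℕ} (hk : β k = k + 1) (h : β.cov x = β.cov k) :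
    x = k := by
  have := (β.cov_eq_iff.1 h) k
  unfold Covers at this
  omega

/-- The gaps in `T` lie in pairwise distinct regions. -/
def Sep (β : NCInv N) (T : Finset ℕ) : Prop := Set.InjOn β.cov T

open Classical in
/-- The indicator that the gaps in `T` lie in pairwise distinct regions. -/
noncomputable def ind (β : NCInv N) (T : Finset ℕ) : ℝ := if β.Sep T then 1 else 0

theorem ind_of_sep (β : NCInv N) {T : Finset ℕ} (h : β.Sep T) : β.ind T = 1 := if_pos h

theorem ind_of_not_sep (β : NCInv N) {T : Finset ℕ} (h : ¬ β.Sep T) : β.ind T = 0 := if_neg h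

theorem sep_of_ind_ne_zero (β : NCInv N) {T : Finset ℕ} (h : β.ind T ≠ 0) : β.Sep T := by
  by_contra h1
  exact h (β.ind_of_not_sep h1)

theorem ind_congr {M : ℕ} {β : NCInv N} {α : NCInv M} {T S : Finset ℕ} (h : β.Sep T ↔ α.Sep S) :
    β.ind T = α.ind S := by
  by_cases h1 : β.Sep T
  · rw [β.ind_of_sep h1, α.ind_of_sep (h.1 h1)]
  · rw [β.ind_of_not_sep h1, α.ind_of_not_sep (mt h.2 h1)]

theorem ind_of_link (β : NCInv N) {k : ℕ} (hk : β k = k + 1) {T : Finset ℕ}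
    (hc : T.card = N + 1) (hkT : k ∉ T) : β.ind T = 0 := by
  refine β.ind_of_not_sep fun hT => ?_
  obtain ⟨t, ht, h⟩ := β.exists_mem_cov_eq hT hc k
  exact hkT (β.cov_ne_of_link hk h ▸ ht)

theorem ind_openers (β : NCInv N) : β.ind (insert 0 β.openers) = 1 :=
  β.ind_of_sep β.injOn_openers

theorem ind_nonneg (β : NCInv N) (T : Finset ℕ) : 0 ≤ β.ind T := by
  unfold ind
  split_ifs <;> norm_num

end NCInv

namespace NCInv

variable {N : ℕ}

/-- Both ends of a link lie on the same side of any other link. -/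
theorem between (β : NCInv N) {p q : ℕ} (_ : q ≠ p) (_ : q ≠ β p) :
    (p < q ∧ q < β p ∨ β p < q ∧ q < p) ↔
      (p < β q ∧ β q < β p ∨ β p < β q ∧ β q < p) := by
  have a1 := β.nested (x := p) (y := q)
  have a2 := β.nested (x := β p) (y := q)
  have a3 := β.nested (x := p) (y := β q)
  have a4 := β.nested (x := β p) (y := β q)
  simp only [β.invol] at a1 a2 a3 a4
  omega

/-- The underlying function of the Temperley–Lieb generator applied to a matching. -/
def eFun (f : ℕ → ℕ) (k x : ℕ) : ℕ :=
  if x = k then k + 1 else if x = k + 1 then k else if x = f k then f (k + 1)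
    else if x = f (k + 1) then f k else f x

/-- The Temperley–Lieb generator: link `k` with `k + 1`, and their former partners together. -/
def e (β : NCInv N) (k : ℕ) (hk : 1 ≤ k ∧ k + 1 ≤ 2 * N) : NCInv N where
  toFun := eFun β k
  invol := by
    intro x
    have h1 := β.invol x
    have h2 := β.invol k
    have h3 := β.invol (k + 1)
    have h4 : β k = β (k + 1) → k = k + 1 := β.inj
    have h5 := (β.fixed k).2 (by omega)
    have h6 := (β.fixed (k + 1)).2 (by omega)
    have h7 : β x = β k → x = k := β.inj
    have h8 : β x = β (k + 1) → x = k + 1 := β.inj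
    have h9 : β x = k → x = β k := fun h => by rw [← h, h1]
    have h10 : β x = k + 1 → x = β (k + 1) := fun h => by rw [← h, h1]
    have h11 : β k = k + 1 → β (k + 1) = k := fun h => by rw [← h, h2]
    have h12 : β (k + 1) = k → β k = k + 1 := fun h => by rw [← h3, h]
    unfold eFun
    grind
  fixed := by
    intro x
    have h2 := β.invol k
    have h3 := β.invol (k + 1)
    have h4 : β k = β (k + 1) → k = k + 1 := β.inj
    have h5 := (β.fixed k).2 (by omega)
    have h6 := (β.fixed (k + 1)).2 (by omega)
    have h7 := β.fixed x
    have h8 := β.mem_range (x := k) (by omega)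
    have h9 := β.mem_range (x := k + 1) (by omega)
    unfold eFun
    split_ifs <;> omega
  nc := by
    intro x y
    have h4 : β k = β (k + 1) → k = k + 1 := β.inj
    have h5 := (β.fixed k).2 (by omega)
    have h6 := (β.fixed (k + 1)).2 (by omega)
    have b1 := β.nc x y
    have b2 := β.between (p := x) (q := k)
    have b3 := β.between (p := x) (q := k + 1)
    have b4 := β.between (p := y) (q := k)
    have b5 := β.between (p := y) (q := k + 1)
    have h7 : β x = β k → x = k := β.inj
    have h8 : β x = β (k + 1) → x = k + 1 := β.inj
    have h9 : β x = k → x = β k := fun h => by rw [← h, β.invol]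
    have h10 : β x = k + 1 → x = β (k + 1) := fun h => by rw [← h, β.invol]
    have h7 : β y = β k → y = k := β.inj
    have h8 : β y = β (k + 1) → y = k + 1 := β.inj
    have h9 : β y = k → y = β k := fun h => by rw [← h, β.invol]
    have h10 : β y = k + 1 → y = β (k + 1) := fun h => by rw [← h, β.invol]
    unfold eFun
    split_ifs <;> omega

theorem e_apply (β : NCInv N) (k : ℕ) (hk) (x : ℕ) : β.e k hk x = eFun β k x := rfl

theorem e_self (β : NCInv N) (k : ℕ) (hk) : β.e k hk k = k + 1 := by simp [e_apply, eFun]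

/-- Insert two new points after position `k - 1`. -/
def shift (k x : ℕ) : ℕ := if x < k then x else x + 2

/-- Delete the points `k` and `k + 1`. -/
def unshift (k x : ℕ) : ℕ := if x < k then x else x - 2

theorem unshift_shift (k x : ℕ) : unshift k (shift k x) = x := by
  unfold unshift shift; split_ifs <;> omega

theorem shift_unshift {k x : ℕ} (h1 : x ≠ k) (h2 : x ≠ k + 1) : shift k (unshift k x) = x := by
  unfold unshift shift; split_ifs <;> omega

theorem shift_ne (k x : ℕ) : shift k x ≠ k ∧ shift k x ≠ k + 1 := by
  unfold shift; split_ifs <;> omega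

theorem shift_lt {k x y : ℕ} : shift k x < shift k y ↔ x < y := by
  unfold shift; split_ifs <;> omega

theorem shift_inj {k x y : ℕ} : shift k x = shift k y ↔ x = y := by
  unfold shift; split_ifs <;> omega

theorem shift_range {k x n : ℕ} (hk : 1 ≤ k ∧ k + 1 ≤ 2 * (n + 1)) :
    (1 ≤ shift k x ∧ shift k x ≤ 2 * (n + 1)) ↔ (1 ≤ x ∧ x ≤ 2 * n) := by
  unfold shift; split_ifs <;> omega

/-- Insert an innermost link `{k, k + 1}`. -/
def cup (α : NCInv N) (k : ℕ) (hk : 1 ≤ k ∧ k + 1 ≤ 2 * (N + 1)) : NCInv (N + 1) where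
  toFun x := if x = k then k + 1 else if x = k + 1 then k else shift k (α (unshift k x))
  invol := by
    intro x
    have := shift_ne k (α (unshift k x))
    by_cases h1 : x = k
    · simp [h1]
    by_cases h2 : x = k + 1
    · simp [h2]
    simp only [h1, h2, this.1, this.2, if_false, unshift_shift, α.invol]
    exact shift_unshift h1 h2
  fixed := by
    intro x
    by_cases h1 : x = k
    · simp [h1]; omega
    by_cases h2 : x = k + 1
    · simp [h2]; omega
    simp only [h1, h2, if_false]
    rw [← shift_unshift h1 h2, unshift_shift, Ne, shift_inj, shift_range hk]
    exact α.fixed _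
  nc := by
    intro x y
    have s1 := shift_ne k (α (unshift k x))
    have s2 := shift_ne k (α (unshift k y))
    by_cases h1 : x = k
    · simp [h1]; omega
    by_cases h2 : x = k + 1
    · simp [h2]; omega
    by_cases h3 : y = k
    · simp [h1, h2, h3]
    by_cases h4 : y = k + 1
    · simp [h1, h2, h4]; omega
    simp only [h1, h2, h3, h4, if_false]
    rw [← shift_unshift h1 h2, ← shift_unshift h3 h4, unshift_shift, unshift_shift, shift_lt,
      shift_lt, shift_lt]
    exact α.nc _ _

theorem cup_self (α : NCInv N) (k : ℕ) (hk) : α.cup k hk k = k + 1 := by simp [cup]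

theorem cup_succ (α : NCInv N) (k : ℕ) (hk) : α.cup k hk (k + 1) = k := by simp [cup]

theorem cup_shift (α : NCInv N) (k : ℕ) (hk) (x : ℕ) :
    α.cup k hk (shift k x) = shift k (α x) := by
  simp [cup, (shift_ne k x).1, (shift_ne k x).2, unshift_shift]

/-- Link the partners of `k` and `k + 1` and delete these two points. -/
def cap (β : NCInv (N + 1)) (k : ℕ) (hk : 1 ≤ k ∧ k + 1 ≤ 2 * (N + 1)) : NCInv N where
  toFun x := unshift k (β.e k hk (shift k x))
  invol := by
    intro x
    have h0 := shift_ne k x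
    have h1 : β.e k hk (shift k x) ≠ k := fun h => h0.2 (by
      rw [← (β.e k hk).invol (shift k x), h, e_self])
    have h2 : β.e k hk (shift k x) ≠ k + 1 := fun h => h0.1 ((β.e k hk).inj (by
      rw [h, e_self]))
    rw [shift_unshift h1 h2, (β.e k hk).invol, unshift_shift]
  fixed := by
    intro x
    have h0 := shift_ne k x
    have h1 : β.e k hk (shift k x) ≠ k := fun h => h0.2 (by
      rw [← (β.e k hk).invol (shift k x), h, e_self])
    have h2 : β.e k hk (shift k x) ≠ k + 1 := fun h => h0.1 ((β.e k hk).inj (by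
      rw [h, e_self]))
    rw [← shift_range hk, ← (β.e k hk).fixed, Ne, Ne, ← shift_inj (k := k), shift_unshift h1 h2]
  nc := by
    have h1 : ∀ x, β.e k hk (shift k x) ≠ k := fun x h => (shift_ne k x).2 (by
      rw [← (β.e k hk).invol (shift k x), h, e_self])
    have h2 : ∀ x, β.e k hk (shift k x) ≠ k + 1 := fun x h => (shift_ne k x).1
      ((β.e k hk).inj (by rw [h, e_self]))
    intro x y
    have := (β.e k hk).nc (shift k x) (shift k y)
    rw [← shift_unshift (h1 x) (h2 x), ← shift_unshift (h1 y) (h2 y), shift_lt, shift_lt,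
      shift_lt] at this
    exact this

theorem cup_cap (β : NCInv (N + 1)) (k : ℕ) (hk) : (β.cap k hk).cup k hk = β.e k hk := by
  refine ext' fun x => ?_
  by_cases h1 : x = k
  · rw [h1, cup_self, e_self]
  by_cases h2 : x = k + 1
  · rw [h2, cup_succ]
    exact (by rw [← e_self β k hk, NCInv.invol] : β.e k hk (k + 1) = k).symm
  rw [← shift_unshift h1 h2, cup_shift]
  refine shift_unshift (fun h => ?_) fun h => ?_
  · exact (shift_ne k (unshift k x)).2 (by
      rw [← (β.e k hk).invol (shift k (unshift k x)), h, e_self])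
  · exact (shift_ne k (unshift k x)).1 ((β.e k hk).inj (by rw [h, e_self]))

theorem cap_apply (β : NCInv (N + 1)) (k : ℕ) (hk) (x : ℕ) :
    β.cap k hk x = unshift k (eFun β k (shift k x)) := rfl

theorem e_eq_self (β : NCInv N) {k : ℕ} (hk) (h : β k = k + 1) : β.e k hk = β := by
  refine ext' fun x => ?_
  have h1 : β (k + 1) = k := by rw [← h, β.invol]
  rw [e_apply]
  unfold eFun
  split_ifs with a b c d
  · rw [a, h]
  · rw [b, h1]
  · omega
  · omega
  · rfl

theorem exists_cup_eq (β : NCInv (N + 1)) {k : ℕ} (hk) (h : β k = k + 1) :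
    (β.cap k hk).cup k hk = β := by rw [cup_cap, e_eq_self _ _ h]

/-- Zigzag relation. -/
theorem cap_cup_succ (α : NCInv N) (k : ℕ) (hk) (hk') : (α.cup (k + 1) hk').cap k hk = α := by
  refine ext' fun x => ?_
  have f1 : α.cup (k + 1) hk' (k + 1) = k + 1 + 1 := cup_self _ _ _
  have f2 : α.cup (k + 1) hk' k = shift (k + 1) (α k) := by
    have := cup_shift α (k + 1) hk' k
    rwa [show shift (k + 1) k = k by simp [shift]] at this
  rw [cap_apply]
  unfold eFun
  rw [f1, f2]
  have a0 := (shift_ne k x)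
  rw [if_neg a0.1, if_neg a0.2]
  by_cases h : shift k x = k + 1 + 1
  · have : x = k := by unfold shift at h; split_ifs at h <;> omega
    subst this
    have h3 := (α.fixed x).2 (by omega)
    rw [h, if_pos rfl]
    split_ifs with h1
    · exfalso; unfold shift at h1; split_ifs at h1 <;> omega
    · unfold shift unshift; split_ifs <;> omega
  · have hx : shift k x = shift (k + 1) x := by
      unfold shift at h ⊢; split_ifs at h ⊢ <;> omega
    have hx2 : x ≠ k := fun h1 => h (by rw [h1]; simp [shift])
    rw [if_neg h, hx]
    simp only [shift_inj, cup_shift]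
    by_cases h4 : x = α k
    · rw [if_pos h4, h4, α.invol]
      simp only [unshift]; split_ifs <;> omega
    · rw [if_neg h4]
      have h5 : α x ≠ k := fun h => h4 (by rw [← h, α.invol])
      unfold shift unshift; split_ifs <;> omega

theorem e_cup_succ (α : NCInv N) (k : ℕ) (hk) (hk') :
    (α.cup (k + 1) hk').e k hk = α.cup k hk := by
  rw [← cup_cap, cap_cup_succ]

/-- Every matching has an innermost link starting in its first half. -/
theorem exists_innermost (α : NCInv (N + 1)) : ∃ k, 1 ≤ k ∧ k ≤ N + 1 ∧ α k = k + 1 := by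
  classical
  have hex : ∃ m, 1 ≤ m ∧ α m < m := by
    refine ⟨2 * (N + 1), by omega, ?_⟩
    have := α.mem_range (x := 2 * (N + 1)) (by omega)
    have := (α.fixed (2 * (N + 1))).2 (by omega)
    omega
  set m := Nat.find hex with hm
  obtain ⟨h1, h2⟩ : 1 ≤ m ∧ α m < m := Nat.find_spec hex
  have h3 : ∀ x, 1 ≤ x → x < m → ¬ α x < x := fun x hx hxm h => Nat.find_min hex hxm ⟨hx, h⟩
  have h4 : m ≤ 2 * (N + 1) := by
    by_contra h
    rw [α.fix_of_gt (by omega)] at h2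
    omega
  have h5 := α.mem_range (x := m) ⟨h1, h4⟩
  have h6 : α m + 1 = m := by
    by_contra h
    have a := h3 (m - 1) (by omega) (by omega)
    have b := (α.fixed (m - 1)).2 (by omega)
    have c := α.nested (x := α m) (y := m - 1) (by omega) (by rw [α.invol]; omega)
    rw [α.invol] at c
    omega
  refine ⟨α m, h5.1, ?_, by rw [α.invol, h6]⟩
  have h7 : (Finset.Icc 1 (α m)).card ≤ (Finset.Icc (α m + 1) (2 * (N + 1))).card := by
    refine Finset.card_le_card_of_injOn α ?_ fun x _ y _ h => α.inj h
    intro x hx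
    simp only [Finset.coe_Icc, Set.mem_Icc] at hx ⊢
    have a := h3 x hx.1 (by omega)
    have b := α.mem_range (x := x) (by omega)
    have c := h3 (α x) b.1
    rw [α.invol] at c
    have d := (α.fixed x).2 (by omega)
    omega
  simp only [Nat.card_Icc] at h7
  omega

/-- The graph formed by two matchings is connected. -/
def Conn (α β : NCInv N) : Prop :=
  ∀ S : Set ℕ, (∀ x ∈ S, α x ∈ S ∧ β x ∈ S) → (∃ x ∈ S, 1 ≤ x ∧ x ≤ 2 * N) →
    ∀ x, 1 ≤ x → x ≤ 2 * N → x ∈ S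

theorem conn_comm (α β : NCInv N) : α.Conn β ↔ β.Conn α := by
  unfold Conn
  constructor
  · exact fun h S hS => h S fun x hx => (hS x hx).symm
  · exact fun h S hS => h S fun x hx => (hS x hx).symm

theorem e_shift_ne (β : NCInv N) (k : ℕ) (hk) (x : ℕ) :
    β.e k hk (shift k x) ≠ k ∧ β.e k hk (shift k x) ≠ k + 1 := by
  refine ⟨fun h => (shift_ne k x).2 ?_, fun h => (shift_ne k x).1 ((β.e k hk).inj ?_)⟩
  · rw [← (β.e k hk).invol (shift k x), h, e_self]
  · rw [h, e_self]

theorem shift_cap (β : NCInv (N + 1)) (k : ℕ) (hk) (x : ℕ) :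
    shift k (β.cap k hk x) = eFun β k (shift k x) :=
  shift_unshift (β.e_shift_ne k hk x).1 (β.e_shift_ne k hk x).2

theorem not_conn_cup (α : NCInv N) (β : NCInv (N + 1)) (hN : 1 ≤ N) {k : ℕ} (hk)
    (h : β k = k + 1) : ¬ (α.cup k hk).Conn β := by
  intro hc
  have h1 : β (k + 1) = k := by rw [← h, β.invol]
  have := hc {k, k + 1} (by
    intro x hx
    rcases hx with rfl | rfl
    · rw [cup_self, h]; simp
    · rw [cup_succ, h1]; simp) ⟨k, by simp, by omega, by omega⟩
  have a := this 1 (by omega) (by omega)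
  have b := this 3 (by omega) (by omega)
  have c := this 2 (by omega) (by omega)
  simp at a b c
  omega

theorem conn_cup (α : NCInv N) (β : NCInv (N + 1)) {k : ℕ} (hk)
    (h : β k ≠ k + 1) : (α.cup k hk).Conn β ↔ α.Conn (β.cap k hk) := by
  have hb := β.invol k
  have hb1 := β.invol (k + 1)
  have hb2 : β k ≠ k := (β.fixed k).2 (by omega)
  have hb3 : β (k + 1) ≠ k + 1 := (β.fixed (k + 1)).2 (by omega)
  have hb4 : β (k + 1) ≠ k := fun h1 => h (by rw [← h1, hb1, h1])
  have hb5 : β k ≠ β (k + 1) := fun h => by have := β.inj h; omega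
  constructor
  · intro hc S hS ⟨x0, hx0, hx0r⟩
    set S' : Set ℕ := {y | if y = k ∨ y = k + 1 then unshift k (β k) ∈ S else unshift k y ∈ S}
      with hS'
    have hd : unshift k (β k) ∈ S ↔ unshift k (β (k + 1)) ∈ S := by
      have a1 : β.cap k hk (unshift k (β k)) = unshift k (β (k + 1)) := by
        rw [cap_apply, shift_unshift hb2 h]
        simp [eFun, hb2, h]
      have a2 : β.cap k hk (unshift k (β (k + 1))) = unshift k (β k) := by
        rw [← a1, (β.cap k hk).invol]
      exact ⟨fun h => a1 ▸ (hS _ h).2, fun h => a2 ▸ (hS _ h).2⟩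
    have key : ∀ x, shift k x ∈ S' ↔ x ∈ S := by
      intro x
      simp [hS', (shift_ne k x).1, (shift_ne k x).2, unshift_shift]
    have := hc S' (by
      intro y hy
      by_cases h1 : y = k
      · subst h1
        simp only [hS', Set.mem_ofPred_eq, true_or, if_true] at hy
        rw [cup_self]
        simp [hS', hy, hb2, h]
      by_cases h2 : y = k + 1
      · subst h2
        simp only [hS', Set.mem_ofPred_eq, or_true, if_true] at hy
        rw [cup_succ]
        simp [hS', hy, hb4, hb3, ← hd]
      rw [← shift_unshift h1 h2] at hy ⊢
      set z := unshift k y with hz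
      rw [key] at hy
      rw [cup_shift, key]
      refine ⟨(hS z hy).1, ?_⟩
      have a1 := (hS z hy).2
      rw [← key, shift_cap] at a1
      unfold eFun at a1
      rw [if_neg (shift_ne k z).1, if_neg (shift_ne k z).2] at a1
      split_ifs at a1 with a b
      · rw [← unshift_shift k z, a] at hy
        rw [a, hb]; simp [hS', hy]
      · rw [← unshift_shift k z, b] at hy
        rw [b, hb1]; simp [hS', hd, hy]
      · exact a1) ⟨shift k x0, (key x0).2 hx0, (shift_range hk).2 hx0r⟩
    intro x h1 h2
    have a := (shift_range hk).2 ⟨h1, h2⟩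
    exact (key x).1 (this _ a.1 a.2)
  · intro hc S hS ⟨x0, hx0, hx0r⟩
    have hm : ∀ x, x ∈ S ↔ β x ∈ S := fun x =>
      ⟨fun h => (hS x h).2, fun h => by have := (hS _ h).2; rwa [β.invol] at this⟩
    have hkk : k ∈ S ↔ k + 1 ∈ S := by
      constructor
      · intro h; have := (hS _ h).1; rwa [cup_self] at this
      · intro h; have := (hS _ h).1; rwa [cup_succ] at this
    have hne : ∃ y ∈ S, (1 ≤ y ∧ y ≤ 2 * (N + 1)) ∧ y ≠ k ∧ y ≠ k + 1 := by
      by_cases h1 : x0 = k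
      · exact ⟨β k, (hm _).1 (h1 ▸ hx0), β.mem_range (h1 ▸ hx0r), hb2, h⟩
      by_cases h2 : x0 = k + 1
      · exact ⟨β (k + 1), (hm _).1 (h2 ▸ hx0), β.mem_range (h2 ▸ hx0r), hb4, hb3⟩
      exact ⟨x0, hx0, hx0r, h1, h2⟩
    obtain ⟨y, hy, hyr, hy1, hy2⟩ := hne
    have := hc {x | shift k x ∈ S} (by
      intro x hx
      simp only [Set.mem_ofPred_eq] at hx ⊢
      have a := (hS _ hx)
      rw [cup_shift] at a
      refine ⟨a.1, ?_⟩
      rw [shift_cap]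
      unfold eFun
      rw [if_neg (shift_ne k x).1, if_neg (shift_ne k x).2]
      split_ifs with h1 h2
      · rw [h1] at hx; rwa [← hm, ← hkk, hm]
      · rw [h2] at hx; rwa [← hm, hkk, hm]
      · exact a.2) ⟨unshift k y, by
        simp only [Set.mem_ofPred_eq]; rwa [shift_unshift hy1 hy2], by
        rw [← shift_range hk, shift_unshift hy1 hy2]; exact hyr⟩
    have hall : ∀ x, (1 ≤ x ∧ x ≤ 2 * (N + 1)) → x ≠ k → x ≠ k + 1 → x ∈ S := by
      intro x hx h1 h2
      have a := hx
      rw [← shift_unshift h1 h2, shift_range hk] at a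
      have b := this _ a.1 a.2
      simp only [Set.mem_ofPred_eq] at b
      rwa [shift_unshift h1 h2] at b
    have hkS : k ∈ S := (hm k).2 (hall _ (β.mem_range (by omega)) hb2 h)
    intro x h1 h2
    by_cases h3 : x = k
    · rwa [h3]
    by_cases h4 : x = k + 1
    · rw [h4]; exact hkk.1 hkS
    exact hall x ⟨h1, h2⟩ h3 h4

end NCInv

namespace NCInv

variable {N : ℕ}

theorem covers_e_other (β : NCInv N) {k : ℕ} (hk) {z : ℕ} (x : ℕ) (h1 : z ≠ k) (h2 : z ≠ k + 1)
    (h3 : z ≠ β k) (h4 : z ≠ β (k + 1)) : (β.e k hk).Covers z x ↔ β.Covers z x := by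
  unfold Covers
  simp only [e_apply, eFun, h1, h2, h3, h4, if_false]

theorem covers_e_partner (β : NCInv N) {k : ℕ} (hk) {x : ℕ} (hx : x ≠ k) (hb : β k ≠ k + 1) :
    (β.e k hk).Covers (β k) x ↔ ¬ (β.Covers k x ↔ β.Covers (k + 1) x) := by
  have hb2 : β k ≠ k := (β.fixed k).2 (by omega)
  have hb3 : β (k + 1) ≠ k + 1 := (β.fixed (k + 1)).2 (by omega)
  have hb4 : β (k + 1) ≠ k := fun h1 => hb (by rw [← h1, β.invol, h1])
  unfold Covers
  rw [e_apply]
  unfold eFun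
  rw [if_neg hb2, if_neg hb, if_pos rfl]
  have b := β.between (p := k) (q := k + 1) (by omega) (Ne.symm hb)
  omega

theorem cov_e_eq_iff (β : NCInv N) {k : ℕ} (hk) (hb : β k ≠ k + 1) {x y : ℕ} (hx : x ≠ k)
    (hy : y ≠ k) : (β.e k hk).cov x = (β.e k hk).cov y ↔
      (∀ z, z ≠ k → z ≠ k + 1 → z ≠ β k → z ≠ β (k + 1) → (β.Covers z x ↔ β.Covers z y)) ∧
      (¬ (β.Covers k x ↔ β.Covers (k + 1) x) ↔ ¬ (β.Covers k y ↔ β.Covers (k + 1) y)) := by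
  have hb2 : β k ≠ k := (β.fixed k).2 (by omega)
  rw [cov_eq_iff]
  constructor
  · intro h
    refine ⟨fun z h1 h2 h3 h4 => ?_, ?_⟩
    · rw [← β.covers_e_other hk x h1 h2 h3 h4, ← β.covers_e_other hk y h1 h2 h3 h4]
      exact h z
    · rw [← β.covers_e_partner hk hx hb, ← β.covers_e_partner hk hy hb]
      exact h _
  · rintro ⟨h1, h2⟩ z
    have a : ∀ w, w ≠ k → ¬ (β.e k hk).Covers k w := by
      intro w hw
      unfold Covers
      rw [e_self]
      omega
    rw [← β.covers_e_partner hk hx hb, ← β.covers_e_partner hk hy hb] at h2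
    by_cases c1 : z = k
    · rw [c1]; simp [a x hx, a y hy]
    by_cases c2 : z = k + 1
    · rw [c2, ← β.e_self k hk, covers_partner, covers_partner]; simp [a x hx, a y hy]
    by_cases c3 : z = β k
    · rw [c3]; exact h2
    by_cases c4 : z = β (k + 1)
    · have : z = β.e k hk (β k) := by
        rw [c4, e_apply]
        simp [eFun, hb2, hb]
      rw [this, covers_partner, covers_partner]
      exact h2
    rw [β.covers_e_other hk x c1 c2 c3 c4, β.covers_e_other hk y c1 c2 c3 c4]
    exact h1 z c1 c2 c3 c4

theorem cov_eq_iff_split (β : NCInv N) (k : ℕ) {x y : ℕ} : β.cov x = β.cov y ↔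
      (∀ z, z ≠ k → z ≠ k + 1 → z ≠ β k → z ≠ β (k + 1) → (β.Covers z x ↔ β.Covers z y)) ∧
      (β.Covers k x ↔ β.Covers k y) ∧ (β.Covers (k + 1) x ↔ β.Covers (k + 1) y) := by
  rw [cov_eq_iff]
  refine ⟨fun h => ⟨fun z _ _ _ _ => h z, h _, h _⟩, ?_⟩
  rintro ⟨h1, h2, h3⟩ z
  by_cases c1 : z = k
  · rw [c1]; exact h2
  by_cases c2 : z = k + 1
  · rw [c2]; exact h3
  by_cases c3 : z = β k
  · rw [c3, covers_partner, covers_partner]; exact h2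
  by_cases c4 : z = β (k + 1)
  · rw [c4, covers_partner, covers_partner]; exact h3
  exact h1 z c1 c2 c3 c4

theorem cov_e_of_cov (β : NCInv N) {k : ℕ} (hk) (hb : β k ≠ k + 1) {x y : ℕ} (hx : x ≠ k)
    (hy : y ≠ k) (h : β.cov x = β.cov y) : (β.e k hk).cov x = (β.e k hk).cov y := by
  rw [cov_e_eq_iff β hk hb hx hy]
  rw [cov_eq_iff_split β k] at h
  obtain ⟨h1, h2, h3⟩ := h
  exact ⟨h1, by rw [h2, h3]⟩

theorem covers_pred_succ (β : NCInv N) {k : ℕ} (hk : 1 ≤ k ∧ k + 1 ≤ 2 * N)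
    (hb : β k ≠ k + 1) :
    (β.Covers k (k - 1) ↔ ¬ β.Covers k k) ∧ (β.Covers k (k + 1) ↔ β.Covers k k) ∧
    (β.Covers (k + 1) (k - 1) ↔ β.Covers (k + 1) k) ∧
    (β.Covers (k + 1) (k + 1) ↔ ¬ β.Covers (k + 1) k) := by
  have hb2 : β k ≠ k := (β.fixed k).2 (by omega)
  have hb3 : β (k + 1) ≠ k + 1 := (β.fixed (k + 1)).2 (by omega)
  have hb4 : β (k + 1) ≠ k := fun h1 => hb (by rw [← h1, β.invol, h1])
  unfold Covers
  omega

theorem covers_other_pred_succ (β : NCInv N) {k : ℕ} (z : ℕ) (h1 : z ≠ k) (h2 : z ≠ k + 1)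
    (h3 : z ≠ β k) (h4 : z ≠ β (k + 1)) :
    (β.Covers z (k - 1) ↔ β.Covers z k) ∧ (β.Covers z (k + 1) ↔ β.Covers z k) := by
  have h5 : β z ≠ k := fun h => h3 (by rw [← h, β.invol])
  have h6 : β z ≠ k + 1 := fun h => h4 (by rw [← h, β.invol])
  unfold Covers
  omega

theorem cov_e_pred_succ (β : NCInv N) {k : ℕ} (hk) (hb : β k ≠ k + 1) :
    (β.e k hk).cov (k - 1) = (β.e k hk).cov (k + 1) := by
  rw [cov_e_eq_iff β hk hb (by omega) (by omega)]
  obtain ⟨a, b, c, d⟩ := β.covers_pred_succ hk hb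
  refine ⟨fun z h1 h2 h3 h4 => ?_, ?_⟩
  · have := β.covers_other_pred_succ z h1 h2 h3 h4
    rw [this.1, this.2]
  · rw [a, b, c, d]
    tauto

theorem cov_pred_ne_succ (β : NCInv N) {k : ℕ} (hk : 1 ≤ k ∧ k + 1 ≤ 2 * N) (hb : β k ≠ k + 1) :
    β.cov (k - 1) ≠ β.cov (k + 1) := by
  rw [Ne, cov_eq_iff_split β k]
  obtain ⟨a, b, c, d⟩ := β.covers_pred_succ hk hb
  rw [a, b, c, d]
  tauto

theorem covers_of_split (β : NCInv N) {k x y z : ℕ} (h1 : z ≠ k) (h3 : z ≠ β k)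
    (h : β.Covers z x ↔ β.Covers z y) (hP : ¬ (β.Covers k x ↔ β.Covers k y)) :
    β.Covers z x ↔ β.Covers z k := by
  have b := β.between (p := z) (q := k) (Ne.symm h1) (fun h => h3 (by rw [h, β.invol]))
  have h5 : β z ≠ k := fun h => h3 (by rw [← h, β.invol])
  unfold Covers at *
  omega

theorem covers_succ_of_split (β : NCInv N) {k u : ℕ} (hk : k + 1 ≤ 2 * N) (hb : β k ≠ k + 1)
    (hu : β.Covers k u ↔ ¬ β.Covers k k) : β.Covers (k + 1) u ↔ β.Covers (k + 1) k := by
  have b := β.between (p := k) (q := k + 1) (by omega) (Ne.symm hb)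
  have hb3 : β (k + 1) ≠ k + 1 := (β.fixed (k + 1)).2 (by omega)
  have hb4 : β (k + 1) ≠ k := fun h1 => hb (by rw [← h1, β.invol, h1])
  have c := β.nested (x := β k) (y := β (k + 1))
  have d := β.nested (x := β (k + 1)) (y := β k)
  rw [β.invol, β.invol] at c d
  unfold Covers at *
  omega

theorem cov_of_cov_e (β : NCInv N) {k : ℕ} (hk) (hb : β k ≠ k + 1) {x y : ℕ} (hx : x ≠ k)
    (hy : y ≠ k) (h : (β.e k hk).cov x = (β.e k hk).cov y) : β.cov x = β.cov y ∨
      (β.cov x = β.cov (k - 1) ∧ β.cov y = β.cov (k + 1)) ∨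
      (β.cov y = β.cov (k - 1) ∧ β.cov x = β.cov (k + 1)) := by
  rw [cov_e_eq_iff β hk hb hx hy] at h
  obtain ⟨h1, h2⟩ := h
  rw [cov_eq_iff_split β k]
  by_cases hP : β.Covers k x ↔ β.Covers k y
  · refine Or.inl ⟨h1, hP, ?_⟩
    by_cases β.Covers (k + 1) x <;> by_cases β.Covers (k + 1) y <;> by_cases β.Covers k y <;>
      simp_all
  right
  have hb2 : β k ≠ k := (β.fixed k).2 (by omega)
  have hb3 : β (k + 1) ≠ k + 1 := (β.fixed (k + 1)).2 (by omega)
  have hb4 : β (k + 1) ≠ k := fun h1 => hb (by rw [← h1, β.invol, h1])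
  have hR : ∀ z, z ≠ k → z ≠ k + 1 → z ≠ β k → z ≠ β (k + 1) →
      (β.Covers z x ↔ β.Covers z k) ∧ (β.Covers z y ↔ β.Covers z k) := by
    intro z c1 c2 c3 c4
    have a := h1 z c1 c2 c3 c4
    have b := β.covers_of_split c1 c3 a hP
    exact ⟨b, a.symm.trans b⟩
  have key : ∀ u v : ℕ, (∀ z, z ≠ k → z ≠ k + 1 → z ≠ β k → z ≠ β (k + 1) →
      (β.Covers z u ↔ β.Covers z k) ∧ (β.Covers z v ↔ β.Covers z k)) →
      (β.Covers k u ↔ ¬ β.Covers k k) → (β.Covers k v ↔ β.Covers k k) →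
      (¬ (β.Covers k u ↔ β.Covers (k + 1) u) ↔ ¬ (β.Covers k v ↔ β.Covers (k + 1) v)) →
      β.cov u = β.cov (k - 1) ∧ β.cov v = β.cov (k + 1) := by
    intro u v hR hu hv hX
    have hQ := β.covers_succ_of_split hk.2 hb hu
    have hQ' : β.Covers (k + 1) v ↔ ¬ β.Covers (k + 1) k := by
      clear hR h1 h2 hP
      by_cases β.Covers (k + 1) v <;> by_cases β.Covers (k + 1) k <;> by_cases β.Covers k k <;>
        simp_all
    obtain ⟨a, b, c, d⟩ := β.covers_pred_succ hk hb
    rw [cov_eq_iff_split β k, cov_eq_iff_split β k, a, b, c, d]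
    refine ⟨⟨fun z c1 c2 c3 c4 => ?_, hu, hQ⟩, fun z c1 c2 c3 c4 => ?_, hv, hQ'⟩
    · rw [(hR z c1 c2 c3 c4).1, (β.covers_other_pred_succ z c1 c2 c3 c4).1]
    · rw [(hR z c1 c2 c3 c4).2, (β.covers_other_pred_succ z c1 c2 c3 c4).2]
  have hs : (β.Covers k y ↔ ¬ β.Covers k k) ∧ (β.Covers k x ↔ β.Covers k k) ∨
      (β.Covers k x ↔ ¬ β.Covers k k) ∧ (β.Covers k y ↔ β.Covers k k) := by
    clear hR key h1 h2
    by_cases β.Covers k x <;> by_cases β.Covers k y <;> by_cases β.Covers k k <;> simp_all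
  rcases hs with hs | hs
  · exact Or.inr (key y x (fun z c1 c2 c3 c4 => (hR z c1 c2 c3 c4).symm) hs.1 hs.2 h2.symm)
  · exact Or.inl (key x y hR hs.1 hs.2 h2)

theorem sep_insert_iff (β : NCInv N) {T : Finset ℕ} {x : ℕ} (hx : x ∉ T) :
    β.Sep (insert x T) ↔
      β.Sep T ∧ ∀ t ∈ T, β.cov t ≠ β.cov x := by
  unfold Sep
  rw [Finset.coe_insert, Set.injOn_insert (by simpa using hx)]
  simp

theorem sep_e_iff (β : NCInv N) {k : ℕ} (hk) (hb : β k ≠ k + 1) {T : Finset ℕ} (hkT : k ∉ T) :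
    (β.e k hk).Sep (insert k T) ↔ β.Sep T ∧
      ¬ ((∃ t ∈ T, β.cov t = β.cov (k - 1)) ∧ ∃ t ∈ T, β.cov t = β.cov (k + 1)) := by
  have hne : ∀ t ∈ T, t ≠ k := fun t ht h => hkT (h ▸ ht)
  rw [sep_insert_iff _ hkT]
  constructor
  · rintro ⟨h1, -⟩
    refine ⟨fun x hx y hy h => h1 hx hy (β.cov_e_of_cov hk hb (hne x hx) (hne y hy) h), ?_⟩
    rintro ⟨⟨t, ht, h2⟩, s, hs, h3⟩
    have a := β.cov_e_of_cov hk hb (hne t ht) (by omega) h2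
    have b := β.cov_e_of_cov hk hb (hne s hs) (by omega) h3
    rw [β.cov_e_pred_succ hk hb, ← b] at a
    have := h1 ht hs a
    subst this
    exact β.cov_pred_ne_succ hk hb (h2.symm.trans h3)
  · rintro ⟨h1, h2⟩
    refine ⟨fun x hx y hy h => ?_, fun t ht h => hne t ht
      ((β.e k hk).cov_ne_of_link (e_self _ _ _) h)⟩
    rcases β.cov_of_cov_e hk hb (hne x hx) (hne y hy) h with h3 | h3 | h3
    · exact h1 hx hy h3
    · exact absurd ⟨⟨x, hx, h3.1⟩, y, hy, h3.2⟩ h2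
    · exact absurd ⟨⟨y, hy, h3.1⟩, x, hx, h3.2⟩ h2

open Classical in
theorem ite_ind_insert (β : NCInv N) (T : Finset ℕ) (x : ℕ) :
    (if x ∈ T then 0 else β.ind (insert x T)) = if β.Sep T ∧
      ¬ (∃ t ∈ T, β.cov t = β.cov x) then 1 else 0 := by
  by_cases h : x ∈ T
  · rw [if_pos h, if_neg]
    exact fun h1 => h1.2 ⟨x, h, rfl⟩
  · rw [if_neg h]
    unfold ind
    rw [β.sep_insert_iff h]
    push Not
    congr

/-- Action of the Temperley–Lieb generator on the indicators of separated sets of gaps. -/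
theorem ind_e (β : NCInv N) {k : ℕ} (hk) (hb : β k ≠ k + 1) {T : Finset ℕ} (hT : T.card = N)
    (hkT : k ∉ T) :
    (if k - 1 ∈ T then 0 else β.ind (insert (k - 1) T)) +
      (if k + 1 ∈ T then 0 else β.ind (insert (k + 1) T)) = (β.e k hk).ind (insert k T) := by
  classical
  rw [ite_ind_insert, ite_ind_insert, ind, sep_e_iff β hk hb hkT]
  have h : ¬ (β.Sep T ∧ (¬ ∃ t ∈ T, β.cov t = β.cov (k - 1)) ∧
      ¬ ∃ t ∈ T, β.cov t = β.cov (k + 1)) := by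
    rintro ⟨h1, h2, h3⟩
    have a : β.Sep (insert (k - 1) T) := by
      rw [sep_insert_iff _ fun h => h2 ⟨_, h, rfl⟩]
      exact ⟨h1, fun t ht h => h2 ⟨t, ht, h⟩⟩
    have n1 : k - 1 ∉ T := fun h => h2 ⟨_, h, rfl⟩
    have n2 : k + 1 ∉ insert (k - 1) T := by
      rw [Finset.mem_insert]
      rintro (h | h)
      · omega
      · exact h3 ⟨_, h, rfl⟩
    have b : β.Sep (insert (k + 1) (insert (k - 1) T)) := by
      rw [sep_insert_iff _ n2]
      refine ⟨a, fun t ht h => ?_⟩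
      rw [Finset.mem_insert] at ht
      rcases ht with rfl | ht
      · exact β.cov_pred_ne_succ hk hb h
      · exact h3 ⟨t, ht, h⟩
    have := β.card_le b
    rw [Finset.card_insert_of_notMem n2, Finset.card_insert_of_notMem n1] at this
    omega
  by_cases h1 : β.Sep T <;> by_cases h2 : ∃ t ∈ T, β.cov t = β.cov (k - 1) <;>
    by_cases h3 : ∃ t ∈ T, β.cov t = β.cov (k + 1) <;> simp only [h1, h2, h3] at h ⊢ <;> simp at h ⊢

theorem ind_e_both (β : NCInv N) {k : ℕ} (hk) (hb : β k ≠ k + 1) {T : Finset ℕ}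
    (hkT : k ∉ T) (h1 : k - 1 ∉ T) (h2 : k + 1 ∉ T) :
    β.ind (insert (k - 1) (insert (k + 1) T)) = (β.e k hk).ind (insert k (insert (k - 1) T)) := by
  have n1 : k - 1 ∉ insert (k + 1) T := by
    rw [Finset.mem_insert]
    rintro (h | h)
    · omega
    · exact h1 h
  have n2 : k ∉ insert (k - 1) T := by
    rw [Finset.mem_insert]
    rintro (h | h)
    · omega
    · exact hkT h
  refine ind_congr ?_
  rw [sep_e_iff β hk hb n2, sep_insert_iff _ n1, sep_insert_iff _ h2, sep_insert_iff _ h1]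
  have := β.cov_pred_ne_succ hk hb
  constructor
  · rintro ⟨⟨a, b⟩, c⟩
    simp only [Finset.mem_insert, forall_eq_or_imp, exists_eq_or_imp] at c ⊢
    refine ⟨⟨a, c.2⟩, fun h => ?_⟩
    rcases h.2 with h | ⟨t, ht, h⟩
    · exact this h
    · exact b t ht h
  · rintro ⟨⟨a, b⟩, c⟩
    simp only [Finset.mem_insert, forall_eq_or_imp, exists_eq_or_imp] at c ⊢
    refine ⟨⟨a, fun t ht h => c ⟨Or.inl trivial, Or.inr ⟨t, ht, h⟩⟩⟩, this.symm, b⟩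

theorem covers_cup_shift (α : NCInv N) {k : ℕ} (hk) (z x : ℕ) :
    (α.cup k hk).Covers (shift k z) (shift k x) ↔ α.Covers z x := by
  unfold Covers
  rw [cup_shift, shift_lt, shift_lt, ← not_lt, ← not_lt, shift_lt, shift_lt, not_lt, not_lt]

theorem cov_cup_iff (α : NCInv N) {k : ℕ} (hk) (x y : ℕ) :
    (α.cup k hk).cov (shift k x) = (α.cup k hk).cov (shift k y) ↔ α.cov x = α.cov y := by
  rw [cov_eq_iff, cov_eq_iff]
  constructor
  · intro h z
    rw [← covers_cup_shift α hk, ← covers_cup_shift α hk]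
    exact h _
  · intro h z
    have key : ∀ w, ¬ (α.cup k hk).Covers k (shift k w) := by
      intro w
      unfold Covers
      rw [cup_self]
      have := shift_ne k w
      omega
    by_cases h1 : z = k
    · rw [h1]; simp [key]
    by_cases h2 : z = k + 1
    · rw [h2, ← α.cup_self k hk, covers_partner, covers_partner]; simp [key]
    rw [← shift_unshift h1 h2, covers_cup_shift, covers_cup_shift]
    exact h _

theorem ind_cup (α : NCInv N) {k : ℕ} (hk) (T : Finset ℕ) :
    (α.cup k hk).ind (insert k (T.image (shift k))) = α.ind T := by
  have n1 : k ∉ T.image (shift k) := by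
    rw [Finset.mem_image]
    rintro ⟨x, -, h⟩
    exact (shift_ne k x).1 h
  refine ind_congr ?_
  rw [sep_insert_iff _ n1]
  constructor
  · rintro ⟨h, -⟩ x hx y hy hxy
    have := h (by simpa using ⟨x, hx, rfl⟩) (by simpa using ⟨y, hy, rfl⟩)
      ((cov_cup_iff α hk x y).2 hxy)
    exact shift_inj.1 this
  · intro h
    refine ⟨?_, fun t ht h => n1 ((cov_ne_of_link _ (cup_self _ _ _) h) ▸ ht)⟩
    intro x hx y hy hxy
    simp only [Finset.coe_image, Set.mem_image] at hx hy
    obtain ⟨x, hx, rfl⟩ := hx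
    obtain ⟨y, hy, rfl⟩ := hy
    rw [cov_cup_iff] at hxy
    rw [h hx hy hxy]

end NCInv

namespace NCInv

variable {N : ℕ}

theorem odd_partner_aux (β : NCInv N) {k : ℕ} (h : k < β k) : Odd (k + β k) := by
  have h1 : ∑ x ∈ Finset.Ioo k (β k), (1 : ZMod 2) = 0 := by
    refine Finset.sum_involution (fun x _ => β x) (fun _ _ => by decide) ?_ ?_ fun x _ => β.invol x
    · intro x hx _
      rw [Finset.mem_Ioo] at hx
      have hk := (β.fixed k).1 (by omega)
      have := β.mem_range hk
      exact (β.fixed x).2 (by omega)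
    · intro x hx
      rw [Finset.mem_Ioo] at hx ⊢
      exact β.nested hx.1 hx.2
  rw [Finset.sum_const, Nat.card_Ioo, nsmul_one, ZMod.natCast_eq_zero_iff] at h1
  rw [Nat.odd_iff]
  omega

theorem odd_partner (β : NCInv N) {k : ℕ} (h : β k ≠ k) : Odd (k + β k) := by
  rcases lt_or_gt_of_ne h with h1 | h1
  · have := β.odd_partner_aux (k := β k) (by rwa [β.invol])
    rwa [β.invol, add_comm] at this
  · exact β.odd_partner_aux h1

theorem eq_of_openers_eq {α β : NCInv N} (h : α.openers = β.openers) : α = β := by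
  have h0 : ∀ x, x < α x ↔ x < β x := by
    intro x
    by_cases hx : 1 ≤ x ∧ x ≤ 2 * N
    · have := Finset.ext_iff.1 h x
      simpa [openers, hx] using this
    · rw [not_not.1 (mt (α.fixed x).1 hx), not_not.1 (mt (β.fixed x).1 hx)]
  have key : ∀ (α β : NCInv N), (∀ x, x < α x ↔ x < β x) → ∀ x,
      (∀ m < x, α m < m → α m = β m) → α x < β x → β x < x → False := by
    intro α β h0 x ih h1 h2
    have a1 := α.nested (x := α x) (y := β x) h1 (by rwa [α.invol])
    rw [α.invol] at a1
    have a2 := (h0 (β x)).2 (by rwa [β.invol])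
    have a3 := ih (α (β x)) a1.2 (by rwa [α.invol])
    rw [α.invol] at a3
    have a4 := congrArg β a3
    rw [β.invol, β.invol] at a4
    omega
  have main : ∀ x, α x < x → α x = β x := by
    intro x
    induction x using Nat.strong_induction_on with
    | _ x ih =>
      intro hx
      have b1 : β x < x := by
        have c1 := (α.fixed x).1 (by omega)
        have c2 := (β.fixed x).2 c1
        have c3 := h0 x
        omega
      rcases lt_trichotomy (α x) (β x) with h1 | h1 | h1
      · exact (key α β h0 x ih h1 b1).elim
      · exact h1
      · refine (key β α (fun z => (h0 z).symm) x (fun m hm h2 => (ih m hm ?_).symm) h1 hx).elim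
        have c1 := (β.fixed m).1 (by omega)
        have c2 := (α.fixed m).2 c1
        have c3 := h0 m
        omega
  refine ext' fun x => ?_
  rcases lt_trichotomy (α x) x with h1 | h1 | h1
  · exact main x h1
  · by_contra h2
    rw [h1] at h2
    exact (α.fixed x).2 ((β.fixed x).1 (Ne.symm h2)) h1
  · have := main (α x) (by rwa [α.invol])
    rw [α.invol] at this
    have := congrArg β this
    rwa [β.invol, eq_comm] at this

theorem sum_openers_lt (β : NCInv N) {T : Finset ℕ} (hT : β.Sep T) (hc : T.card = N + 1) :
    ∑ x ∈ insert 0 β.openers, x < ∑ x ∈ T, x ∨ insert 0 β.openers = T := by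
  choose o ho h1 h2 using β.exists_opener
  have hinj : Set.InjOn o T := fun x hx y hy h => hT hx hy (by rw [← h1 x, ← h1 y, h])
  have himg : T.image o = insert 0 β.openers := by
    refine Finset.eq_of_subset_of_card_le (fun x hx => ?_) ?_
    · obtain ⟨t, -, rfl⟩ := Finset.mem_image.1 hx
      exact ho t
    · rw [Finset.card_image_of_injOn hinj, hc]
      exact (Finset.card_insert_le _ _).trans_eq (by rw [β.card_openers])
  by_cases h : ∀ t ∈ T, o t = t
  · right
    rw [← himg]
    exact (Finset.image_congr h).trans Finset.image_id
  · left
    push Not at h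
    obtain ⟨t, ht, h3⟩ := h
    rw [← himg, Finset.sum_image hinj]
    exact Finset.sum_lt_sum (fun i _ => h2 i) ⟨t, ht, lt_of_le_of_ne (h2 t) h3⟩

/-- The pairing of a vector indexed by matchings with the indicator of `T`. -/
noncomputable def pairing (y : NCInv N → ℝ) (T : Finset ℕ) : ℝ := ∑ β, y β * β.ind T

theorem pairing_ite (y : NCInv N → ℝ) (p : Prop) [Decidable p] (T : Finset ℕ) :
    (if p then 0 else pairing y T) = ∑ β, y β * (if p then 0 else β.ind T) := by
  split_ifs <;> simp [pairing]

open Classical in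
theorem pairing_hop {y : NCInv (N + 1) → ℝ}
    (h : ∀ k hk (α : NCInv N), ∑ β, (if β k ≠ k + 1 ∧ β.cap k hk = α then y β else 0) = 0)
    {T : Finset ℕ} (hT : T.card = N + 1) {k : ℕ} (hk : 1 ≤ k ∧ k + 1 ≤ 2 * (N + 1))
    (hkT : k ∉ T) :
    (if k - 1 ∈ T then 0 else pairing y (insert (k - 1) T)) +
      (if k + 1 ∈ T then 0 else pairing y (insert (k + 1) T)) = 0 := by
  rw [pairing_ite, pairing_ite, ← Finset.sum_add_distrib]
  have h1 : ∀ β : NCInv (N + 1), y β * (if k - 1 ∈ T then 0 else β.ind (insert (k - 1) T)) +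
      y β * (if k + 1 ∈ T then 0 else β.ind (insert (k + 1) T)) =
      ∑ α : NCInv N, (α.cup k hk).ind (insert k T) *
        (if β k ≠ k + 1 ∧ β.cap k hk = α then y β else 0) := by
    intro β
    rw [← mul_add]
    by_cases hb : β k = k + 1
    · have a1 : ∀ z, z ∉ T → z ≠ k → β.ind (insert z T) = 0 := fun z hz hzk =>
        β.ind_of_link hb (by rw [Finset.card_insert_of_notMem hz, hT]) (by
          rw [Finset.mem_insert]; rintro (h | h)
          · exact hzk h.symm
          · exact hkT h)
      have a2 : (if k - 1 ∈ T then 0 else β.ind (insert (k - 1) T)) = 0 := by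
        split_ifs with h
        · rfl
        · exact a1 _ h (by omega)
      have a3 : (if k + 1 ∈ T then 0 else β.ind (insert (k + 1) T)) = 0 := by
        split_ifs with h
        · rfl
        · exact a1 _ h (by omega)
      rw [a2, a3]
      simp [hb]
    · rw [β.ind_e hk hb hT hkT]
      simp only [hb, ne_eq, not_false_eq_true, true_and, mul_ite, mul_zero]
      rw [Finset.sum_ite_eq]
      simp [cup_cap, mul_comm]
  simp_rw [h1]
  rw [Finset.sum_comm]
  refine Finset.sum_eq_zero fun α _ => ?_
  rw [← Finset.mul_sum, h k hk α, mul_zero]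

theorem sep_insert_pair (β : NCInv N) {k : ℕ} {T : Finset ℕ} (h1 : k ∉ T) (h2 : k + 1 ∉ T) :
    β.Sep (insert k (insert (k + 1) T)) ↔ β.Sep T ∧ (∀ t ∈ T, β.cov t ≠ β.cov (k + 1)) ∧
      (∀ t ∈ T, β.cov t ≠ β.cov k) ∧ β.cov (k + 1) ≠ β.cov k := by
  rw [sep_insert_iff, sep_insert_iff _ h2]
  · simp only [Finset.mem_insert, forall_eq_or_imp]
    tauto
  · rw [Finset.mem_insert]
    rintro (h | h)
    · omega
    · exact h1 h

/-- The gaps `0` and `N + 2, …, 2N - 1`. -/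
def tailGaps (N : ℕ) : Finset ℕ := insert 0 (Finset.Ioo (N + 1) (2 * N))

theorem mem_tailGaps {N x : ℕ} : x ∈ tailGaps N ↔ x = 0 ∨ (N + 1 < x ∧ x < 2 * N) := by
  simp [tailGaps]

theorem sum_ind_pair (β : NCInv N) :
    ∑ k ∈ Finset.Icc 1 N, (-1) ^ k * β.ind (insert k (insert (k + 1) (tailGaps N))) = 0 := by
  classical
  have hs : ∑ k ∈ (Finset.Icc 1 N).filter fun k => β.Sep (insert k (insert (k + 1) (tailGaps N))),
      (-1 : ℝ) ^ k * β.ind (insert k (insert (k + 1) (tailGaps N))) =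
      ∑ k ∈ Finset.Icc 1 N, (-1) ^ k * β.ind (insert k (insert (k + 1) (tailGaps N))) :=
    Finset.sum_filter_of_ne fun k _ h => β.sep_of_ind_ne_zero (right_ne_zero_of_mul h)
  rw [← hs]
  have key : ∀ k, 1 ≤ k → k ≤ N → β.Sep (insert k (insert (k + 1) (tailGaps N))) →
      1 ≤ β (k + 1) - 1 ∧ β (k + 1) - 1 ≤ N ∧
        β.Sep (insert (β (k + 1) - 1) (insert (β (k + 1) - 1 + 1) (tailGaps N))) ∧
        Odd (k + 1 + β (k + 1)) := by
    intro k hk1 hk2 hs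
    have c1 := β.cov_partner (k := k) (by omega)
    have c2 := β.cov_partner' (k := k) (by omega)
    have r := β.mem_range (x := k + 1) (by omega)
    rw [sep_insert_pair _ (by rw [mem_tailGaps]; omega) (by rw [mem_tailGaps]; omega)] at hs
    obtain ⟨s0, s1, s2, s3⟩ := hs
    have hm1 : β (k + 1) ∉ tailGaps N := fun h => s2 _ h c1
    have hm2 : β (k + 1) - 1 ∉ tailGaps N := fun h => s1 _ h c2
    have hm3 : β (k + 1) ≠ 2 * N := fun h => s2 0 (by rw [mem_tailGaps]; omega) (by
      rw [← c1, h, cov_zero, cov_last _ le_rfl])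
    rw [sep_insert_pair _ hm2 (by rwa [Nat.sub_add_cancel r.1]), Nat.sub_add_cancel r.1, c1, c2]
    rw [mem_tailGaps] at hm1 hm2
    exact ⟨by omega, by omega, ⟨s0, s2, s1, s3.symm⟩, β.odd_partner ((β.fixed _).2 (by omega))⟩
  refine Finset.sum_involution (fun k _ => β (k + 1) - 1) ?_ ?_ ?_ ?_
  · intro k hk
    simp only [Finset.mem_filter, Finset.mem_Icc] at hk
    obtain ⟨a, b, c, d⟩ := key k hk.1.1 hk.1.2 hk.2
    rw [β.ind_of_sep c, β.ind_of_sep hk.2]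
    rcases Nat.even_or_odd k with e | e
    · have : Odd (β (k + 1) - 1) := by
        rw [Nat.odd_iff] at *; rw [Nat.even_iff] at e; omega
      rw [e.neg_one_pow, this.neg_one_pow]; norm_num
    · have : Even (β (k + 1) - 1) := by
        rw [Nat.even_iff]; rw [Nat.odd_iff] at *; omega
      rw [e.neg_one_pow, this.neg_one_pow]; norm_num
  · intro k hk _
    simp only [Finset.mem_filter, Finset.mem_Icc] at hk
    obtain ⟨a, b, c, d⟩ := key k hk.1.1 hk.1.2 hk.2
    rw [Nat.odd_iff] at d
    omega
  · intro k hk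
    simp only [Finset.mem_filter, Finset.mem_Icc] at hk ⊢
    obtain ⟨a, b, c, d⟩ := key k hk.1.1 hk.1.2 hk.2
    exact ⟨⟨a, b⟩, c⟩
  · intro k hk
    simp only [Finset.mem_filter, Finset.mem_Icc] at hk
    obtain ⟨a, b, c, d⟩ := key k hk.1.1 hk.1.2 hk.2
    rw [Nat.sub_add_cancel (by omega), β.invol]
    omega

open Classical in
theorem pairing_eq_zero {y : NCInv (N + 1) → ℝ} (hN : 1 ≤ N)
    (h : ∀ k hk (α : NCInv N), ∑ β, (if β k ≠ k + 1 ∧ β.cap k hk = α then y β else 0) = 0)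
    {T : Finset ℕ} (hT : T.card = N + 2) (h0 : 0 ∈ T) (hT2 : ∀ t ∈ T, t < 2 * (N + 1)) :
    pairing y T = 0 := by
  have blocked : ∀ T : Finset ℕ, T.card = N + 2 → ∀ x, x ∈ T → x + 1 ∉ T → x + 2 ∈ T →
      x + 2 ≤ 2 * (N + 1) → pairing y T = 0 := by
    intro T hT x h1 h2 h3 h4
    have := pairing_hop h (T := T.erase x) (by rw [Finset.card_erase_of_mem h1]; omega)
      (k := x + 1) (by omega) (by simp [h2])
    rwa [Nat.add_sub_cancel, if_neg (by simp), Finset.insert_erase h1,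
      if_pos (Finset.mem_erase.2 ⟨by omega, h3⟩), add_zero] at this
  have hop : ∀ T : Finset ℕ, T.card = N + 2 → ∀ x, x ∈ T → x + 1 ∉ T → x + 2 ∉ T →
      x + 2 ≤ 2 * (N + 1) → pairing y T = - pairing y (insert (x + 2) (T.erase x)) := by
    intro T hT x h1 h2 h3 h4
    have := pairing_hop h (T := T.erase x) (by rw [Finset.card_erase_of_mem h1]; omega)
      (k := x + 1) (by omega) (by simp [h2])
    rw [Nat.add_sub_cancel, if_neg (by simp), Finset.insert_erase h1,
      if_neg (by simp [h3])] at this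
    linarith
  have last : ∀ T : Finset ℕ, T.card = N + 2 → 0 ∈ T → 2 * (N + 1) ∈ T → pairing y T = 0 := by
    intro T _ h0 h1
    refine Finset.sum_eq_zero fun β _ => ?_
    rw [β.ind_of_not_sep, mul_zero]
    intro hs
    have := hs h0 h1 (by rw [cov_zero, cov_last _ le_rfl])
    omega
  set g : ℕ → ℝ := fun k => pairing y (insert k (insert (k + 1) (tailGaps (N + 1)))) with hg
  have hcard : ∀ k m, 1 ≤ k → k < m → m ≤ N + 2 →
      (insert k (insert m (tailGaps (N + 1)))).card = N + 2 := by
    intro k m h1 h2 h3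
    rw [Finset.card_insert_of_notMem, Finset.card_insert_of_notMem, tailGaps,
      Finset.card_insert_of_notMem, Nat.card_Ioo]
    · omega
    · simp
    · rw [mem_tailGaps]; omega
    · rw [Finset.mem_insert, mem_tailGaps]; omega
  have g_step : ∀ k, 1 ≤ k → k + 2 ≤ N + 1 → g k = g (k + 2) := by
    intro k h1 h2
    have e1 : insert (k + 1 + 2) ((insert k (insert (k + 1) (tailGaps (N + 1)))).erase (k + 1)) =
        insert k (insert (k + 3) (tailGaps (N + 1))) := by
      ext z; simp only [Finset.mem_insert, Finset.mem_erase, mem_tailGaps]; omega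
    have e2 : insert (k + 2) ((insert k (insert (k + 3) (tailGaps (N + 1)))).erase k) =
        insert (k + 2) (insert (k + 2 + 1) (tailGaps (N + 1))) := by
      ext z; simp only [Finset.mem_insert, Finset.mem_erase, mem_tailGaps]; omega
    simp only [hg]
    rw [hop _ (hcard k (k + 1) h1 (by omega) (by omega)) (k + 1) (by simp)
      (by simp only [Finset.mem_insert, mem_tailGaps]; omega)
      (by simp only [Finset.mem_insert, mem_tailGaps]; omega) (by omega), e1,
      hop _ (hcard k (k + 3) h1 (by omega) (by omega)) k (by simp)
      (by simp only [Finset.mem_insert, mem_tailGaps]; omega)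
      (by simp only [Finset.mem_insert, mem_tailGaps]; omega) (by omega), e2, neg_neg]
  have g_two : g 2 = 0 := blocked _ (hcard 2 3 (by omega) (by omega) (by omega)) 0
    (by simp [mem_tailGaps]) (by simp only [Finset.mem_insert, mem_tailGaps]; omega)
    (by simp) (by omega)
  have g_all : ∀ k, 1 ≤ k → k ≤ N + 1 → g k = if Even k then 0 else g 1 := by
    intro k
    induction k using Nat.strong_induction_on with
    | _ k ih =>
      intro h1 h2
      rcases Nat.lt_or_ge k 3 with h3 | h3
      · interval_cases k
        · simp
        · simpa using g_two
      · have a1 := g_step (k - 2) (by omega) (by omega)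
        have a2 := ih (k - 2) (by omega) (by omega) (by omega)
        rw [Nat.sub_add_cancel (by omega)] at a1
        rw [← a1, a2]
        have : Even (k - 2) ↔ Even k := by rw [Nat.even_iff, Nat.even_iff]; omega
        simp [this]
  have g_sum : ∑ k ∈ Finset.Icc 1 (N + 1), (-1) ^ k * g k = 0 := by
    simp only [hg, pairing, Finset.mul_sum]
    rw [Finset.sum_comm]
    refine Finset.sum_eq_zero fun β _ => ?_
    have := β.sum_ind_pair
    calc _ = y β * ∑ k ∈ Finset.Icc 1 (N + 1),
        (-1) ^ k * β.ind (insert k (insert (k + 1) (tailGaps (N + 1)))) := by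
          rw [Finset.mul_sum]
          exact Finset.sum_congr rfl fun k _ => by ring
      _ = 0 := by rw [this, mul_zero]
  have g_one : g 1 = 0 := by
    have e : ∑ k ∈ Finset.Icc 1 (N + 1), (-1) ^ k * g k =
        -((((Finset.Icc 1 (N + 1)).filter fun k => ¬ Even k).card : ℝ) * g 1) := by
      rw [← nsmul_eq_mul, ← Finset.sum_const, Finset.sum_filter, ← Finset.sum_neg_distrib]
      refine Finset.sum_congr rfl fun k hk => ?_
      rw [Finset.mem_Icc] at hk
      rw [g_all k hk.1 hk.2]
      split_ifs with h1
      · simp_all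
      · rw [(Nat.not_even_iff_odd.1 h1).neg_one_pow]; ring
    rw [e, neg_eq_zero] at g_sum
    refine (mul_eq_zero.1 g_sum).resolve_left ?_
    refine Nat.cast_ne_zero.2 ?_
    rw [← Nat.pos_iff_ne_zero, Finset.card_pos]
    exact ⟨1, by simp⟩
  have g_zero : ∀ k, 1 ≤ k → k ≤ N + 1 → g k = 0 := by
    intro k h1 h2
    rw [g_all k h1 h2, g_one, ite_self]
  have main : ∀ d : ℕ, ∀ T : Finset ℕ, T.card = N + 2 → 0 ∈ T → (∀ t ∈ T, t < 2 * (N + 1)) →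
      ∑ t ∈ T, (2 * (N + 1) - t) = d → pairing y T = 0 := by
    intro d
    induction d using Nat.strong_induction_on with
    | _ d ih =>
      intro T hT h0 hT2 hd
      by_cases hx : ∃ x ∈ T, x ≠ 0 ∧ x + 1 ∉ T ∧ x + 1 < 2 * (N + 1)
      · obtain ⟨x, hx, hx0, hx1, hx2⟩ := hx
        by_cases hx3 : x + 2 ∈ T
        · exact blocked T hT x hx hx1 hx3 (hT2 _ hx3).le
        · rw [hop T hT x hx hx1 hx3 (by omega), neg_eq_zero]
          have hn : x + 2 ∉ T.erase x := by simp [hx3]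
          have hc : (insert (x + 2) (T.erase x)).card = N + 2 := by
            rw [Finset.card_insert_of_notMem hn, Finset.card_erase_of_mem hx]; omega
          by_cases hx4 : x + 2 = 2 * (N + 1)
          · exact last _ hc (by simp [h0, hx0.symm]) (by simp [hx4])
          · refine ih _ ?_ _ hc (by simp [h0, hx0.symm]) ?_ rfl
            · rw [← hd, Finset.sum_insert hn, ← Finset.add_sum_erase T _ hx]
              omega
            · intro t ht
              rw [Finset.mem_insert, Finset.mem_erase] at ht
              rcases ht with rfl | ht
              · omega
              · exact hT2 t ht.2
      · push Not at hx
        have hup : ∀ x ∈ T, x ≠ 0 → ∀ j, x + j < 2 * (N + 1) → x + j ∈ T := by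
          intro x hx1 hx2 j
          induction j with
          | zero => intro _; exact hx1
          | succ j ihj =>
            intro hj
            by_contra hc
            have := hx (x + j) (ihj (by omega)) (by omega) hc
            omega
        have hT' : T = insert 0 (Finset.Ico (N + 1) (2 * (N + 1))) := by
          have hsub : insert 0 (Finset.Ico (N + 1) (2 * (N + 1))) ⊆ T := by
            intro z hz
            simp only [Finset.mem_insert, Finset.mem_Ico] at hz
            rcases hz with rfl | hz
            · exact h0
            by_contra hzT
            have hsub2 : T.erase 0 ⊆ Finset.Ioo z (2 * (N + 1)) := by
              intro t ht
              rw [Finset.mem_erase] at ht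
              rw [Finset.mem_Ioo]
              refine ⟨?_, hT2 t ht.2⟩
              by_contra hc
              have := hup t ht.2 ht.1 (z - t) (by omega)
              rw [Nat.add_sub_cancel' (by omega)] at this
              exact hzT this
            have := Finset.card_le_card hsub2
            rw [Finset.card_erase_of_mem h0, Nat.card_Ioo] at this
            omega
          refine (Finset.eq_of_subset_of_card_le hsub ?_).symm
          rw [hT, Finset.card_insert_of_notMem (by simp), Nat.card_Ico]
          omega
        have := g_zero (N + 1) (by omega) le_rfl
        simp only [hg] at this
        rw [← this, hT']
        congr 1
        ext z
        simp only [Finset.mem_insert, mem_tailGaps, Finset.mem_Ico]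
        omega
  exact main _ T hT h0 hT2 rfl

open Classical in
theorem eq_zero_of_cap_sums {y : NCInv (N + 1) → ℝ} (hN : 1 ≤ N)
    (h : ∀ k hk (α : NCInv N), ∑ β, (if β k ≠ k + 1 ∧ β.cap k hk = α then y β else 0) = 0)
    (β : NCInv (N + 1)) : y β = 0 := by
  have key : ∀ d : ℕ, ∀ β : NCInv (N + 1), ∑ x ∈ insert 0 β.openers, x = d → y β = 0 := by
    intro d
    induction d using Nat.strong_induction_on with
    | _ d ih =>
      intro β hd
      have h1 : pairing y (insert 0 β.openers) = 0 := by
        refine pairing_eq_zero hN h ?_ (by simp) ?_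
        · rw [Finset.card_insert_of_notMem (by simp [openers]), card_openers]
        · intro t ht
          simp only [openers, Finset.mem_insert, Finset.mem_filter, Finset.mem_Icc] at ht
          rcases ht with rfl | ht
          · omega
          · have := β.mem_range ht.1
            omega
      rw [pairing, Finset.sum_eq_single β, ind_openers, mul_one] at h1
      · exact h1
      · intro α _ hne
        by_cases hs : α.Sep (insert 0 β.openers)
        · rcases α.sum_openers_lt hs (by
            rw [Finset.card_insert_of_notMem (by simp [openers]), card_openers]) with h2 | h2
          · rw [ih _ (hd ▸ h2) α rfl, zero_mul]
          · refine absurd (eq_of_openers_eq ?_) hne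
            have a1 : 0 ∉ α.openers := by simp [openers]
            have a2 : 0 ∉ β.openers := by simp [openers]
            rw [← Finset.erase_insert a1, h2, Finset.erase_insert a2]
        · rw [α.ind_of_not_sep hs, mul_zero]
      · simp
  exact key _ β rfl

theorem eq_of_size_one (α β : NCInv 1) : α = β := by
  have key : ∀ α : NCInv 1, α 1 = 2 ∧ α 2 = 1 := by
    intro α
    have h1 := α.mem_range (x := 1) (by omega)
    have h2 := (α.fixed 1).2 (by omega)
    have h3 : α 1 = 2 := by omega
    exact ⟨h3, by rw [← h3, α.invol]⟩
  refine ext' fun x => ?_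
  by_cases h : 1 ≤ x ∧ x ≤ 2 * 1
  · have : x = 1 ∨ x = 2 := by omega
    rcases this with rfl | rfl
    · rw [(key α).1, (key β).1]
    · rw [(key α).2, (key β).2]
  · rw [not_not.1 (mt (α.fixed x).1 h), not_not.1 (mt (β.fixed x).1 h)]

theorem conn_size_one (α β : NCInv 1) : α.Conn β := by
  intro S hS ⟨x, hx, hr⟩ z h1 h2
  have h3 := α.mem_range hr
  have h4 := (α.fixed x).2 hr
  have h5 := (hS x hx).1
  have : z = x ∨ z = α x := by omega
  rcases this with rfl | rfl
  · exact hx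
  · exact h5

open Classical in
/-- The meander matrix is nonsingular. -/
theorem eq_zero_of_conn_sums (N : ℕ) (y : NCInv (N + 1) → ℝ)
    (h : ∀ β, ∑ α : NCInv (N + 1), (if α.Conn β then y α else 0) = 0) : ∀ α, y α = 0 := by
  induction N with
  | zero =>
    intro α
    have := h α
    rwa [Finset.sum_eq_single α (fun b _ hb => absurd (eq_of_size_one b α) hb) (by simp),
      if_pos (conn_size_one α α)] at this
  | succ N ih =>
    refine eq_zero_of_cap_sums (by omega) fun k hk => ih _ fun γ => ?_
    refine Eq.trans ?_ (h (γ.cup k hk))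
    have e1 : ∀ α : NCInv (N + 1), (if α.Conn γ then ∑ β : NCInv (N + 1 + 1),
        (if β k ≠ k + 1 ∧ β.cap k hk = α then y β else 0) else 0) =
        ∑ β : NCInv (N + 1 + 1), if β.cap k hk = α then
          (if β k ≠ k + 1 ∧ α.Conn γ then y β else 0) else 0 := by
      intro α
      by_cases hc : α.Conn γ
      · rw [if_pos hc]
        refine Finset.sum_congr rfl fun β _ => ?_
        by_cases a : β k = k + 1 <;> by_cases b : β.cap k hk = α <;> simp [a, b, hc]
      · rw [if_neg hc]
        exact (Finset.sum_eq_zero fun β _ => by simp [hc]).symm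
    refine (Finset.sum_congr rfl fun α _ => e1 α).trans ?_
    rw [Finset.sum_comm]
    refine Finset.sum_congr rfl fun β _ => ?_
    rw [Finset.sum_ite_eq, if_pos (Finset.mem_univ _)]
    refine if_congr ?_ rfl rfl
    rw [conn_comm β]
    constructor
    · rintro ⟨a, b⟩
      rw [conn_cup γ β hk a, conn_comm]
      exact b
    · intro a
      have hne : β k ≠ k + 1 := fun hb => not_conn_cup γ β (by omega) hk hb a
      rw [conn_cup γ β hk hne, conn_comm] at a
      exact ⟨hne, a⟩

end NCInv

section Minors

variable {E : Type*} [AddCommGroup E] [Module ℝ E]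

/-- The minor of the columns `A j`, `j ∈ J`, taken in increasing order; zero when the number of
columns is not the arity of `Ω`. -/
noncomputable def minor {d : ℕ} (Ω : E [⋀^Fin d]→ₗ[ℝ] ℝ) (A : ℕ → E) (J : Finset ℕ) : ℝ :=
  if h : J.card = d then Ω fun i => A (J.orderEmbOfFin h i) else 0

variable {d : ℕ}

theorem minor_of_card_ne (Ω : E [⋀^Fin d]→ₗ[ℝ] ℝ) (A : ℕ → E) {J : Finset ℕ} (h : J.card ≠ d) :
    minor Ω A J = 0 := dif_neg h

theorem minor_congr (Ω : E [⋀^Fin d]→ₗ[ℝ] ℝ) {A B : ℕ → E} {J : Finset ℕ}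
    (h : ∀ j ∈ J, A j = B j) : minor Ω A J = minor Ω B J := by
  unfold minor
  split_ifs with hJ
  · congr 1
    ext i
    exact h _ (Finset.orderEmbOfFin_mem _ _ _)
  · rfl

theorem minor_eq_of_strictMono (Ω : E [⋀^Fin d]→ₗ[ℝ] ℝ) (A : ℕ → E) {k : Fin d → ℕ}
    (hk : StrictMono k) : minor Ω A (Finset.univ.image k) = Ω fun i => A (k i) := by
  have hc : (Finset.univ.image k).card = d := by
    rw [Finset.card_image_of_injective _ hk.injective, Finset.card_fin]
  have := Finset.orderEmbOfFin_unique hc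
    (fun x => Finset.mem_image_of_mem k (Finset.mem_univ x)) hk
  rw [minor, dif_pos hc, ← this]

@[simp] theorem minor_add (Ω Ω' : E [⋀^Fin d]→ₗ[ℝ] ℝ) (A : ℕ → E) (J : Finset ℕ) :
    minor (Ω + Ω') A J = minor Ω A J + minor Ω' A J := by
  unfold minor; split_ifs <;> simp

@[simp] theorem minor_smul (c : ℝ) (Ω : E [⋀^Fin d]→ₗ[ℝ] ℝ) (A : ℕ → E) (J : Finset ℕ) :
    minor (c • Ω) A J = c * minor Ω A J := by
  unfold minor; split_ifs <;> simp

@[simp] theorem minor_neg (Ω : E [⋀^Fin d]→ₗ[ℝ] ℝ) (A : ℕ → E) (J : Finset ℕ) :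
    minor (-Ω) A J = -minor Ω A J := by
  unfold minor; split_ifs <;> simp

@[simp] theorem minor_sub (Ω Ω' : E [⋀^Fin d]→ₗ[ℝ] ℝ) (A : ℕ → E) (J : Finset ℕ) :
    minor (Ω - Ω') A J = minor Ω A J - minor Ω' A J := by
  unfold minor; split_ifs <;> simp

@[simp] theorem minor_zero (A : ℕ → E) (J : Finset ℕ) :
    minor (0 : E [⋀^Fin d]→ₗ[ℝ] ℝ) A J = 0 := by
  unfold minor; split_ifs <;> simp

theorem minor_insert (Ω : E [⋀^Fin (d + 1)]→ₗ[ℝ] ℝ) (A : ℕ → E) {x : ℕ} {Y : Finset ℕ}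
    (hx : x ∉ Y) : minor Ω A (insert x Y) =
      (-1) ^ (Y.filter (· < x)).card * minor (Ω.curryLeft (A x)) A Y := by
  by_cases hY : Y.card = d
  swap
  · rw [minor_of_card_ne, minor_of_card_ne _ _ hY, mul_zero]
    rw [Finset.card_insert_of_notMem hx]; omega
  have hc : (insert x Y).card = d + 1 := by rw [Finset.card_insert_of_notMem hx, hY]
  rw [minor, dif_pos hc, minor, dif_pos hY]
  set e := (insert x Y).orderEmbOfFin hc with he
  obtain ⟨i, hi⟩ : ∃ i, e i = x := by
    have : x ∈ Set.range e := by rw [he, Finset.range_orderEmbOfFin]; simp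
    exact this
  have hrem : (fun j => e (i.succAbove j)) = Y.orderEmbOfFin hY := by
    refine Finset.orderEmbOfFin_unique hY (fun j => ?_) fun a b h => ?_
    · have h1 : e (i.succAbove j) ∈ insert x Y := Finset.orderEmbOfFin_mem _ _ _
      refine Finset.mem_of_mem_insert_of_ne h1 fun h2 => ?_
      rw [← hi] at h2
      exact Fin.succAbove_ne i j (e.injective h2)
    · exact e.strictMono (Fin.strictMono_succAbove i h)
  have hcount : (Y.filter (· < x)).card = i := by
    have : Y.filter (· < x) = (Finset.Iio i).image e := by
      ext y
      simp only [Finset.mem_filter, Finset.mem_image, Finset.mem_Iio]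
      constructor
      · rintro ⟨h1, h2⟩
        have : y ∈ Set.range e := by rw [he, Finset.range_orderEmbOfFin]; simp [h1]
        obtain ⟨j, rfl⟩ := this
        rw [← hi] at h2
        exact ⟨j, e.lt_iff_lt.1 h2, rfl⟩
      · rintro ⟨j, hj, rfl⟩
        have h3 : e j < x := by rw [← hi]; exact e.lt_iff_lt.2 hj
        exact ⟨Finset.mem_of_mem_insert_of_ne (Finset.orderEmbOfFin_mem _ _ _) h3.ne, h3⟩
    rw [this, Finset.card_image_of_injective _ e.injective, Fin.card_Iio]
  have hfun : (fun j => A (e j)) =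
      i.insertNth (α := fun _ => E) (A x) fun j => A (Y.orderEmbOfFin hY j) := by
    rw [← hrem]
    ext j
    refine Fin.succAboveCases i ?_ (fun j => ?_) j
    · simp [hi]
    · simp
  rw [hfun, AlternatingMap.map_insertNth, hcount, AlternatingMap.curryLeft_apply_apply]
  simp

theorem minor_image (Ω : E [⋀^Fin d]→ₗ[ℝ] ℝ) (A : ℕ → E) {f : ℕ → ℕ} (hf : StrictMono f)
    (J : Finset ℕ) : minor Ω A (J.image f) = minor Ω (fun j => A (f j)) J := by
  have hc : (J.image f).card = J.card := Finset.card_image_of_injective _ hf.injective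
  by_cases h : J.card = d
  · have h2 : (J.image f).card = d := hc.trans h
    have : (fun i => f (J.orderEmbOfFin h i)) = (J.image f).orderEmbOfFin h2 :=
      Finset.orderEmbOfFin_unique h2
        (fun i => Finset.mem_image_of_mem f (Finset.orderEmbOfFin_mem _ _ _))
        fun a b hab => hf ((J.orderEmbOfFin h).strictMono hab)
    rw [minor, minor, dif_pos h, dif_pos h2, ← this]
  · rw [minor_of_card_ne _ _ h, minor_of_card_ne _ _ (hc.trans_ne h)]

theorem minor_smul_columns (Ω : E [⋀^Fin d]→ₗ[ℝ] ℝ) (A : ℕ → E) (c : ℕ → ℝ) (J : Finset ℕ) :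
    minor Ω (fun j => c j • A j) J = (∏ j ∈ J, c j) * minor Ω A J := by
  by_cases h : J.card = d
  · rw [minor, minor, dif_pos h, dif_pos h]
    refine (Ω.toMultilinearMap.map_smul_univ (fun i => c (J.orderEmbOfFin h i))
        (fun i => A (J.orderEmbOfFin h i))).trans ?_
    rw [smul_eq_mul]
    congr 1
    conv_rhs => rw [← Finset.image_orderEmbOfFin_univ J h,
      Finset.prod_image (fun a _ b _ hab => (J.orderEmbOfFin h).injective hab)]
  · rw [minor_of_card_ne _ _ h, minor_of_card_ne _ _ h, mul_zero]

theorem curryLeft_swap (Ω : E [⋀^Fin (d + 1 + 1)]→ₗ[ℝ] ℝ) (u v : E) :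
    (Ω.curryLeft u).curryLeft v = -(Ω.curryLeft v).curryLeft u := by
  have := AlternatingMap.curryLeft_same Ω (u + v)
  simp only [map_add, AlternatingMap.curryLeft_add, LinearMap.add_apply,
    AlternatingMap.curryLeft_same, zero_add, add_zero] at this
  exact eq_neg_of_add_eq_zero_left (by rw [add_comm]; exact this)

/-- The exchange relations: `Ω` behaves like a determinant. -/
def Exchange (Ω : E [⋀^Fin (d + 1)]→ₗ[ℝ] ℝ) : Prop :=
  ∀ (w : Fin (d + 1) → E) (q : E) (R : Fin d → E),
    Ω w * Ω (Matrix.vecCons q R) =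
      ∑ i, Ω (Function.update w i q) * Ω (Matrix.vecCons (w i) R)

theorem Exchange.smul {Ω : E [⋀^Fin (d + 1)]→ₗ[ℝ] ℝ} (h : Exchange Ω) (c : ℝ) :
    Exchange (c • Ω) := by
  intro w q R
  have := congrArg (c * c * ·) (h w q R)
  simp only [Finset.mul_sum] at this
  simp only [AlternatingMap.smul_apply, smul_eq_mul]
  calc _ = c * c * (Ω w * Ω (Matrix.vecCons q R)) := by ring
    _ = _ := this
    _ = _ := Finset.sum_congr rfl fun i _ => by ring

theorem Exchange.curryLeft {Ω : E [⋀^Fin (d + 1 + 1)]→ₗ[ℝ] ℝ} (h : Exchange Ω) (u : E) :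
    Exchange (Ω.curryLeft u) := by
  intro w q R
  have h1 := h (Matrix.vecCons u w) q (Matrix.vecCons u R)
  have h2 : ∀ a : E, Ω (Matrix.vecCons a (Matrix.vecCons u R)) =
      -Ω (Matrix.vecCons u (Matrix.vecCons a R)) := fun a => by
    have := congrArg (fun f => f R) (curryLeft_swap Ω a u)
    simpa using this
  rw [Fin.sum_univ_succ] at h1
  simp only [Matrix.cons_val_zero, Matrix.cons_val_succ, fun i => h2 (w i)] at h1
  rw [h2 q] at h1
  have h3 : Ω (Matrix.vecCons u (Matrix.vecCons u R)) = 0 :=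
    Ω.map_eq_zero_of_eq _ (i := 0) (j := 1) (by simp) (by simp)
  rw [h3, mul_zero, zero_add] at h1
  simp only [mul_neg, Finset.sum_neg_distrib, neg_inj] at h1
  simp only [AlternatingMap.curryLeft_apply_apply]
  rw [h1]
  refine Finset.sum_congr rfl fun i _ => ?_
  congr 2
  ext j
  refine Fin.cases ?_ (fun j => ?_) j
  · simp [Function.update_of_ne (Fin.succ_ne_zero i).symm]
  · by_cases hj : j = i
    · subst hj; simp
    · rw [Function.update_of_ne (by simpa using hj)]
      simp [hj]

theorem Exchange.eq_zero {Ω : E [⋀^Fin (d + 1)]→ₗ[ℝ] ℝ} (h : Exchange Ω) {q : E} {R : Fin d → E}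
    (hq : Ω (Matrix.vecCons q R) ≠ 0) {w : Fin (d + 1) → E}
    (hw : ∀ i, Ω (Matrix.vecCons (w i) R) = 0) : Ω w = 0 := by
  have := h w q R
  simp only [hw, mul_zero, Finset.sum_const_zero] at this
  exact (mul_eq_zero.1 this).resolve_right hq

/-- The minors with two distinguished columns satisfy the three-term Plücker relation. -/
theorem Exchange.plucker {Ω : E [⋀^Fin (d + 1 + 1)]→ₗ[ℝ] ℝ} (h : Exchange Ω) (a c z s : E)
    (V : Fin d → E) :
    Ω (Matrix.vecCons a (Matrix.vecCons z V)) * Ω (Matrix.vecCons c (Matrix.vecCons s V)) =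
      Ω (Matrix.vecCons a (Matrix.vecCons c V)) * Ω (Matrix.vecCons z (Matrix.vecCons s V)) +
      Ω (Matrix.vecCons c (Matrix.vecCons z V)) * Ω (Matrix.vecCons a (Matrix.vecCons s V)) := by
  have h1 := h (Matrix.vecCons a (Matrix.vecCons c V)) z (Matrix.vecCons s V)
  rw [Fin.sum_univ_succ, Fin.sum_univ_succ, Finset.sum_eq_zero, add_zero] at h1
  · have e1 : Function.update (Matrix.vecCons a (Matrix.vecCons c V)) 0 z =
        Matrix.vecCons z (Matrix.vecCons c V) := by
      simp [Matrix.vecCons]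
    have e2 : Function.update (Matrix.vecCons a (Matrix.vecCons c V)) (Fin.succ 0) z =
        Matrix.vecCons a (Matrix.vecCons z V) := by
      ext j
      refine Fin.cases (by simp) (fun j => Fin.cases (by simp) (fun j => ?_) j) j
      rw [Function.update_of_ne (fun h => Fin.succ_ne_zero _ (Fin.succ_injective _ h))]
      simp
    have e3 : Ω (Matrix.vecCons z (Matrix.vecCons c V)) =
        -Ω (Matrix.vecCons c (Matrix.vecCons z V)) := by
      have := congrArg (fun f => f V) (curryLeft_swap Ω z c)
      simpa using this
    rw [e1, e2, e3] at h1
    simp only [Matrix.cons_val_zero, Matrix.cons_val_succ] at h1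
    linarith
  · intro i _
    refine mul_eq_zero_of_right _ ?_
    refine Ω.map_eq_zero_of_eq _ (i := 0) (j := i.succ.succ) ?_ (Fin.succ_ne_zero _).symm
    simp

end Minors

section Plucker

variable {E : Type*} [AddCommGroup E] [Module ℝ E] {d : ℕ}

theorem minor_insert_insert (Ω : E [⋀^Fin (d + 1 + 1)]→ₗ[ℝ] ℝ) (A : ℕ → E) {u v : ℕ}
    {Y : Finset ℕ} (huv : u < v) (hu : u ∉ Y) (hv : v ∉ Y) :
    minor Ω A (insert u (insert v Y)) =
      (-1) ^ ((Y.filter (· < u)).card + (Y.filter (· < v)).card) *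
        minor ((Ω.curryLeft (A u)).curryLeft (A v)) A Y := by
  rw [minor_insert _ _ (by simp [huv.ne, hu]), minor_insert _ _ hv, Finset.filter_insert,
    if_neg huv.not_gt, pow_add, mul_assoc]

theorem minor_plucker_aux {Ω : E [⋀^Fin (d + 1 + 1)]→ₗ[ℝ] ℝ} (h : Exchange Ω) (A : ℕ → E)
    (a c z s : E) (Y : Finset ℕ) :
    minor ((Ω.curryLeft a).curryLeft z) A Y * minor ((Ω.curryLeft c).curryLeft s) A Y =
      minor ((Ω.curryLeft a).curryLeft c) A Y * minor ((Ω.curryLeft z).curryLeft s) A Y +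
      minor ((Ω.curryLeft c).curryLeft z) A Y * minor ((Ω.curryLeft a).curryLeft s) A Y := by
  by_cases hY : Y.card = d
  · simp only [minor, dif_pos hY, AlternatingMap.curryLeft_apply_apply]
    exact h.plucker a c z s _
  · simp only [minor, dif_neg hY, mul_zero, add_zero]

theorem minor_plucker {Ω : E [⋀^Fin (d + 1)]→ₗ[ℝ] ℝ} (h : Exchange Ω) (A : ℕ → E)
    {a c z s : ℕ} {Y : Finset ℕ} (hac : a < c) (hcz : c < z) (hs : s < a ∨ z < s)
    (ha : a ∉ Y) (hc : c ∉ Y) (hz : z ∉ Y) (hsY : s ∉ Y) :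
    minor Ω A (insert a (insert z Y)) * minor Ω A (insert c (insert s Y)) =
      minor Ω A (insert a (insert c Y)) * minor Ω A (insert z (insert s Y)) +
      minor Ω A (insert c (insert z Y)) * minor Ω A (insert a (insert s Y)) := by
  cases d with
  | zero =>
    have : ∀ u v, u ≠ v → u ∉ Y → v ∉ Y → minor Ω A (insert u (insert v Y)) = 0 := by
      intro u v h1 h2 h3
      refine minor_of_card_ne _ _ ?_
      rw [Finset.card_insert_of_notMem (by simp [h1, h2]), Finset.card_insert_of_notMem h3]
      omega
    rw [this a z (by omega) ha hz, this a c (by omega) ha hc, this c z (by omega) hc hz]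
    ring
  | succ d =>
    have key := minor_plucker_aux h A (A a) (A c) (A z) (A s) Y
    rw [minor_insert_insert Ω A (hac.trans hcz) ha hz, minor_insert_insert Ω A hac ha hc,
      minor_insert_insert Ω A hcz hc hz]
    simp only [pow_add]
    rcases hs with hs | hs
    · rw [Finset.insert_comm c s, Finset.insert_comm z s, Finset.insert_comm a s,
        minor_insert_insert Ω A (hs.trans hac) hsY hc,
        minor_insert_insert Ω A (hs.trans (hac.trans hcz)) hsY hz,
        minor_insert_insert Ω A hs hsY ha, curryLeft_swap Ω (A s) (A c),
        curryLeft_swap Ω (A s) (A a), curryLeft_swap Ω (A s) (A z)]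
      simp only [minor_neg, pow_add]
      linear_combination (-((-1) ^ (Y.filter (· < a)).card * (-1) ^ (Y.filter (· < z)).card *
        (-1) ^ (Y.filter (· < s)).card * (-1) ^ (Y.filter (· < c)).card : ℝ)) * key
    · rw [minor_insert_insert Ω A (hcz.trans hs) hc hsY,
        minor_insert_insert Ω A hs hz hsY,
        minor_insert_insert Ω A ((hac.trans hcz).trans hs) ha hsY]
      simp only [pow_add]
      linear_combination ((-1) ^ (Y.filter (· < a)).card * (-1) ^ (Y.filter (· < z)).card *
        (-1) ^ (Y.filter (· < s)).card * (-1) ^ (Y.filter (· < c)).card : ℝ) * key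

/-- A Fekete-type criterion: positivity of a function on `d`-subsets of `[p, q] ∪ Q` obeying
three-term relations follows from positivity on the sets meeting `[p, q]` in an interval. -/
theorem pos_of_contiguous {p q d : ℕ} {Q : Finset ℕ} (hQ : ∀ s ∈ Q, s < p ∨ q < s)
    (hd : d ≤ Q.card + 1) {g : Finset ℕ → ℝ}
    (h3 : ∀ (Y : Finset ℕ) (a c z s : ℕ), Y ⊆ Finset.Icc p q ∪ Q → p ≤ a → a < c → c < z →
      z ≤ q → s ∈ Q → a ∉ Y → c ∉ Y → z ∉ Y → s ∉ Y → Y.card + 2 = d →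
      g (insert a (insert z Y)) * g (insert c (insert s Y)) =
        g (insert a (insert c Y)) * g (insert z (insert s Y)) +
        g (insert c (insert z Y)) * g (insert a (insert s Y)))
    (hc : ∀ (i j : ℕ) (S : Finset ℕ), p ≤ i → i ≤ j → j ≤ q + 1 → S ⊆ Q →
      (j - i) + S.card = d → 0 < g (Finset.Ico i j ∪ S))
    {J : Finset ℕ} (hJ : J ⊆ Finset.Icc p q ∪ Q) (hJd : J.card = d) (hpq : p ≤ q + 1) :
    0 < g J := by
  have main : ∀ l i : ℕ, ∀ J : Finset ℕ, J.card = d → p ≤ i → i + l ≤ q + 1 →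
      J ⊆ Finset.Ico i (i + l) ∪ Q → 0 < g J := by
    intro l
    induction l using Nat.strong_induction_on with
    | _ l ih =>
      intro i J hJd hi hl hJ
      by_cases hfull : Finset.Ico i (i + l) ⊆ J
      · have hJe : J = Finset.Ico i (i + l) ∪ (J ∩ Q) := by
          ext x
          have := @hJ x
          have := @hfull x
          simp only [Finset.mem_union, Finset.mem_inter] at *
          tauto
        rw [hJe]
        refine hc i (i + l) _ hi (by omega) hl Finset.inter_subset_right ?_
        rw [← hJd]
        conv_rhs => rw [hJe]
        rw [Finset.card_union_of_disjoint, Nat.card_Ico]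
        rw [Finset.disjoint_left]
        intro x hx hx2
        have := hQ x (Finset.mem_inter.1 hx2).2
        rw [Finset.mem_Ico] at hx
        omega
      obtain ⟨c, hcI, hcJ⟩ := Finset.not_subset.1 hfull
      rw [Finset.mem_Ico] at hcI
      have hJ' : ∀ x ∈ J, (i ≤ x ∧ x < i + l) ∨ x ∈ Q := by
        intro x hx
        have := hJ hx
        rwa [Finset.mem_union, Finset.mem_Ico] at this
      by_cases hiJ : i ∈ J
      swap
      · refine ih (l - 1) (by omega) (i + 1) J hJd (by omega) (by omega) fun x hx => ?_
        have := hJ' x hx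
        have : x ≠ i := fun h => hiJ (h ▸ hx)
        rw [Finset.mem_union, Finset.mem_Ico]
        rcases hJ' x hx with h | h
        · left; omega
        · right; exact h
      by_cases hzJ : i + l - 1 ∈ J
      swap
      · refine ih (l - 1) (by omega) i J hJd (by omega) (by omega) fun x hx => ?_
        have : x ≠ i + l - 1 := fun h => hzJ (h ▸ hx)
        rw [Finset.mem_union, Finset.mem_Ico]
        rcases hJ' x hx with h | h
        · left; omega
        · right; exact h
      obtain ⟨z, hz⟩ : ∃ z, z = i + l - 1 := ⟨_, rfl⟩
      rw [← hz] at hzJ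
      have hci : c ≠ i := fun h => hcJ (h ▸ hiJ)
      have hcz : c ≠ z := fun h => hcJ (h ▸ hzJ)
      set Y := (J.erase i).erase z with hY
      have hzi : z ∈ J.erase i := Finset.mem_erase.2 ⟨by omega, hzJ⟩
      have hYc : Y.card + 2 = d := by
        have h1 := Finset.card_erase_add_one hzi
        have h2 := Finset.card_erase_add_one hiJ
        rw [← hY] at h1
        omega
      have hYJ : Y ⊆ J := (Finset.erase_subset _ _).trans (Finset.erase_subset _ _)
      have hiY : i ∉ Y := fun h => (Finset.notMem_erase i J) (Finset.mem_of_mem_erase h)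
      have hzY : z ∉ Y := Finset.notMem_erase _ _
      have hcY : c ∉ Y := fun h => hcJ (hYJ h)
      have hJY : insert i (insert z Y) = J := by
        rw [hY, Finset.insert_erase hzi, Finset.insert_erase hiJ]
      obtain ⟨s, hsQ, hsY⟩ : ∃ s ∈ Q, s ∉ Y := by
        by_contra! hcon
        have := Finset.card_le_card hcon
        omega
      have hsr := hQ s hsQ
      have hY' : ∀ x ∈ Y, (i < x ∧ x < z) ∨ x ∈ Q := by
        intro x hx
        have h1 : x ≠ i := fun h => hiY (h ▸ hx)
        have h2 : x ≠ z := fun h => hzY (h ▸ hx)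
        rcases hJ' x (hYJ hx) with h | h
        · left; omega
        · right; exact h
      have step : ∀ u v : ℕ, ∀ l' i' : ℕ, u ≠ v → u ∉ Y → v ∉ Y → l' < l → i ≤ i' →
          i' + l' ≤ i + l → i' ≤ i + 1 → z ≤ i' + l' → ((i' ≤ u ∧ u < i' + l') ∨ u ∈ Q) →
          ((i' ≤ v ∧ v < i' + l') ∨ v ∈ Q) → 0 < g (insert u (insert v Y)) := by
        intro u v l' i' huv hu hv h1 h2 h3 h4 h5 h6 h7
        refine ih l' h1 i' _ ?_ (by omega) (by omega) fun x hx => ?_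
        · rw [Finset.card_insert_of_notMem (by simp [huv, hu]), Finset.card_insert_of_notMem hv]
          omega
        · rw [Finset.mem_union, Finset.mem_Ico]
          simp only [Finset.mem_insert] at hx
          rcases hx with rfl | rfl | hx
          · exact h6
          · exact h7
          · rcases hY' x hx with h | h
            · left; omega
            · right; exact h
      have key := h3 Y i c z s (fun x hx => ?_) hi (by omega) (by omega) (by omega) hsQ hiY hcY
        hzY hsY hYc
      swap
      · rw [Finset.mem_union, Finset.mem_Icc]
        rcases hY' x hx with h | h
        · left; omega
        · right; exact h
      rw [hJY] at key
      have p1 := step c s (l - 2) (i + 1) (by omega) hcY hsY (by omega) (by omega) (by omega)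
        (by omega) (by omega) (by left; omega) (Or.inr hsQ)
      have p2 := step i c (l - 1) i (by omega) hiY hcY (by omega) (by omega) (by omega)
        (by omega) (by omega) (by left; omega) (by left; omega)
      have p3 := step z s (l - 1) (i + 1) (by omega) hzY hsY (by omega) (by omega) (by omega)
        (by omega) (by omega) (by left; omega) (Or.inr hsQ)
      have p4 := step c z (l - 1) (i + 1) (by omega) hcY hzY (by omega) (by omega) (by omega)
        (by omega) (by omega) (by left; omega) (by left; omega)
      have p5 := step i s (l - 1) i (by omega) hiY hsY (by omega) (by omega) (by omega)
        (by omega) (by omega) (by left; omega) (Or.inr hsQ)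
      have : 0 < g J * g (insert c (insert s Y)) := by rw [key]; positivity
      exact pos_of_mul_pos_left this p1.le
  refine main (q + 1 - p) p J hJd le_rfl (by omega) fun x hx => ?_
  have := hJ hx
  rw [Finset.mem_union, Finset.mem_Icc] at this
  rw [Finset.mem_union, Finset.mem_Ico]
  rcases this with h | h
  · left; omega
  · right; exact h

end Plucker

section MinorSystem

variable {E : Type*} [AddCommGroup E] [Module ℝ E] {d : ℕ}

/-- The minor with its leftmost column left free. -/
noncomputable def minorLin (Ω : E [⋀^Fin (d + 1)]→ₗ[ℝ] ℝ) (A : ℕ → E) (J : Finset ℕ) :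
    E →ₗ[ℝ] ℝ where
  toFun v := minor (Ω.curryLeft v) A J
  map_add' u v := by rw [map_add, minor_add]
  map_smul' c v := by rw [map_smul, minor_smul]; rfl

theorem minorLin_apply (Ω : E [⋀^Fin (d + 1)]→ₗ[ℝ] ℝ) (A : ℕ → E) (J : Finset ℕ) (v : E) :
    minorLin Ω A J v = minor (Ω.curryLeft v) A J := rfl

theorem minorLin_col (Ω : E [⋀^Fin (d + 1)]→ₗ[ℝ] ℝ) (A : ℕ → E) {x : ℕ} {Y : Finset ℕ}
    (hx : x ∉ Y) :
    minorLin Ω A Y (A x) = (-1) ^ (Y.filter (· < x)).card * minor Ω A (insert x Y) := by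
  rw [minor_insert Ω A hx, ← mul_assoc, ← pow_add, Even.neg_one_pow ⟨_, rfl⟩, one_mul,
    minorLin_apply]

theorem minorLin_col_mem (Ω : E [⋀^Fin (d + 1)]→ₗ[ℝ] ℝ) (A : ℕ → E) {x : ℕ} {Y : Finset ℕ}
    (hx : x ∈ Y) : minorLin Ω A Y (A x) = 0 := by
  rw [minorLin_apply]
  cases d with
  | zero => exact minor_of_card_ne _ _ (Finset.card_ne_zero_of_mem hx)
  | succ d =>
    rw [← Finset.insert_erase hx, minor_insert _ _ (Finset.notMem_erase _ _),
      AlternatingMap.curryLeft_same, minor_zero, mul_zero]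

/-- The columns `φ (k + 1) + φ (k - 1)` attached to a sequence of vectors. -/
def col (φ : ℕ → E) (k : ℕ) : E := φ (k + 1) + φ (k - 1)

variable (E) in
/-- The linear algebra data behind a family of Coulomb gas integrals. -/
structure MinorSystem (n : ℕ) where
  Ω : E [⋀^Fin (n + 1)]→ₗ[ℝ] ℝ
  φ : ℕ → E
  φ_zero : φ 0 = 0
  φ_last : φ (2 * n + 1) = 0
  φ_top : φ (2 * n + 3) = φ (2 * n + 2)
  exch : Exchange Ω
  lag : ∀ f : E →ₗ[ℝ] ℝ, ∑ j ∈ Finset.range (2 * n + 1),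
    (-1 : ℝ) ^ j • (f (φ j) • φ (j + 1) - f (φ (j + 1)) • φ j) = 0
  tp : ∀ J ⊆ Finset.range (2 * n + 2), J.card = n →
    0 < (-1) ^ n * minor (Ω.curryLeft (φ (2 * n + 2))) (col φ) J

namespace MinorSystem

variable {n m : ℕ}

theorem lag_col (S : MinorSystem E n) (f : E →ₗ[ℝ] ℝ) :
    ∑ j ∈ Finset.range (2 * n), (-1 : ℝ) ^ (j + 1) • f (S.φ (j + 1)) • col S.φ (j + 1) = 0 := by
  have h := S.lag f
  simp only [smul_sub, Finset.sum_sub_distrib] at h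
  rw [Finset.sum_range_succ', Finset.sum_range_succ (fun j => (-1 : ℝ) ^ j • f (S.φ (j + 1)) • S.φ j)]
    at h
  simp only [S.φ_zero, S.φ_last, map_zero, zero_smul, smul_zero, add_zero] at h
  rw [← Finset.sum_sub_distrib] at h
  rw [← h]
  refine Finset.sum_congr rfl fun j _ => ?_
  rw [col, Nat.add_sub_cancel, pow_succ]
  module

variable (S : MinorSystem E (m + 1))

/-- The form obtained by contracting with the last vector. -/
noncomputable def Ω₀ : E [⋀^Fin (m + 1)]→ₗ[ℝ] ℝ :=
  (-1 : ℝ) ^ (m + 1) • S.Ω.curryLeft (S.φ (2 * (m + 1) + 2))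

theorem exch₀ : Exchange S.Ω₀ := (S.exch.curryLeft _).smul _

theorem tp₀ {J : Finset ℕ} (hJ : J ⊆ Finset.range (2 * m + 4)) (hc : J.card = m + 1) :
    0 < minor S.Ω₀ (col S.φ) J := by
  rw [Ω₀, minor_smul]
  exact S.tp J hJ hc

/-- The linear functional used to split off one dimension. -/
noncomputable def lam : E →ₗ[ℝ] ℝ := minorLin S.Ω₀ (col S.φ) (Finset.Ico (m + 4) (2 * m + 4))

theorem lam_one_pos : 0 < S.lam (S.φ 1) := by
  have h0 : S.φ 1 = col S.φ 0 := by simp [col, S.φ_zero]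
  have hn : 0 ∉ Finset.Ico (m + 4) (2 * m + 4) := by simp
  rw [h0, lam, minorLin_col _ _ hn]
  have : (Finset.Ico (m + 4) (2 * m + 4)).filter (· < 0) = ∅ := by simp
  rw [this, Finset.card_empty, pow_zero, one_mul]
  refine S.tp₀ (fun x hx => ?_) ?_
  · simp only [Finset.mem_insert, Finset.mem_Ico, Finset.mem_range] at *
    omega
  · rw [Finset.card_insert_of_notMem hn, Nat.card_Ico]
    omega

theorem Ω₀_curryLeft_top : S.Ω₀.curryLeft (S.φ (2 * m + 4)) = 0 := by
  rw [Ω₀, AlternatingMap.curryLeft_smul, LinearMap.smul_apply]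
  exact (congrArg _ (AlternatingMap.curryLeft_same S.Ω _)).trans (smul_zero _)

theorem lam_top : S.lam (S.φ (2 * m + 4)) = 0 := by
  rw [lam, minorLin_apply, Ω₀_curryLeft_top, minor_zero]

theorem lam_col {k : ℕ} (h1 : m + 4 ≤ k) (h2 : k ≤ 2 * m + 3) : S.lam (col S.φ k) = 0 :=
  minorLin_col_mem _ _ (by rw [Finset.mem_Ico]; omega)

theorem lam_high {j : ℕ} (h1 : m + 3 ≤ j) (h2 : j ≤ 2 * m + 5) : S.lam (S.φ j) = 0 := by
  have h0 : S.lam (S.φ (2 * m + 3)) = 0 := by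
    rw [show 2 * m + 3 = 2 * (m + 1) + 1 by ring, S.φ_last, map_zero]
  have main : ∀ i ≤ m, S.lam (S.φ (2 * m + 3 - i)) = 0 ∧ S.lam (S.φ (2 * m + 4 - i)) = 0 := by
    intro i
    induction i with
    | zero => exact fun _ => ⟨h0, S.lam_top⟩
    | succ i ih =>
      intro hi
      obtain ⟨h3, h4⟩ := ih (by omega)
      have h5 := S.lam_col (k := 2 * m + 3 - i) (by omega) (by omega)
      rw [col, map_add, show 2 * m + 3 - i + 1 = 2 * m + 4 - i by omega, h4, zero_add] at h5
      refine ⟨?_, ?_⟩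
      · rwa [show 2 * m + 3 - (i + 1) = 2 * m + 3 - i - 1 by omega]
      · rwa [show 2 * m + 4 - (i + 1) = 2 * m + 3 - i by omega]
  by_cases h3 : j ≤ 2 * m + 3
  · have := (main (2 * m + 3 - j) (by omega)).1
    rwa [show 2 * m + 3 - (2 * m + 3 - j) = j by omega] at this
  · by_cases h4 : j = 2 * m + 4
    · rw [h4]; exact S.lam_top
    · rw [show j = 2 * (m + 1) + 3 by omega, S.φ_top]
      exact S.lam_top

theorem sum_lam_col :
    ∑ j ∈ Finset.range (m + 2), (-1 : ℝ) ^ (j + 1) • S.lam (S.φ (j + 1)) • col S.φ (j + 1) = 0 := by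
  rw [← S.lag_col S.lam]
  refine Finset.sum_subset (Finset.range_mono (by omega)) fun j hj hj' => ?_
  rw [Finset.mem_range] at hj hj'
  rw [S.lam_high (by omega) (by omega), zero_smul, smul_zero]

theorem lam_pos {k : ℕ} (h1 : 1 ≤ k) (h2 : k ≤ m + 2) : 0 < S.lam (S.φ k) := by
  induction k, h1 using Nat.le_induction with
  | base => exact S.lam_one_pos
  | succ k hk ih =>
    have ihk := ih (by omega)
    set T := ((Finset.Icc 1 (m + 2)).erase k).erase (k + 1) with hT
    have hTmem : ∀ x, x ∈ T ↔ x ≠ k + 1 ∧ x ≠ k ∧ 1 ≤ x ∧ x ≤ m + 2 := by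
      intro x
      simp only [hT, Finset.mem_erase, Finset.mem_Icc]
    have hTc : T.card = m := by
      rw [hT, Finset.card_erase_of_mem, Finset.card_erase_of_mem, Nat.card_Icc]
      · omega
      · rw [Finset.mem_Icc]; omega
      · rw [Finset.mem_erase, Finset.mem_Icc]; omega
    have hcount : T.filter (· < k + 1) = T.filter (· < k) := by
      ext x
      simp only [Finset.mem_filter, hTmem]
      omega
    have hk1 : k ∉ T := by rw [hTmem]; omega
    have hk2 : k + 1 ∉ T := by rw [hTmem]; omega
    have hpos : ∀ x, x = k ∨ x = k + 1 → 0 < minor S.Ω₀ (col S.φ) (insert x T) := by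
      intro x hx
      refine S.tp₀ (fun y hy => ?_) ?_
      · rw [Finset.mem_insert, hTmem] at hy
        rw [Finset.mem_range]
        omega
      · rw [Finset.card_insert_of_notMem (by rcases hx with rfl | rfl <;> assumption), hTc]
    have h := congrArg (minorLin S.Ω₀ (col S.φ) T) S.sum_lam_col
    rw [map_sum, map_zero, Finset.sum_eq_add (k - 1) k (by omega)] at h
    · simp only [map_smul, smul_eq_mul, Nat.sub_add_cancel hk] at h
      rw [minorLin_col _ _ hk1, minorLin_col _ _ hk2, hcount, pow_succ] at h
      have h0 : (-1 : ℝ) ^ k ≠ 0 := pow_ne_zero _ (by norm_num)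
      have h0' : (-1 : ℝ) ^ (T.filter (· < k)).card ≠ 0 := pow_ne_zero _ (by norm_num)
      have h3 : (-1 : ℝ) ^ k * (-1 : ℝ) ^ (T.filter (· < k)).card *
          (S.lam (S.φ k) * minor S.Ω₀ (col S.φ) (insert k T) -
          S.lam (S.φ (k + 1)) * minor S.Ω₀ (col S.φ) (insert (k + 1) T)) = 0 := by
        linear_combination h
      have h4 := (mul_eq_zero.1 h3).resolve_left (mul_ne_zero h0 h0')
      have h5 : 0 < S.lam (S.φ (k + 1)) * minor S.Ω₀ (col S.φ) (insert (k + 1) T) := by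
        rw [← sub_eq_zero.1 h4]
        exact mul_pos ihk (hpos k (Or.inl rfl))
      exact pos_of_mul_pos_left h5 (hpos _ (Or.inr rfl)).le
    · intro j hj hjk
      rw [Finset.mem_range] at hj
      rw [map_smul, map_smul, minorLin_col_mem, smul_zero, smul_zero]
      rw [hTmem]
      omega
    · intro hj
      rw [Finset.mem_range] at hj
      omega
    · intro hj
      rw [Finset.mem_range] at hj
      omega

theorem lam_ne {k : ℕ} (h1 : 1 ≤ k) (h2 : k ≤ m + 2) : S.lam (S.φ k) ≠ 0 := (S.lam_pos h1 h2).ne'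

end MinorSystem

end MinorSystem

namespace MinorSystem

variable {E : Type*} [AddCommGroup E] [Module ℝ E] {m : ℕ} (S : MinorSystem E (m + 1))

/-- The vectors obtained from `φ` by eliminating the functional `lam` from the left. -/
noncomputable def chi : ℕ → E
  | 0 => 0
  | k + 1 => S.φ (k + 1) - (S.lam (S.φ (k + 1)) / S.lam (S.φ (k + 2))) • (S.φ (k + 2) + chi k)

theorem chi_zero : S.chi 0 = 0 := rfl

/-- The ratio used in the elimination. -/
noncomputable def ratio (k : ℕ) : ℝ := S.lam (S.φ k) / S.lam (S.φ (k + 1))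

theorem chi_eq {k : ℕ} (hk : 1 ≤ k) :
    S.chi k = S.φ k - S.ratio k • (S.φ (k + 1) + S.chi (k - 1)) := by
  obtain ⟨k, rfl⟩ : ∃ l, k = l + 1 := ⟨k - 1, by omega⟩
  rw [chi, ratio, Nat.add_sub_cancel]

theorem ratio_pos {k : ℕ} (h1 : 1 ≤ k) (h2 : k ≤ m + 1) : 0 < S.ratio k :=
  div_pos (S.lam_pos h1 (by omega)) (S.lam_pos (by omega) (by omega))

theorem lam_chi {k : ℕ} (hk : k ≤ m + 1) : S.lam (S.chi k) = 0 := by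
  induction k with
  | zero => rw [chi_zero, map_zero]
  | succ k ih =>
    have h := S.lam_ne (k := k + 2) (by omega) (by omega)
    rw [chi, map_sub, map_smul, map_add, ih (by omega), add_zero, smul_eq_mul,
      div_mul_cancel₀ _ h, sub_self]

/-- The columns of the intermediate minors. -/
noncomputable def B (k : ℕ) : E := S.lam (S.φ k) • (S.φ (k + 1) + S.chi (k - 1))

theorem B_zero : S.B 0 = 0 := by rw [B, S.φ_zero, map_zero, zero_smul]

theorem B_add {k : ℕ} (hk : k ≤ m + 1) :
    S.B (k + 1) + S.B k = S.lam (S.φ (k + 1)) • col S.φ (k + 1) := by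
  rcases Nat.eq_zero_or_pos k with rfl | hk0
  · rw [B_zero, B, col, chi_zero, S.φ_zero, add_zero]
  have h := S.lam_ne (k := k + 1) (by omega) (by omega)
  have h2 : S.B k = S.lam (S.φ (k + 1)) • (S.φ k - S.chi k) := by
    rw [S.chi_eq hk0, sub_sub_cancel, smul_smul, ratio, mul_div_cancel₀ _ h, B]
  rw [h2, B, col, Nat.add_sub_cancel]
  module

theorem sum_lam_col_eq {k : ℕ} (hk : k ≤ m + 2) :
    ∑ j ∈ Finset.range k, (-1 : ℝ) ^ (j + 1) • S.lam (S.φ (j + 1)) • col S.φ (j + 1) =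
      (-1 : ℝ) ^ k • S.B k := by
  induction k with
  | zero => rw [B_zero, smul_zero, Finset.sum_range_zero]
  | succ k ih =>
    rw [Finset.sum_range_succ, ih (by omega), ← S.B_add (by omega), pow_succ]
    module

theorem B_last : S.B (m + 2) = 0 := by
  have h := S.sum_lam_col
  rw [S.sum_lam_col_eq le_rfl] at h
  exact (smul_eq_zero.1 h).resolve_left (pow_ne_zero _ (by norm_num))

theorem chi_last : S.chi (m + 1) = -S.φ (m + 3) := by
  have h := S.B_last
  rw [B] at h
  have h2 := (smul_eq_zero.1 h).resolve_left (S.lam_ne (by omega) (by omega))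
  exact eq_neg_of_add_eq_zero_right h2

/-- Normalised sections of `lam`. -/
noncomputable def phat (k : ℕ) : E :=
  if k = m + 2 then (S.lam (S.φ (m + 2)))⁻¹ • col S.φ (m + 3)
  else (S.lam (S.φ (k + 1)))⁻¹ • (S.φ (k + 1) + S.chi (k - 1))

theorem lam_phat {k : ℕ} (hk : k ≤ m + 2) : S.lam (S.phat k) = 1 := by
  rw [phat]
  split_ifs with h
  · rw [map_smul, col, map_add, S.lam_high (j := m + 3 + 1) (by omega) (by omega), zero_add, smul_eq_mul,
      show m + 3 - 1 = m + 2 from rfl, inv_mul_cancel₀ (S.lam_ne (by omega) (by omega))]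
  · rw [map_smul, map_add, S.lam_chi (by omega), add_zero, smul_eq_mul,
      inv_mul_cancel₀ (S.lam_ne (by omega) (by omega))]

/-- The sequence of vectors of the smaller system. -/
noncomputable def φ' (j : ℕ) : E := if j ≤ m + 1 then S.chi j else -S.φ (j + 2)

theorem φ'_of_le {j : ℕ} (hj : j ≤ m + 1) : S.φ' j = S.chi j := if_pos hj

theorem φ'_of_ge {j : ℕ} (hj : m + 1 ≤ j) : S.φ' j = -S.φ (j + 2) := by
  rw [φ']
  split_ifs with h
  · rw [show j = m + 1 by omega, chi_last]
  · rfl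

theorem col_φ'_low {k : ℕ} (hk : k ≤ m + 1) :
    col S.φ' k = -(S.lam (S.φ (k + 1)) • (S.phat (k + 1) - S.phat k)) := by
  have h := S.lam_ne (k := k + 1) (by omega) (by omega)
  rcases hk.eq_or_lt with rfl | hk
  · rw [col, S.φ'_of_ge (by omega), S.φ'_of_le (by omega), phat, if_pos rfl, phat,
      if_neg (by omega), smul_sub, smul_smul, smul_smul, mul_inv_cancel₀ h, one_smul, one_smul,
      col]
    change -S.φ (m + 4) + S.chi m = -(S.φ (m + 4) + S.φ (m + 2) - (S.φ (m + 2) + S.chi m))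
    abel
  · have h2 := S.lam_ne (k := k + 1 + 1) (by omega) (by omega)
    rw [col, S.φ'_of_le (by omega), S.φ'_of_le (by omega), phat, if_neg (by omega), phat,
      if_neg (by omega), smul_sub, smul_smul, smul_smul, mul_inv_cancel₀ h, one_smul,
      S.chi_eq (by omega), ratio, div_eq_mul_inv, Nat.add_sub_cancel]
    abel

theorem col_φ'_high {k : ℕ} (hk : m + 2 ≤ k) : col S.φ' k = -col S.φ (k + 2) := by
  rw [col, col, S.φ'_of_ge (by omega), S.φ'_of_ge (by omega), neg_add,
    show k - 1 + 2 = k + 2 - 1 by omega, show k + 1 + 2 = k + 2 + 1 by omega]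

/-- The vector contracted out when passing to the smaller system. -/
noncomputable def q : E := S.φ (m + 2) + S.chi m

theorem lam_q : S.lam S.q = S.lam (S.φ (m + 2)) := by
  rw [q, map_add, S.lam_chi (by omega), add_zero]

/-- The wedge product of two vectors, contracted with a linear functional. -/
def wedge (f : E →ₗ[ℝ] ℝ) (u v : E) : E := f u • v - f v • u

theorem wedge_sum_chi (f : E →ₗ[ℝ] ℝ) {k : ℕ} (hk : k ≤ m + 1) :
    ∑ j ∈ Finset.range k, (-1 : ℝ) ^ j • wedge f (S.chi j) (S.chi (j + 1)) +
      (-1 : ℝ) ^ k • wedge f (S.chi k) (S.φ (k + 1)) =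
    ∑ j ∈ Finset.range (k + 1), (-1 : ℝ) ^ j • wedge f (S.φ j) (S.φ (j + 1)) := by
  induction k with
  | zero => simp [chi_zero, S.φ_zero]
  | succ k ih =>
    rw [Finset.sum_range_succ, Finset.sum_range_succ _ (k + 1), ← ih (by omega)]
    have h := S.chi_eq (k := k + 1) (by omega)
    rw [Nat.add_sub_cancel] at h
    have h2 : wedge f (S.chi (k + 1)) (S.φ (k + 1 + 1) + S.chi k) =
        wedge f (S.φ (k + 1)) (S.φ (k + 1 + 1) + S.chi k) := by
      rw [h]
      simp only [wedge, map_sub, map_smul, map_add, smul_eq_mul]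
      module
    have h3 : (-1 : ℝ) ^ k • wedge f (S.chi k) (S.chi (k + 1)) +
        (-1 : ℝ) ^ (k + 1) • wedge f (S.chi (k + 1)) (S.φ (k + 1 + 1)) =
        (-1 : ℝ) ^ (k + 1) • wedge f (S.chi (k + 1)) (S.φ (k + 1 + 1) + S.chi k) := by
      simp only [wedge, map_add, pow_succ]
      module
    rw [add_assoc, h3, h2]
    simp only [wedge, map_add, pow_succ]
    module

theorem lag_φ' (f : E →ₗ[ℝ] ℝ) : ∑ j ∈ Finset.range (2 * m + 1),
    (-1 : ℝ) ^ j • (f (S.φ' j) • S.φ' (j + 1) - f (S.φ' (j + 1)) • S.φ' j) = 0 := by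
  have h := S.lag f
  rw [show 2 * (m + 1) + 1 = (m + 1 + 1 + 1) + m by ring, Finset.sum_range_add] at h
  have h1 := S.wedge_sum_chi f (k := m + 1) le_rfl
  rw [S.chi_last] at h1
  have h2 := Finset.sum_range_succ
    (fun j => (-1 : ℝ) ^ j • wedge f (S.φ j) (S.φ (j + 1))) (m + 1 + 1)
  rw [← h1] at h2
  have h3 : (-1 : ℝ) ^ (m + 1) • wedge f (-S.φ (m + 3)) (S.φ (m + 1 + 1)) +
      (-1 : ℝ) ^ (m + 1 + 1) • wedge f (S.φ (m + 1 + 1)) (S.φ (m + 1 + 1 + 1)) = 0 := by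
    simp only [wedge, map_neg, pow_succ]
    module
  have h4 := h2.trans ((add_assoc _ _ _).trans ((congrArg _ h3).trans (add_zero _)))
  rw [show 2 * m + 1 = (m + 1) + m by ring, Finset.sum_range_add]
  rw [← h]
  congr 1
  · refine Eq.trans ?_ h4.symm
    refine Finset.sum_congr rfl fun j hj => ?_
    rw [Finset.mem_range] at hj
    rw [S.φ'_of_le (by omega), S.φ'_of_le (by omega), wedge]
  · refine Finset.sum_congr rfl fun j _ => ?_
    rw [S.φ'_of_ge (by omega), S.φ'_of_ge (by omega), map_neg, map_neg,
      show m + 1 + j + 2 = m + 1 + 1 + 1 + j by ring,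
      show m + 1 + j + 1 + 2 = m + 1 + 1 + 1 + j + 1 by ring,
      show (-1 : ℝ) ^ (m + 1 + 1 + 1 + j) = (-1) ^ (m + 1 + j) by ring]
    module

end MinorSystem

section ColumnOperations

variable {E : Type*} [AddCommGroup E] [Module ℝ E] {d : ℕ}

theorem minor_column_add (Ω : E [⋀^Fin d]→ₗ[ℝ] ℝ) {A B : ℕ → E} {J : Finset ℕ} {x y : ℕ}
    (hx : x ∈ J) (hy : y ∈ J) (hxy : x ≠ y) (hB : B x = A x + A y)
    (hAB : ∀ k, k ≠ x → B k = A k) : minor Ω B J = minor Ω A J := by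
  cases d with
  | zero =>
    rw [minor_of_card_ne _ _ (Finset.card_ne_zero_of_mem hx),
      minor_of_card_ne _ _ (Finset.card_ne_zero_of_mem hx)]
  | succ d =>
    have h : ∀ j ∈ J.erase x, B j = A j := fun j hj => hAB j (Finset.ne_of_mem_erase hj)
    rw [← Finset.insert_erase hx, minor_insert _ _ (Finset.notMem_erase _ _),
      minor_insert _ _ (Finset.notMem_erase _ _), minor_congr _ h, hB, map_add, minor_add]
    have h2 := minorLin_col_mem Ω A (Finset.mem_erase.2 ⟨hxy.symm, hy⟩)
    rw [minorLin_apply] at h2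
    rw [h2, add_zero]

theorem minor_add_prev (Ω : E [⋀^Fin d]→ₗ[ℝ] ℝ) (A : ℕ → E) {J : Finset ℕ} {p i : ℕ}
    (h : ∀ k, p ≤ k → k < i → k ∈ J) :
    minor Ω (fun k => if p < k ∧ k < i then A k + A (k - 1) else A k) J = minor Ω A J := by
  rcases le_or_gt i p with hip | hip
  · congr 1
    ext k
    exact if_neg (by omega)
  induction hip.le using Nat.decreasingInduction with
  | self => exact (lt_irrefl _ hip).elim
  | of_succ p hp ih =>
    have h0 : minor Ω (fun k => if p + 1 < k ∧ k < i then A k + A (k - 1) else A k) J =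
        minor Ω A J := by
      rcases Nat.lt_or_ge (p + 1) i with h1 | h1
      · exact ih (fun k hk => h k (by omega)) h1
      · congr 1
        ext k
        exact if_neg (by omega)
    rw [← h0]
    rcases Nat.lt_or_ge (p + 1) i with h1 | h1
    · refine minor_column_add Ω (x := p + 1) (y := p) (h _ (by omega) h1) (h _ le_rfl hip)
        (by omega) ?_ ?_
      · simp [h1]
      · intro k hk
        simp only [show (p < k ∧ k < i) ↔ (p + 1 < k ∧ k < i) by omega]
    · congr 1
      ext k
      simp only [show (p < k ∧ k < i) ↔ (p + 1 < k ∧ k < i) by omega]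

theorem minor_add_next (Ω : E [⋀^Fin d]→ₗ[ℝ] ℝ) (A : ℕ → E) {J : Finset ℕ} {p i : ℕ}
    (h : ∀ k, p ≤ k → k < i → k ∈ J) :
    minor Ω (fun k => if p ≤ k ∧ k + 1 < i then A k + A (k + 1) else A k) J = minor Ω A J := by
  induction i with
  | zero =>
    congr 1
    ext k
    exact if_neg (by omega)
  | succ i ih =>
    rw [← ih fun k hk hki => h k hk (by omega)]
    rcases Nat.lt_or_ge p i with h1 | h1
    · refine minor_column_add Ω (x := i - 1) (y := i) (h _ (by omega) (by omega))
        (h _ (by omega) (by omega)) (by omega) ?_ ?_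
      · have h2 : i - 1 + 1 = i := by omega
        have h3 : p ≤ i - 1 := by omega
        simp [h2, h3]
      · intro k hk
        simp only [show (p ≤ k ∧ k + 1 < i + 1) ↔ (p ≤ k ∧ k + 1 < i) by omega]
    · congr 1
      ext k
      simp only [show (p ≤ k ∧ k + 1 < i + 1) ↔ (p ≤ k ∧ k + 1 < i) by omega]

theorem sdiff_insert_pair {α : Type*} [DecidableEq α] {U Y : Finset α} {u v u' v' a c z s : α}
    (h1 : u' ∉ Y) (h2 : v' ∉ Y) (h3 : u' ∈ U) (h4 : v' ∈ U) (g1 : u ≠ u') (g2 : u ≠ v')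
    (g3 : v ≠ u') (g4 : v ≠ v')
    (hx : ∀ x, (x = u ∨ x = v ∨ x = u' ∨ x = v') ↔ (x = a ∨ x = c ∨ x = z ∨ x = s)) :
    U \ insert u (insert v Y) =
      insert u' (insert v' (U \ insert a (insert c (insert z (insert s Y))))) := by
  ext x
  have h : x ∈ insert a (insert c (insert z (insert s Y))) ↔
      (x = u ∨ x = v ∨ x = u' ∨ x = v') ∨ x ∈ Y := by
    rw [hx]
    simp only [Finset.mem_insert, or_assoc]
  simp only [Finset.mem_sdiff]
  simp only [Finset.mem_insert, Finset.mem_sdiff, h]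
  by_cases e1 : x = u'
  · subst e1
    simp [h3, h1, g1.symm, g3.symm]
  by_cases e2 : x = v'
  · subst e2
    simp [h4, h2, g2.symm, g4.symm]
  simp [e1, e2, or_assoc]

end ColumnOperations

namespace MinorSystem

variable {E : Type*} [AddCommGroup E] [Module ℝ E] {m : ℕ} (S : MinorSystem E (m + 1))

/-- The columns `B`, completed by the untouched columns of the system. -/
noncomputable def colB (k : ℕ) : E :=
  if k = 0 then col S.φ 0 else if k ≤ m + 1 then S.B k else col S.φ (k + 1)

theorem colB_zero : S.colB 0 = col S.φ 0 := if_pos rfl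

theorem colB_of_le {k : ℕ} (h1 : 1 ≤ k) (h2 : k ≤ m + 1) : S.colB k = S.B k := by
  rw [colB, if_neg (by omega), if_pos h2]

theorem minor_colB_pos_of_gap {i j : ℕ} (hi : 1 ≤ i) (hij : i ≤ j) (hj : j ≤ m + 2)
    {J : Finset ℕ} (hJ : J ⊆ Finset.range (2 * m + 3)) (hJc : J.card = m + 1)
    (h1 : ∀ k, 1 ≤ k → k < i → k ∈ J) (h2 : ∀ k, j ≤ k → k < m + 2 → k ∈ J)
    (h3 : ∀ k, i ≤ k → k < j → k ∉ J) : 0 < minor S.Ω₀ S.colB J := by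
  rw [← minor_add_prev S.Ω₀ S.colB h1, ← minor_add_next S.Ω₀ _ h2]
  have key : ∀ k ∈ J, (fun k => if j ≤ k ∧ k + 1 < m + 2 then
      (fun k => if 1 < k ∧ k < i then S.colB k + S.colB (k - 1) else S.colB k) k +
      (fun k => if 1 < k ∧ k < i then S.colB k + S.colB (k - 1) else S.colB k) (k + 1)
      else (fun k => if 1 < k ∧ k < i then S.colB k + S.colB (k - 1) else S.colB k) k) k =
      (if k = 0 then 1 else if k < i then S.lam (S.φ k) else
        if k ≤ m + 1 then S.lam (S.φ (k + 1)) else 1) •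
        col S.φ (if k < i then k else k + 1) := by
    intro k hk
    beta_reduce
    have hk3 : k < i ∨ j ≤ k := by
      by_contra! hh
      exact h3 k hh.1 hh.2 hk
    rcases hk3 with hki | hkj
    · rw [if_neg (by omega), if_pos hki]
      rcases Nat.lt_or_ge 1 k with h | h
      · rw [if_pos ⟨h, hki⟩, if_neg (by omega), if_pos hki, S.colB_of_le (by omega) (by omega),
          S.colB_of_le (by omega) (by omega)]
        have := S.B_add (k := k - 1) (by omega)
        rwa [show k - 1 + 1 = k by omega] at this
      · rw [if_neg (by omega)]
        rcases Nat.eq_zero_or_pos k with rfl | hk0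
        · rw [if_pos rfl, one_smul, colB_zero, if_pos hki]
        · obtain rfl : k = 1 := by omega
          rw [if_neg (by omega), if_pos hki, colB, if_neg (by omega), if_pos (by omega)]
          have := S.B_add (k := 0) (by omega)
          rwa [B_zero, add_zero] at this
    · rw [if_neg (show ¬(1 < k ∧ k < i) by omega), if_neg (show ¬(1 < k + 1 ∧ k + 1 < i) by omega),
        if_neg (show ¬k = 0 by omega), if_neg (show ¬ k < i by omega), if_neg (show ¬ k < i by omega)]
      rcases Nat.lt_or_ge (k + 1) (m + 2) with h | h
      · rw [if_pos ⟨hkj, h⟩, if_pos (by omega), S.colB_of_le (by omega) (by omega),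
          S.colB_of_le (by omega) (by omega), add_comm]
        exact S.B_add (by omega)
      · rw [if_neg (by omega)]
        rcases h.eq_or_lt with h | h
        · obtain rfl : k = m + 1 := by omega
          rw [if_pos le_rfl, colB, if_neg (by omega), if_pos (by omega)]
          have := S.B_add (k := m + 1) le_rfl
          rwa [B_last, zero_add] at this
        · rw [if_neg (by omega), one_smul, colB, if_neg (by omega), if_neg (by omega)]
  rw [minor_congr _ key, minor_smul_columns S.Ω₀ (fun k => col S.φ (if k < i then k else k + 1))]
  refine mul_pos (Finset.prod_pos fun k hk => ?_) ?_
  · split_ifs with h4 h5 h6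
    · exact one_pos
    · exact S.lam_pos (by omega) (by omega)
    · exact S.lam_pos (by omega) (by omega)
    · exact one_pos
  · have hmono : StrictMono fun k : ℕ => if k < i then k else k + 1 := by
      intro a b hab
      dsimp only
      split_ifs <;> omega
    rw [← minor_image S.Ω₀ (col S.φ) hmono]
    refine S.tp₀ (fun x hx => ?_) ?_
    · rw [Finset.mem_image] at hx
      obtain ⟨y, hy, rfl⟩ := hx
      have := hJ hy
      rw [Finset.mem_range] at *
      split_ifs <;> omega
    · rw [Finset.card_image_of_injective _ hmono.injective, hJc]

theorem minor_colB_pos {J : Finset ℕ} (hJ : J ⊆ Finset.range (2 * m + 3)) (hJc : J.card = m + 1) :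
    0 < minor S.Ω₀ S.colB J := by
  set U := Finset.range (2 * m + 3) with hU
  have hmU : ∀ x, x ∈ U ↔ x < 2 * m + 3 := fun x => Finset.mem_range
  set Q : Finset ℕ := insert 0 (Finset.Icc (m + 2) (2 * m + 2)) with hQ
  have hmQ : ∀ x, x ∈ Q ↔ x = 0 ∨ (m + 2 ≤ x ∧ x ≤ 2 * m + 2) := by
    intro x
    rw [hQ, Finset.mem_insert, Finset.mem_Icc]
  have hQc : Q.card = m + 2 := by
    rw [hQ, Finset.card_insert_of_notMem (by simp), Nat.card_Icc]
    omega
  have hUc : U.card = 2 * m + 3 := Finset.card_range _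
  have main := pos_of_contiguous (p := 1) (q := m + 1) (d := m + 2) (Q := Q)
    (g := fun I => minor S.Ω₀ S.colB (U \ I)) (J := U \ J)
    (fun s hs => by rw [hmQ] at hs; omega) (by omega) ?_ ?_ ?_ ?_ (by omega)
  · beta_reduce at main
    rwa [Finset.sdiff_sdiff_eq_self hJ] at main
  · intro Y a c z s hY ha hac hcz hz hs haY hcY hzY hsY hYc
    rw [hmQ] at hs
    set V := U \ insert a (insert c (insert z (insert s Y))) with hV
    have hd : ∀ u v u' v', u ∉ Y → v ∉ Y → u' ∉ Y → v' ∉ Y → u < 2 * m + 3 → v < 2 * m + 3 →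
        u' < 2 * m + 3 → v' < 2 * m + 3 → u ≠ u' → u ≠ v' → v ≠ u' → v ≠ v' →
        (∀ x, (x = u ∨ x = v ∨ x = u' ∨ x = v') ↔ (x = a ∨ x = c ∨ x = z ∨ x = s)) →
        U \ insert u (insert v Y) = insert u' (insert v' V) := by
      intro u v u' v' h1 h2 h3 h4 h5 h6 h7 h8 g1 g2 g3 g4 hx
      rw [hV]
      exact sdiff_insert_pair h3 h4 ((hmU _).2 h7) ((hmU _).2 h8) g1 g2 g3 g4 hx
    have hsa : s < a ∨ z < s := by omega
    have hpl := minor_plucker S.exch₀ S.colB hac hcz hsa (Y := V) (by simp [hV]) (by simp [hV])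
      (by simp [hV]) (by simp [hV])
    rw [hd a z c s haY hzY hcY hsY (by omega) (by omega) (by omega) (by omega) (by omega)
      (by omega) (by omega) (by omega) (fun x => by omega),
      hd c s a z hcY hsY haY hzY (by omega) (by omega) (by omega) (by omega) (by omega)
      (by omega) (by omega) (by omega) (fun x => by omega),
      hd a c z s haY hcY hzY hsY (by omega) (by omega) (by omega) (by omega) (by omega)
      (by omega) (by omega) (by omega) (fun x => by omega),
      hd z s a c hzY hsY haY hcY (by omega) (by omega) (by omega) (by omega) (by omega)
      (by omega) (by omega) (by omega) (fun x => by omega),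
      hd c z a s hcY hzY haY hsY (by omega) (by omega) (by omega) (by omega) (by omega)
      (by omega) (by omega) (by omega) (fun x => by omega),
      hd a s c z haY hsY hcY hzY (by omega) (by omega) (by omega) (by omega) (by omega)
      (by omega) (by omega) (by omega) (fun x => by omega)]
    linarith [hpl]
  · intro i j T hi hij hj hT hc
    have hmem : ∀ x, x ∈ U \ (Finset.Ico i j ∪ T) ↔
        x < 2 * m + 3 ∧ ¬((i ≤ x ∧ x < j) ∨ x ∈ T) := by
      intro x
      rw [Finset.mem_sdiff, Finset.mem_union, Finset.mem_Ico, hmU]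
    have hTm : ∀ x, x ∈ T → x = 0 ∨ (m + 2 ≤ x ∧ x ≤ 2 * m + 2) := fun x hx => (hmQ x).1 (hT hx)
    refine S.minor_colB_pos_of_gap hi hij (by omega) Finset.sdiff_subset ?_ ?_ ?_ ?_
    · rw [Finset.card_sdiff_of_subset, hUc, Finset.card_union_of_disjoint, Nat.card_Ico, hc]
      · omega
      · rw [Finset.disjoint_left]
        intro x hx hx'
        have := hTm x hx'
        rw [Finset.mem_Ico] at hx
        omega
      · intro x hx
        rw [Finset.mem_union, Finset.mem_Ico] at hx
        rw [hmU]
        rcases hx with hx | hx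
        · omega
        · have := hTm x hx
          omega
    · intro k hk hki
      rw [hmem]
      refine ⟨by omega, ?_⟩
      rintro (h | h)
      · omega
      · have := hTm k h
        omega
    · intro k hk hki
      rw [hmem]
      refine ⟨by omega, ?_⟩
      rintro (h | h)
      · omega
      · have := hTm k h
        omega
    · intro k hk hki hh
      rw [hmem] at hh
      exact hh.2 (Or.inl ⟨hk, hki⟩)
  · intro x hx
    rw [Finset.mem_sdiff, hmU] at hx
    rw [Finset.mem_union, Finset.mem_Icc, hmQ]
    omega
  · rw [Finset.card_sdiff_of_subset hJ, hUc, hJc]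
    omega

/-- The normalised sections, completed by the untouched columns of the system. -/
noncomputable def colPhat (k : ℕ) : E := if k ≤ m + 2 then S.phat k else col S.φ (k + 1)

theorem minor_colPhat_pos {J : Finset ℕ} (hJ : J ⊆ Finset.range (2 * m + 3))
    (hJc : J.card = m + 1) : 0 < minor S.Ω₀ S.colPhat J := by
  have key : ∀ k ∈ J, S.colPhat k = (if k = 0 then (S.lam (S.φ 1))⁻¹ else
      if k ≤ m + 1 then (S.lam (S.φ (k + 1)) * S.lam (S.φ k))⁻¹ else
      if k = m + 2 then (S.lam (S.φ k))⁻¹ else 1) • S.colB k := by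
    intro k _
    rw [colPhat, colB]
    rcases Nat.eq_zero_or_pos k with rfl | hk0
    · rw [if_pos (by omega), if_pos rfl, if_pos rfl, phat, if_neg (by omega), col, chi_zero,
        S.φ_zero]
    rw [if_neg (show ¬k = 0 by omega), if_neg (show ¬k = 0 by omega)]
    rcases Nat.lt_or_ge (m + 1) k with h | h
    · rw [if_neg (show ¬k ≤ m + 1 by omega), if_neg (show ¬k ≤ m + 1 by omega)]
      by_cases h2 : k = m + 2
      · rw [if_pos h2.le, if_pos h2, phat, if_pos h2, h2]
      · rw [if_neg (by omega), if_neg h2, one_smul]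
    · rw [if_pos (by omega), if_pos h, if_pos h, phat, if_neg (by omega), B, smul_smul,
        mul_inv, mul_assoc, inv_mul_cancel₀ (S.lam_ne hk0 (by omega)), mul_one]
  rw [minor_congr _ key, minor_smul_columns]
  refine mul_pos (Finset.prod_pos fun k hk => ?_) (S.minor_colB_pos hJ hJc)
  have := S.lam_one_pos
  split_ifs with h1 h2 h3
  · positivity
  · have := S.lam_pos (k := k) (by omega) (by omega)
    have := S.lam_pos (k := k + 1) (by omega) (by omega)
    positivity
  · have := S.lam_pos (k := k) (by omega) (by omega)
    positivity
  · exact one_pos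

end MinorSystem

section Telescope

variable {E : Type*} [AddCommGroup E] [Module ℝ E] {d : ℕ}

theorem Exchange.minorLin_eq_zero {Ω : E [⋀^Fin (d + 1)]→ₗ[ℝ] ℝ} (h : Exchange Ω) {A B : ℕ → E}
    {R J : Finset ℕ} {q v : E} (hq : minorLin Ω A R q ≠ 0) (hv : minorLin Ω A R v = 0)
    (hJ : ∀ j ∈ J, minorLin Ω A R (B j) = 0) : minorLin Ω B J v = 0 := by
  rw [minorLin_apply]
  by_cases hJc : J.card = d
  swap
  · exact minor_of_card_ne _ _ hJc
  have hR : R.card = d := by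
    by_contra hR
    exact hq (minor_of_card_ne _ _ hR)
  simp only [minorLin_apply, minor, dif_pos hR, AlternatingMap.curryLeft_apply_apply] at hq hJ hv
  rw [minor, dif_pos hJc, AlternatingMap.curryLeft_apply_apply]
  refine h.eq_zero hq fun i => ?_
  cases i using Fin.cases with
  | zero => exact hv
  | succ i => exact hJ _ (Finset.orderEmbOfFin_mem _ _ _)

theorem minor_curryLeft_plucker {Ω : E [⋀^Fin (d + 1)]→ₗ[ℝ] ℝ} (h : Exchange Ω) (v : E)
    (A : ℕ → E) {a c z s : ℕ} {Y : Finset ℕ} (hac : a < c) (hcz : c < z) (hs : s < a ∨ z < s)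
    (ha : a ∉ Y) (hc : c ∉ Y) (hz : z ∉ Y) (hsY : s ∉ Y) :
    minor (Ω.curryLeft v) A (insert a (insert z Y)) *
        minor (Ω.curryLeft v) A (insert c (insert s Y)) =
      minor (Ω.curryLeft v) A (insert a (insert c Y)) *
        minor (Ω.curryLeft v) A (insert z (insert s Y)) +
      minor (Ω.curryLeft v) A (insert c (insert z Y)) *
        minor (Ω.curryLeft v) A (insert a (insert s Y)) := by
  cases d with
  | zero =>
    have : ∀ u Y, minor (Ω.curryLeft v) A (insert u Y) = 0 := fun u Y =>
      minor_of_card_ne _ _ (Finset.card_ne_zero_of_mem (Finset.mem_insert_self _ _))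
    simp only [this]
    ring
  | succ d => exact minor_plucker (h.curryLeft v) A hac hcz hs ha hc hz hsY

theorem minor_telescope (Ω : E [⋀^Fin (d + 1)]→ₗ[ℝ] ℝ) (P C : ℕ → E) {i j : ℕ} {T : Finset ℕ}
    (hij : i ≤ j) (hT : ∀ t ∈ T, j ≤ t) (hC : ∀ k, i ≤ k → k < j → C k = P (k + 1) - P k)
    (hCT : ∀ t ∈ T, C t = P (t + 1)) :
    minor (Ω.curryLeft (P i)) C (Finset.Ico i j ∪ T) =
      minor Ω P (Finset.Icc i j ∪ T.image (· + 1)) := by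
  have hsucc : StrictMono (· + 1 : ℕ → ℕ) := fun a b h => Nat.succ_lt_succ h
  induction hij using Nat.decreasingInduction generalizing d with
  | self =>
    have hn : j ∉ T.image (· + 1) := by
      intro h
      obtain ⟨t, ht, h⟩ := Finset.mem_image.1 h
      have := hT t ht
      omega
    have he : (T.image (· + 1)).filter (· < j) = ∅ := by
      rw [Finset.filter_eq_empty_iff]
      intro x hx
      obtain ⟨t, ht, h⟩ := Finset.mem_image.1 hx
      have := hT t ht
      omega
    rw [Finset.Ico_self, Finset.empty_union, Finset.Icc_self, Finset.singleton_union,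
      minor_insert _ _ hn, he, Finset.card_empty, pow_zero, one_mul, minor_image _ _ hsucc]
    exact minor_congr _ hCT
  | of_succ i hi ih =>
    have hn : i ∉ Finset.Ico (i + 1) j ∪ T := by
      rw [Finset.mem_union, Finset.mem_Ico]
      rintro (h | h)
      · omega
      · have := hT _ h
        omega
    have hn' : i ∉ Finset.Icc (i + 1) j ∪ T.image (· + 1) := by
      rw [Finset.mem_union, Finset.mem_Icc, Finset.mem_image]
      rintro (h | ⟨t, ht, h⟩)
      · omega
      · have := hT _ ht
        omega
    have he : (Finset.Ico (i + 1) j ∪ T).filter (· < i) = ∅ := by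
      rw [Finset.filter_eq_empty_iff]
      intro x hx
      rcases Finset.mem_union.1 hx with hx | hx
      · rw [Finset.mem_Ico] at hx
        omega
      · have := hT _ hx
        omega
    have he' : (Finset.Icc (i + 1) j ∪ T.image (· + 1)).filter (· < i) = ∅ := by
      rw [Finset.filter_eq_empty_iff]
      intro x hx
      rcases Finset.mem_union.1 hx with hx | hx
      · rw [Finset.mem_Icc] at hx
        omega
      · obtain ⟨t, ht, h⟩ := Finset.mem_image.1 hx
        have := hT t ht
        omega
    have hI : Finset.Ico i j = insert i (Finset.Ico (i + 1) j) := by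
      ext x
      simp only [Finset.mem_insert, Finset.mem_Ico]
      omega
    have hI' : Finset.Icc i j = insert i (Finset.Icc (i + 1) j) := by
      ext x
      simp only [Finset.mem_insert, Finset.mem_Icc]
      omega
    rw [hI, hI', Finset.insert_union, Finset.insert_union, minor_insert _ _ hn', he',
      Finset.card_empty, pow_zero, one_mul]
    cases d with
    | zero =>
      rw [minor_of_card_ne _ _ (Finset.card_ne_zero_of_mem (Finset.mem_insert_self _ _)),
        minor_of_card_ne]
      refine Finset.card_ne_zero_of_mem (a := i + 1) ?_
      rw [Finset.mem_union, Finset.mem_Icc]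
      omega
    | succ d =>
      rw [minor_insert _ _ hn, he, Finset.card_empty, pow_zero, one_mul, hC i le_rfl hi, map_sub,
        AlternatingMap.curryLeft_same, sub_zero]
      exact ih _ fun k hk => hC k (by omega)

end Telescope

namespace MinorSystem

variable {E : Type*} [AddCommGroup E] [Module ℝ E] {m : ℕ} (S : MinorSystem E (m + 1))

/-- The normalised columns of the smaller system. -/
noncomputable def colDiff (k : ℕ) : E :=
  if k ≤ m + 1 then S.phat (k + 1) - S.phat k else col S.φ (k + 2)

theorem lam_colDiff {k : ℕ} (hk : k < 2 * m + 2) : S.lam (S.colDiff k) = 0 := by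
  rw [colDiff]
  split_ifs with h
  · rw [map_sub, S.lam_phat (by omega), S.lam_phat (by omega), sub_self]
  · exact S.lam_col (by omega) (by omega)

theorem minor_colDiff_pos {J : Finset ℕ} (hJ : J ⊆ Finset.range (2 * m + 2)) (hJc : J.card = m) :
    0 < minor (S.Ω₀.curryLeft S.q) S.colDiff J := by
  set Q : Finset ℕ := Finset.Icc (m + 2) (2 * m + 1) with hQ
  have hQc : Q.card = m := by
    rw [hQ, Nat.card_Icc]
    omega
  refine pos_of_contiguous (p := 0) (q := m + 1) (d := m) (Q := Q)
    (fun s hs => by rw [hQ, Finset.mem_Icc] at hs; omega) (by omega)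
    (g := fun I => minor (S.Ω₀.curryLeft S.q) S.colDiff I) ?_ ?_ ?_ hJc (by omega)
  · intro Y a c z s _ ha hac hcz hz hs haY hcY hzY hsY _
    rw [hQ, Finset.mem_Icc] at hs
    exact minor_curryLeft_plucker S.exch₀ S.q S.colDiff hac hcz (by omega) haY hcY hzY hsY
  · intro i j T _ hij hj hT hc
    have hTm : ∀ x ∈ T, m + 2 ≤ x ∧ x ≤ 2 * m + 1 := fun x hx => Finset.mem_Icc.1 (hT hx)
    have hz : minorLin S.Ω₀ S.colDiff (Finset.Ico i j ∪ T)
        (S.q - S.lam (S.φ (m + 2)) • S.phat i) = 0 := by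
      refine S.exch₀.minorLin_eq_zero (A := col S.φ) (R := Finset.Ico (m + 4) (2 * m + 4))
        S.lam_one_pos.ne' ?_ ?_
      · change S.lam _ = 0
        rw [map_sub, map_smul, S.lam_q, S.lam_phat (by omega), smul_eq_mul, mul_one, sub_self]
      · intro k hk
        refine S.lam_colDiff ?_
        rcases Finset.mem_union.1 hk with hk | hk
        · rw [Finset.mem_Ico] at hk
          omega
        · have := hTm k hk
          omega
    have htel := minor_telescope S.Ω₀ S.colPhat S.colDiff hij (T := T)
      (fun t ht => by have := hTm t ht; omega)
      (fun k hk hkj => by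
        rw [colDiff, if_pos (by omega), colPhat, colPhat, if_pos (by omega), if_pos (by omega)])
      (fun t ht => by
        have := hTm t ht
        rw [colDiff, if_neg (by omega), colPhat, if_neg (by omega)])
    rw [colPhat, if_pos (by omega)] at htel
    rw [map_sub, map_smul, sub_eq_zero, minorLin_apply, minorLin_apply, htel, smul_eq_mul] at hz
    rw [hz]
    refine mul_pos (S.lam_pos (by omega) le_rfl) (S.minor_colPhat_pos ?_ ?_)
    · intro x hx
      rw [Finset.mem_range]
      rcases Finset.mem_union.1 hx with hx | hx
      · rw [Finset.mem_Icc] at hx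
        omega
      · obtain ⟨t, ht, rfl⟩ := Finset.mem_image.1 hx
        have := hTm t ht
        omega
    · rw [Finset.card_union_of_disjoint, Nat.card_Icc,
        Finset.card_image_of_injective _ (add_left_injective 1)]
      · omega
      · rw [Finset.disjoint_left]
        intro x hx hx'
        obtain ⟨t, ht, rfl⟩ := Finset.mem_image.1 hx'
        have := hTm t ht
        rw [Finset.mem_Icc] at hx
        omega
  · intro x hx
    have := Finset.mem_range.1 (hJ hx)
    rw [Finset.mem_union, hQ, Finset.mem_Icc, Finset.mem_Icc]
    omega

theorem minor_col_φ' {J : Finset ℕ} (hJ : J ⊆ Finset.range (2 * m + 2)) (hJc : J.card = m) :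
    0 < (-1) ^ m * minor (S.Ω₀.curryLeft S.q) (col S.φ') J := by
  have key : ∀ k ∈ J, col S.φ' k =
      (-(if k ≤ m + 1 then S.lam (S.φ (k + 1)) else 1)) • S.colDiff k := by
    intro k _
    rw [colDiff]
    split_ifs with h
    · rw [S.col_φ'_low h, neg_smul]
    · rw [S.col_φ'_high (by omega), neg_smul, one_smul]
  rw [minor_congr _ key, minor_smul_columns, Finset.prod_neg, hJc, ← mul_assoc, ← mul_assoc,
    ← pow_add, Even.neg_one_pow ⟨m, rfl⟩, one_mul]
  refine mul_pos (Finset.prod_pos fun k _ => ?_) (S.minor_colDiff_pos hJ hJc)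
  split_ifs with h
  · exact S.lam_pos (by omega) (by omega)
  · exact one_pos

/-- The smaller system, obtained by contracting with `q`. -/
noncomputable def next : MinorSystem E m where
  Ω := (-1 : ℝ) ^ (m + 1) • S.Ω.curryLeft S.q
  φ := S.φ'
  φ_zero := by rw [S.φ'_of_le (by omega), chi_zero]
  φ_last := by
    rw [S.φ'_of_ge (by omega)]
    exact neg_eq_zero.2 S.φ_last
  φ_top := by
    rw [S.φ'_of_ge (by omega), S.φ'_of_ge (by omega)]
    exact congrArg _ S.φ_top
  exch := (S.exch.curryLeft _).smul _
  lag := S.lag_φ'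
  tp J hJ hJc := by
    have h := S.minor_col_φ' hJ hJc
    rw [Ω₀, AlternatingMap.curryLeft_smul, LinearMap.smul_apply, minor_smul] at h
    rw [AlternatingMap.curryLeft_smul, LinearMap.smul_apply, minor_smul,
      S.φ'_of_ge (by omega), map_neg, minor_neg, curryLeft_swap, minor_neg, neg_neg]
    exact h

end MinorSystem

section Screened

variable {E : Type*} [AddCommGroup E] [Module ℝ E] {n : ℕ}

/-- The combination of maximal minors attached to a noncrossing involution. -/
noncomputable def screened (β : NCInv (n + 1)) (Ω : E [⋀^Fin (n + 1)]→ₗ[ℝ] ℝ) (A : ℕ → E) : ℝ :=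
  ∑ K ∈ (Finset.Icc 1 (2 * n + 1)).powersetCard (n + 1), β.ind (insert 0 K) * minor Ω A K

theorem sum_powersetCard_mem {V : Finset ℕ} {y : ℕ} (hy : y ∈ V) (c : ℕ) (f : Finset ℕ → ℝ) :
    ∑ K ∈ V.powersetCard (c + 1), (if y ∈ K then f (K.erase y) else 0) =
      ∑ T ∈ V.powersetCard c, (if y ∈ T then 0 else f T) := by
  have h : ∀ T : Finset ℕ, (if y ∈ T then 0 else f T) = if y ∉ T then f T else 0 := fun T =>
    (ite_not _ _ _).symm
  rw [Finset.sum_congr rfl fun T _ => h T, ← Finset.sum_filter, ← Finset.sum_filter]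
  refine Finset.sum_bij' (fun K _ => K.erase y) (fun T _ => insert y T) ?_ ?_ ?_ ?_ ?_
  · intro K hK
    rw [Finset.mem_filter, Finset.mem_powersetCard] at *
    refine ⟨⟨(Finset.erase_subset _ _).trans hK.1.1, ?_⟩, Finset.notMem_erase _ _⟩
    rw [Finset.card_erase_of_mem hK.2, hK.1.2, Nat.add_sub_cancel]
  · intro T hT
    rw [Finset.mem_filter, Finset.mem_powersetCard] at *
    refine ⟨⟨Finset.insert_subset hy hT.1.1, ?_⟩, Finset.mem_insert_self _ _⟩
    rw [Finset.card_insert_of_notMem hT.2, hT.1.2]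
  · intro K hK
    exact Finset.insert_erase (Finset.mem_filter.1 hK).2
  · intro T hT
    exact Finset.erase_insert (Finset.mem_filter.1 hT).2
  · intro K hK
    rfl

theorem minor_column_add_smul {d : ℕ} (Ω : E [⋀^Fin d]→ₗ[ℝ] ℝ) {A B : ℕ → E} {k y : ℕ} {c : ℝ}
    (hky : y = k + 1 ∨ k = y + 1) (hB : B y = A y + c • A k) (hAB : ∀ x, x ≠ y → B x = A x)
    (J : Finset ℕ) : minor Ω B J = minor Ω A J +
      c * (if y ∈ J then (if k ∈ J then 0 else minor Ω A (insert k (J.erase y))) else 0) := by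
  by_cases hy : y ∈ J
  swap
  · rw [if_neg hy, mul_zero, add_zero]
    exact minor_congr _ fun j hj => hAB j (by rintro rfl; exact hy hj)
  cases d with
  | zero =>
    rw [if_pos hy, minor_of_card_ne _ _ (Finset.card_ne_zero_of_mem hy),
      minor_of_card_ne _ _ (Finset.card_ne_zero_of_mem hy),
      minor_of_card_ne _ _ (Finset.card_ne_zero_of_mem (Finset.mem_insert_self _ _))]
    simp
  | succ d =>
    obtain ⟨T, hT, rfl⟩ : ∃ T, y ∉ T ∧ insert y T = J :=
      ⟨J.erase y, Finset.notMem_erase _ _, Finset.insert_erase hy⟩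
    have h : ∀ j ∈ T, B j = A j := fun j hj => hAB j (by rintro rfl; exact hT hj)
    rw [if_pos hy, Finset.erase_insert hT, minor_insert _ _ hT, minor_insert _ _ hT,
      minor_congr _ h, hB, map_add, map_smul, minor_add, minor_smul, ← minorLin_apply _ _ _ (A k)]
    by_cases hk : k ∈ T
    · rw [minorLin_col_mem _ _ hk, if_pos (Finset.mem_insert_of_mem hk)]
      ring
    · have hk' : k ∉ insert y T := by
        rw [Finset.mem_insert]
        rintro (rfl | h)
        · omega
        · exact hk h
      have hf : T.filter (· < y) = T.filter (· < k) := by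
        refine Finset.filter_congr fun x hx => ?_
        have : x ≠ y := by rintro rfl; exact hT hx
        have : x ≠ k := by rintro rfl; exact hk hx
        omega
      have hs : ((-1 : ℝ) ^ (T.filter (· < k)).card) * (-1) ^ (T.filter (· < k)).card = 1 := by
        rw [← pow_add, Even.neg_one_pow ⟨_, rfl⟩]
      rw [if_neg hk', minorLin_col _ _ hk, hf]
      linear_combination c * minor Ω A (insert k T) * hs

theorem minor_columns_add_smul {d : ℕ} (Ω : E [⋀^Fin d]→ₗ[ℝ] ℝ) {A B : ℕ → E} {k : ℕ} {c : ℝ}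
    (hk : 1 ≤ k) (h1 : B (k - 1) = A (k - 1) + c • A k) (h2 : B (k + 1) = A (k + 1) + c • A k)
    (hAB : ∀ x, x ≠ k - 1 → x ≠ k + 1 → B x = A x) (J : Finset ℕ) :
    minor Ω B J = minor Ω A J +
      c * ((if k - 1 ∈ J then (if k ∈ J then 0 else minor Ω A (insert k (J.erase (k - 1)))) else 0) +
        (if k + 1 ∈ J then (if k ∈ J then 0 else minor Ω A (insert k (J.erase (k + 1)))) else 0)) := by
  set A₁ : ℕ → E := Function.update A (k - 1) (A (k - 1) + c • A k) with hA₁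
  have hA₁y : A₁ (k - 1) = A (k - 1) + c • A k := Function.update_self _ _ _
  have hA₁x : ∀ x, x ≠ k - 1 → A₁ x = A x := fun x hx => Function.update_of_ne hx _ _
  have e1 : ∀ J, minor Ω A₁ J = _ :=
    minor_column_add_smul Ω (A := A) (B := A₁) (k := k) (y := k - 1) (by omega) hA₁y hA₁x
  have e2 := minor_column_add_smul Ω (A := A₁) (B := B) (k := k) (y := k + 1) (c := c) (by omega)
    (by rw [h2, hA₁x _ (by omega), hA₁x _ (by omega)])
    (fun x hx => by
      by_cases hx1 : x = k - 1
      · rw [hx1, h1, hA₁y]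
      · rw [hAB x hx1 hx, hA₁x x hx1]) J
  have e3 := e1 (insert k (J.erase (k + 1)))
  rw [if_pos (Finset.mem_insert_self _ _), ite_self, mul_zero, add_zero] at e3
  rw [e2, e3, e1]
  ring

theorem screened_columns_add_smul (β : NCInv (n + 1)) (Ω : E [⋀^Fin (n + 1)]→ₗ[ℝ] ℝ)
    {A B : ℕ → E} {k : ℕ} {c : ℝ} (hk : 1 ≤ k ∧ k + 1 ≤ 2 * (n + 1)) (hk2 : k + 1 ≤ 2 * n + 1)
    (h1 : B (k - 1) = A (k - 1) + c • A k) (h2 : B (k + 1) = A (k + 1) + c • A k)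
    (hAB : ∀ x, x ≠ k - 1 → x ≠ k + 1 → B x = A x) :
    screened β Ω B = screened β Ω A +
      c * (if β.toFun k = k + 1 then 0 else screened (β.e k hk) Ω A) := by
  set V := Finset.Icc 1 (2 * n + 1) with hV
  have hVm : ∀ x, x ∈ V ↔ 1 ≤ x ∧ x ≤ 2 * n + 1 := fun x => Finset.mem_Icc
  have h0 : ∀ c, ∀ T ∈ V.powersetCard c, 0 ∉ T := by
    intro c T hT h
    have := (hVm _).1 ((Finset.mem_powersetCard.1 hT).1 h)
    omega
  -- each of the two correction sums, indexed by the set with the moved column removed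
  have hsum : ∀ y, y ≠ k → y ≤ 2 * n + 1 →
      ∑ K ∈ V.powersetCard (n + 1), β.ind (insert 0 K) *
        (if y ∈ K then (if k ∈ K then 0 else minor Ω A (insert k (K.erase y))) else 0) =
      ∑ T ∈ V.powersetCard n, (if k ∈ T then 0 else
        (if y ∈ insert 0 T then 0 else β.ind (insert y (insert 0 T))) *
          minor Ω A (insert k T)) := by
    intro y hyk hy
    by_cases hy0 : y ∈ V
    · have hy1 := (hVm y).1 hy0
      have := sum_powersetCard_mem hy0 n (fun T => if k ∈ T then 0 else
        β.ind (insert y (insert 0 T)) * minor Ω A (insert k T))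
      refine Eq.trans (Finset.sum_congr rfl fun K hK => ?_)
        (this.trans (Finset.sum_congr rfl fun T hT => ?_))
      · by_cases hyK : y ∈ K
        · rw [if_pos hyK, if_pos hyK]
          by_cases hkK : k ∈ K
          · rw [if_pos hkK, if_pos (Finset.mem_erase.2 ⟨hyk.symm, hkK⟩), mul_zero]
          · rw [if_neg hkK, if_neg fun h => hkK (Finset.mem_of_mem_erase h)]
            rw [Finset.insert_comm, Finset.insert_erase hyK]
        · rw [if_neg hyK, if_neg hyK, mul_zero]
      · have hyT : y ∈ insert 0 T ↔ y ∈ T := by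
          rw [Finset.mem_insert, or_iff_right (by omega)]
        simp only [hyT]
        split_ifs <;> simp
    · have hy1 : y = 0 := by
        rw [hVm] at hy0
        omega
      subst hy1
      rw [Finset.sum_eq_zero, Finset.sum_eq_zero]
      · intro T _
        rw [if_pos (Finset.mem_insert_self _ _), zero_mul, ite_self]
      · intro K hK
        rw [if_neg (h0 _ K hK), mul_zero]
  have hexp : screened β Ω B = screened β Ω A + c * ∑ T ∈ V.powersetCard n, (if k ∈ T then 0 else
      ((if k - 1 ∈ insert 0 T then 0 else β.ind (insert (k - 1) (insert 0 T))) +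
        (if k + 1 ∈ insert 0 T then 0 else β.ind (insert (k + 1) (insert 0 T)))) *
          minor Ω A (insert k T)) := by
    have e1 := hsum (k - 1) (by omega) (by omega)
    have e2 := hsum (k + 1) (by omega) (by omega)
    have e3 : ∀ T, (if k ∈ T then 0 else
      ((if k - 1 ∈ insert 0 T then 0 else β.ind (insert (k - 1) (insert 0 T))) +
        (if k + 1 ∈ insert 0 T then 0 else β.ind (insert (k + 1) (insert 0 T)))) *
          minor Ω A (insert k T)) =
        (if k ∈ T then 0 else
        (if k - 1 ∈ insert 0 T then 0 else β.ind (insert (k - 1) (insert 0 T))) *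
          minor Ω A (insert k T)) + (if k ∈ T then 0 else
        (if k + 1 ∈ insert 0 T then 0 else β.ind (insert (k + 1) (insert 0 T))) *
          minor Ω A (insert k T)) := by
      intro T
      split_ifs <;> ring
    rw [Finset.sum_congr rfl fun T _ => e3 T, Finset.sum_add_distrib, ← e1, ← e2,
      ← Finset.sum_add_distrib, Finset.mul_sum, screened, screened, ← Finset.sum_add_distrib]
    refine Finset.sum_congr rfl fun K _ => ?_
    rw [minor_columns_add_smul Ω hk.1 h1 h2 hAB K]
    ring
  rw [hexp]
  congr 2
  have hT0 : ∀ T ∈ V.powersetCard n, (insert 0 T).card = n + 1 := by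
    intro T hT
    rw [Finset.card_insert_of_notMem (h0 _ T hT), (Finset.mem_powersetCard.1 hT).2]
  have hk0 : k ≠ 0 := by omega
  split_ifs with hb
  · refine Finset.sum_eq_zero fun T hT => ?_
    split_ifs with hkT hT1 hT2 hT2
    · rfl
    · rw [add_zero, zero_mul]
    · rw [β.ind_of_link hb, zero_add, zero_mul]
      · rw [Finset.card_insert_of_notMem hT2, hT0 T hT]
      · simp [hkT, hk0]
    · rw [β.ind_of_link hb, zero_add, zero_mul]
      · rw [Finset.card_insert_of_notMem hT1, hT0 T hT]
      · simp only [Finset.mem_insert, not_or]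
        exact ⟨by omega, hk0, hkT⟩
    · rw [β.ind_of_link hb, β.ind_of_link hb, zero_add, zero_mul]
      · rw [Finset.card_insert_of_notMem hT2, hT0 T hT]
      · simp [hkT, hk0]
      · rw [Finset.card_insert_of_notMem hT1, hT0 T hT]
      · simp only [Finset.mem_insert, not_or]
        exact ⟨by omega, hk0, hkT⟩
  · have hkV : k ∈ V := (hVm k).2 (by omega)
    have := sum_powersetCard_mem hkV n (fun T =>
      (β.e k hk).ind (insert k (insert 0 T)) * minor Ω A (insert k T))
    rw [screened, ← hV]
    refine Eq.trans (Finset.sum_congr rfl fun T hT => ?_)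
      (this.symm.trans (Finset.sum_congr rfl fun K hK => ?_))
    · by_cases hkT : k ∈ T
      · rw [if_pos hkT, if_pos hkT]
      · rw [if_neg hkT, if_neg hkT, β.ind_e hk hb (hT0 T hT)]
        simp [hkT, hk0]
    · split_ifs with hkK
      · rw [Finset.insert_comm, Finset.insert_erase hkK]
      · rw [(β.e k hk).ind_of_link (β.e_self k hk), zero_mul]
        · rw [Finset.card_insert_of_notMem (h0 _ K hK), (Finset.mem_powersetCard.1 hK).2]
        · simp [hkK, hk0]

end Screened

section PowersetSums

theorem sum_powersetCard_insert {x : ℕ} {V : Finset ℕ} (hx : x ∉ V) (c : ℕ) (f : Finset ℕ → ℝ) :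
    ∑ K ∈ (insert x V).powersetCard (c + 1), f K =
      ∑ K ∈ V.powersetCard (c + 1), f K + ∑ T ∈ V.powersetCard c, f (insert x T) := by
  rw [Finset.powersetCard_succ_insert hx, Finset.sum_union, Finset.sum_image]
  · intro T hT T' hT' h
    have h1 : x ∉ T := fun h => hx ((Finset.mem_powersetCard.1 hT).1 h)
    have h2 : x ∉ T' := fun h => hx ((Finset.mem_powersetCard.1 hT').1 h)
    rw [← Finset.erase_insert h1, ← Finset.erase_insert h2]
    exact congrArg (fun S => S.erase x) h
  · rw [Finset.disjoint_left]
    intro K hK hK'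
    obtain ⟨T, _, rfl⟩ := Finset.mem_image.1 hK'
    exact hx ((Finset.mem_powersetCard.1 hK).1 (Finset.mem_insert_self _ _))

theorem sum_powersetCard_insert_of_zero {x : ℕ} {V : Finset ℕ} (c : ℕ) {f : Finset ℕ → ℝ}
    (hf : ∀ K, x ∈ K → f K = 0) :
    ∑ K ∈ (insert x V).powersetCard c, f K = ∑ K ∈ V.powersetCard c, f K := by
  symm
  refine Finset.sum_subset (Finset.powersetCard_mono (Finset.subset_insert _ _)) fun K hK hK' => ?_
  refine hf K ?_
  by_contra hx
  rw [Finset.mem_powersetCard] at hK hK'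
  exact hK' ⟨(Finset.subset_insert_iff_of_notMem hx).1 hK.1, hK.2⟩

theorem sum_powersetCard_image {σ : ℕ → ℕ} (hσ : Function.Injective σ) (W : Finset ℕ) (c : ℕ)
    (f : Finset ℕ → ℝ) :
    ∑ K ∈ (W.image σ).powersetCard c, f K = ∑ T ∈ W.powersetCard c, f (T.image σ) := by
  have h := Finset.powersetCard_map ⟨σ, hσ⟩ c W
  rw [Finset.map_eq_image] at h
  change (W.image σ).powersetCard c = _ at h
  rw [h, Finset.sum_map]
  refine Finset.sum_congr rfl fun T _ => ?_
  congr 1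
  exact Finset.map_eq_image _ _

theorem sum_powersetCard_image_insert {σ : ℕ → ℕ} (hσ : Function.Injective σ) {W : Finset ℕ}
    {x y z : ℕ} (hx : x ∉ insert y (insert z (W.image σ))) (hy : y ∉ insert z (W.image σ)) (c : ℕ)
    {f : Finset ℕ → ℝ} (hf : ∀ K, z ∈ K → f K = 0) :
    ∑ K ∈ (insert x (insert y (insert z (W.image σ)))).powersetCard (c + 2), f K =
      (∑ T ∈ W.powersetCard (c + 2), f (T.image σ) +
        ∑ T ∈ W.powersetCard (c + 1), f (insert y (T.image σ))) +
      (∑ T ∈ W.powersetCard (c + 1), f (insert x (T.image σ)) +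
        ∑ T ∈ W.powersetCard c, f (insert x (insert y (T.image σ)))) := by
  rw [sum_powersetCard_insert hx, sum_powersetCard_insert hy, sum_powersetCard_insert hy,
    sum_powersetCard_insert_of_zero _ hf,
    sum_powersetCard_insert_of_zero _ fun K hK => hf _ (Finset.mem_insert_of_mem hK),
    sum_powersetCard_insert_of_zero _ fun K hK => hf _ (Finset.mem_insert_of_mem hK),
    sum_powersetCard_insert_of_zero _ fun K hK =>
      hf _ (Finset.mem_insert_of_mem (Finset.mem_insert_of_mem hK)),
    sum_powersetCard_image hσ, sum_powersetCard_image hσ, sum_powersetCard_image hσ,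
    sum_powersetCard_image hσ]

theorem prod_ite_lt_neg_one (T : Finset ℕ) (a : ℕ) :
    ∏ j ∈ T, (if j < a then (1 : ℝ) else -1) = (-1) ^ T.card * (-1) ^ (T.filter (· < a)).card := by
  rw [Finset.prod_ite, Finset.prod_const_one, one_mul, Finset.prod_const,
    ← Finset.card_filter_add_card_filter_not (s := T) (fun j => j < a), pow_add, mul_right_comm,
    ← pow_add, Even.neg_one_pow ⟨_, rfl⟩, one_mul]

end PowersetSums

namespace MinorSystem

variable {E : Type*} [AddCommGroup E] [Module ℝ E] {m : ℕ} (S : MinorSystem E (m + 1))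

/-- The sequences interpolating between `φ` and its reduction `chi`. -/
noncomputable def xi (k j : ℕ) : E := if j ≤ k then S.chi j else S.φ j

theorem xi_of_le {k j : ℕ} (h : j ≤ k) : S.xi k j = S.chi j := if_pos h

theorem xi_of_lt {k j : ℕ} (h : k < j) : S.xi k j = S.φ j := if_neg (by omega)

theorem xi_zero : S.xi 0 = S.φ := by
  ext j
  rcases Nat.eq_zero_or_pos j with rfl | h
  · rw [S.xi_of_le le_rfl, chi_zero, S.φ_zero]
  · exact S.xi_of_lt h

theorem col_xi_top_low {k : ℕ} (hk : k ≤ m) : col (S.xi (m + 1)) k = col S.φ' k := by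
  rw [col, col, S.xi_of_le (by omega), S.xi_of_le (by omega), S.φ'_of_le (by omega),
    S.φ'_of_le (by omega)]

theorem col_xi_top_q : col (S.xi (m + 1)) (m + 1) = S.q := by
  rw [col, S.xi_of_lt (by omega), S.xi_of_le (by omega)]
  rfl

theorem col_xi_top_zero : col (S.xi (m + 1)) (m + 2) = 0 := by
  rw [col, S.xi_of_lt (by omega), S.xi_of_le (by omega), show m + 2 - 1 = m + 1 from rfl, chi_last]
  exact add_neg_cancel _

theorem col_xi_top_succ : col (S.xi (m + 1)) (m + 3) = S.q - col S.φ' (m + 1) := by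
  rw [col, S.xi_of_lt (by omega), S.xi_of_lt (by omega), col, S.φ'_of_ge (by omega),
    S.φ'_of_le (by omega), q]
  change S.φ (m + 4) + S.φ (m + 2) = S.φ (m + 2) + S.chi m - (-S.φ (m + 4) + S.chi m)
  abel

theorem col_xi_top_high {k : ℕ} (hk : m + 2 ≤ k) :
    col (S.xi (m + 1)) (k + 2) = -col S.φ' k := by
  rw [S.col_φ'_high hk, neg_neg, col, col, S.xi_of_lt (by omega), S.xi_of_lt (by omega)]

theorem lam_col_φ' {k : ℕ} (hk : k < 2 * m + 2) : S.lam (col S.φ' k) = 0 := by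
  rcases Nat.lt_or_ge (m + 1) k with h | h
  · rw [S.col_φ'_high (by omega), map_neg, S.lam_col (by omega) (by omega), neg_zero]
  · rw [S.col_φ'_low h, map_neg, map_smul, map_sub, S.lam_phat (by omega), S.lam_phat (by omega),
      sub_self, smul_zero, neg_zero]

theorem minorLin_eq_zero_of_lam {B : ℕ → E} {J : Finset ℕ} {v : E} (hv : S.lam v = 0)
    (hJ : ∀ j ∈ J, S.lam (B j) = 0) : minorLin S.Ω B J v = 0 := by
  set R := Finset.Ico (m + 4) (2 * m + 4)
  have hR : R.card = m := by
    rw [Nat.card_Ico]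
    omega
  have hl : ∀ u, S.Ω (Matrix.vecCons u (Matrix.vecCons (S.φ (2 * (m + 1) + 2))
      fun i => col S.φ (R.orderEmbOfFin hR i))) = (-1) ^ m * S.lam u := by
    intro u
    have h1 := congrArg (fun f => f fun i => col S.φ (R.orderEmbOfFin hR i))
      (curryLeft_swap S.Ω u (S.φ (2 * (m + 1) + 2)))
    refine h1.trans ?_
    rw [lam, minorLin_apply, Ω₀, AlternatingMap.curryLeft_smul, LinearMap.smul_apply, minor_smul,
      minor, dif_pos hR, ← mul_assoc, ← pow_add,
      show m + (m + 1) = 2 * m + 1 by ring, pow_succ, Even.neg_one_pow (by simp)]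
    simp [R]
  rw [minorLin_apply]
  by_cases hJc : J.card = m + 1
  swap
  · exact minor_of_card_ne _ _ hJc
  rw [minor, dif_pos hJc, AlternatingMap.curryLeft_apply_apply]
  refine S.exch.eq_zero (q := S.φ 1) (R := Matrix.vecCons (S.φ (2 * (m + 1) + 2))
      fun i => col S.φ (R.orderEmbOfFin hR i)) ?_ fun i => ?_
  · rw [hl]
    exact mul_ne_zero (pow_ne_zero _ (by norm_num)) S.lam_one_pos.ne'
  · rw [hl]
    cases i using Fin.cases with
    | zero =>
      change _ * S.lam v = 0
      rw [hv, mul_zero]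
    | succ i =>
      change _ * S.lam (B _) = 0
      rw [hJ _ (Finset.orderEmbOfFin_mem _ _ _), mul_zero]

theorem minor_eq_zero_of_lam {B : ℕ → E} {J : Finset ℕ} (hJ : ∀ j ∈ J, S.lam (B j) = 0) :
    minor S.Ω B J = 0 := by
  by_cases hJc : J.card = m + 1 + 1
  swap
  · exact minor_of_card_ne _ _ hJc
  obtain ⟨x, hx⟩ : J.Nonempty := Finset.card_pos.1 (by omega)
  rw [← Finset.insert_erase hx, minor_insert _ _ (Finset.notMem_erase _ _), ← minorLin_apply,
    S.minorLin_eq_zero_of_lam (hJ x hx) fun j hj => hJ j (Finset.mem_of_mem_erase hj), mul_zero]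

section Shift

open NCInv

variable {T : Finset ℕ}

theorem mem_image_shift_ne
    (hT : T ⊆ (Finset.Icc 1 (2 * m + 1)).erase (m + 1)) {x : ℕ} (hx : x ∈ T.image (shift (m + 2))) :
    x ≠ 0 ∧ x ≠ m + 1 ∧ x ≠ m + 2 ∧ x ≠ m + 3 := by
  obtain ⟨t, ht, rfl⟩ := Finset.mem_image.1 hx
  have := hT ht
  rw [Finset.mem_erase, Finset.mem_Icc] at this
  rw [shift]
  split_ifs <;> omega

theorem col_xi_top_shift
    (hT : T ⊆ (Finset.Icc 1 (2 * m + 1)).erase (m + 1))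
    {t : ℕ} (ht : t ∈ T) : col (S.xi (m + 1)) (shift (m + 2) t) =
    (if t < m + 1 then (1 : ℝ) else -1) • col S.φ' t := by
  have := hT ht
  rw [Finset.mem_erase, Finset.mem_Icc] at this
  rw [shift]
  rcases Nat.lt_or_ge t (m + 1) with h | h
  · rw [if_pos (by omega), if_pos h, one_smul, S.col_xi_top_low (by omega)]
  · rw [if_neg (by omega), if_neg (by omega), neg_smul, one_smul, S.col_xi_top_high (by omega)]

theorem lam_col_xi_top
    (hT : T ⊆ (Finset.Icc 1 (2 * m + 1)).erase (m + 1)) {x : ℕ} (hx : x ∈ T.image (shift (m + 2))) :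
    S.lam (col (S.xi (m + 1)) x) = 0 := by
  obtain ⟨t, ht, rfl⟩ := Finset.mem_image.1 hx
  have := hT ht
  rw [Finset.mem_erase, Finset.mem_Icc] at this
  rw [S.col_xi_top_shift hT ht, map_smul, S.lam_col_φ' (by omega), smul_zero]

theorem minor_col_xi_top
    (hT : T ⊆ (Finset.Icc 1 (2 * m + 1)).erase (m + 1)) {d : ℕ} (Ω' : E [⋀^Fin d]→ₗ[ℝ] ℝ) :
    minor Ω' (col (S.xi (m + 1))) (T.image (shift (m + 2))) =
      (-1) ^ T.card * (-1) ^ (T.filter (· < m + 1)).card * minor Ω' (col S.φ') T := by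
  rw [minor_image _ _ (fun a b h => shift_lt.2 h),
    minor_congr _ (fun t ht => S.col_xi_top_shift hT ht), minor_smul_columns, prod_ite_lt_neg_one]

theorem card_filter_image_shift (T : Finset ℕ) : ((T.image (shift (m + 2))).filter (· < m + 1)).card =
    (T.filter (· < m + 1)).card := by
  have h : (T.image (shift (m + 2))).filter (· < m + 1) =
      (T.filter (· < m + 1)).image (shift (m + 2)) := by
    ext x
    simp only [Finset.mem_filter, Finset.mem_image]
    constructor
    · rintro ⟨⟨t, ht, rfl⟩, h⟩
      refine ⟨t, ⟨ht, ?_⟩, rfl⟩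
      rw [shift] at h
      split_ifs at h <;> omega
    · rintro ⟨t, ⟨ht, h⟩, rfl⟩
      refine ⟨⟨t, ht, rfl⟩, ?_⟩
      rw [shift, if_pos (by omega)]
      exact h
  rw [h, Finset.card_image_of_injective _ fun a b h => shift_inj.1 h]

theorem filter_image_shift
    (hT : T ⊆ (Finset.Icc 1 (2 * m + 1)).erase (m + 1)) : (T.image (shift (m + 2))).filter (· < m + 3) =
    (T.image (shift (m + 2))).filter (· < m + 1) := by
  refine Finset.filter_congr fun x hx => ?_
  have := mem_image_shift_ne hT hx
  omega

theorem ind_mul_minor_single (β : NCInv (m + 1 + 1)) (hk : 1 ≤ m + 2 ∧ m + 2 + 1 ≤ 2 * (m + 1 + 1))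
    (hb : β.toFun (m + 2) ≠ m + 2 + 1)
    (hT : T ⊆ (Finset.Icc 1 (2 * m + 1)).erase (m + 1)) (hTc : T.card = m + 1) :
    β.ind (insert 0 (insert (m + 3) (T.image (shift (m + 2))))) *
        minor S.Ω (col (S.xi (m + 1))) (insert (m + 3) (T.image (shift (m + 2)))) +
      β.ind (insert 0 (insert (m + 1) (T.image (shift (m + 2))))) *
        minor S.Ω (col (S.xi (m + 1))) (insert (m + 1) (T.image (shift (m + 2)))) =
      (β.cap (m + 2) hk).ind (insert 0 T) * minor S.next.Ω (col S.φ') T := by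
  have hn0 : 0 ∉ T.image (shift (m + 2)) := fun h => (mem_image_shift_ne hT h).1 rfl
  have hn1 : m + 1 ∉ T.image (shift (m + 2)) := fun h => (mem_image_shift_ne hT h).2.1 rfl
  have hn2 : m + 2 ∉ T.image (shift (m + 2)) := fun h => (mem_image_shift_ne hT h).2.2.1 rfl
  have hn3 : m + 3 ∉ T.image (shift (m + 2)) := fun h => (mem_image_shift_ne hT h).2.2.2 rfl
  have h0 : shift (m + 2) 0 = 0 := if_pos (by omega)
  have hc : (insert 0 (T.image (shift (m + 2)))).card = m + 2 := by
    rw [Finset.card_insert_of_notMem hn0,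
      Finset.card_image_of_injective _ fun a b h => shift_inj.1 h, hTc]
  have he := β.ind_e hk hb hc (by simp [hn2])
  have hcup := (β.cap (m + 2) hk).ind_cup hk (insert 0 T)
  rw [Finset.image_insert, h0, NCInv.cup_cap] at hcup
  rw [hcup, show m + 2 - 1 = m + 1 from rfl, show m + 2 + 1 = m + 3 from rfl,
    if_neg (by simp [hn1]), if_neg (by simp [hn3])] at he
  rw [minor_insert _ _ hn1, minor_insert _ _ hn3, filter_image_shift hT, col_xi_top_q,
    col_xi_top_succ, map_sub, minor_sub, ← minorLin_apply _ _ _ (col S.φ' (m + 1)),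
    S.minorLin_eq_zero_of_lam (S.lam_col_φ' (by omega)) fun x hx => S.lam_col_xi_top hT hx,
    sub_zero, S.minor_col_xi_top hT, card_filter_image_shift, Finset.insert_comm 0 (m + 3),
    Finset.insert_comm 0 (m + 1), ← he, next, minor_smul, hTc]
  have hs : ((-1 : ℝ) ^ (T.filter (· < m + 1)).card) * (-1) ^ (T.filter (· < m + 1)).card = 1 := by
    rw [← pow_add, Even.neg_one_pow ⟨_, rfl⟩]
  linear_combination (β.ind (insert (m + 1) (insert 0 (T.image (shift (m + 2))))) +
    β.ind (insert (m + 3) (insert 0 (T.image (shift (m + 2)))))) * (-1) ^ (m + 1) *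
    minor (S.Ω.curryLeft S.q) (col S.φ') T * hs

theorem ind_mul_minor_double (β : NCInv (m + 1 + 1)) (hk : 1 ≤ m + 2 ∧ m + 2 + 1 ≤ 2 * (m + 1 + 1))
    (hb : β.toFun (m + 2) ≠ m + 2 + 1)
    (hT : T ⊆ (Finset.Icc 1 (2 * m + 1)).erase (m + 1)) (hTc : T.card = m) :
    β.ind (insert 0 (insert (m + 1) (insert (m + 3) (T.image (shift (m + 2)))))) *
        minor S.Ω (col (S.xi (m + 1)))
          (insert (m + 1) (insert (m + 3) (T.image (shift (m + 2))))) =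
      (β.cap (m + 2) hk).ind (insert 0 (insert (m + 1) T)) *
        minor S.next.Ω (col S.φ') (insert (m + 1) T) := by
  have hn1 : m + 1 ∉ T.image (shift (m + 2)) := fun h => (mem_image_shift_ne hT h).2.1 rfl
  have hn2 : m + 2 ∉ T.image (shift (m + 2)) := fun h => (mem_image_shift_ne hT h).2.2.1 rfl
  have hn3 : m + 3 ∉ T.image (shift (m + 2)) := fun h => (mem_image_shift_ne hT h).2.2.2 rfl
  have hnT : m + 1 ∉ T := fun h => Finset.notMem_erase _ _ (hT h)
  have h0 : shift (m + 2) 0 = 0 := if_pos (by omega)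
  have h1 : shift (m + 2) (m + 1) = m + 1 := if_pos (by omega)
  have he := β.ind_e_both hk hb (T := insert 0 (T.image (shift (m + 2)))) (by simp [hn2])
    (by simp [hn1]) (by simp [hn3])
  have hcup := (β.cap (m + 2) hk).ind_cup hk (insert 0 (insert (m + 1) T))
  rw [Finset.image_insert, Finset.image_insert, h0, h1, NCInv.cup_cap,
    Finset.insert_comm 0 (m + 1)] at hcup
  rw [show m + 2 - 1 = m + 1 from rfl, show m + 2 + 1 = m + 3 from rfl, hcup] at he
  rw [Finset.insert_comm 0 (m + 1), Finset.insert_comm 0 (m + 3), he,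
    minor_insert _ _ (by simp [hn1] : m + 1 ∉ insert (m + 3) (T.image (shift (m + 2)))),
    Finset.filter_insert, if_neg (by omega), minor_insert _ _ hn3, filter_image_shift hT,
    col_xi_top_q, col_xi_top_succ, map_sub, AlternatingMap.curryLeft_same, zero_sub, minor_neg,
    S.minor_col_xi_top hT, card_filter_image_shift, minor_insert _ _ hnT, next,
    AlternatingMap.curryLeft_smul, LinearMap.smul_apply, minor_smul, hTc]
  have hs : ((-1 : ℝ) ^ (T.filter (· < m + 1)).card) * (-1) ^ (T.filter (· < m + 1)).card = 1 := by
    rw [← pow_add, Even.neg_one_pow ⟨_, rfl⟩]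
  linear_combination -(β.cap (m + 2) hk).ind (insert 0 (insert (m + 1) T)) * (-1) ^ m *
    (-1) ^ (T.filter (· < m + 1)).card *
    minor ((S.Ω.curryLeft S.q).curryLeft (col S.φ' (m + 1))) (col S.φ') T * hs

end Shift

theorem minor_eq_zero_of_mem {K : Finset ℕ} (hK : m + 2 ∈ K) :
    minor S.Ω (col (S.xi (m + 1))) K = 0 := by
  rw [← Finset.insert_erase hK, minor_insert _ _ (Finset.notMem_erase _ _), col_xi_top_zero,
    map_zero, minor_zero, mul_zero]

theorem screened_xi_top (β : NCInv (m + 1 + 1)) (hk : 1 ≤ m + 2 ∧ m + 2 + 1 ≤ 2 * (m + 1 + 1)) :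
    screened β S.Ω (col (S.xi (m + 1))) = if β.toFun (m + 2) = m + 2 + 1 then 0 else
      screened (β.cap (m + 2) hk) S.next.Ω (col S.next.φ) := by
  split_ifs with hb
  · refine Finset.sum_eq_zero fun K hK => ?_
    rw [Finset.mem_powersetCard] at hK
    by_cases h : m + 2 ∈ K
    · rw [S.minor_eq_zero_of_mem h, mul_zero]
    · have h0 : 0 ∉ K := fun h => by simpa using hK.1 h
      rw [β.ind_of_link hb, zero_mul]
      · rw [Finset.card_insert_of_notMem h0, hK.2]
      · simp [h]
  · have hz : ∀ K, m + 2 ∈ K → β.ind (insert 0 K) * minor S.Ω (col (S.xi (m + 1))) K = 0 :=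
      fun K hK => by rw [S.minor_eq_zero_of_mem hK, mul_zero]
    set W := (Finset.Icc 1 (2 * m + 1)).erase (m + 1) with hW
    have hWm : ∀ x, x ∈ W ↔ x ≠ m + 1 ∧ 1 ≤ x ∧ x ≤ 2 * m + 1 := fun x => by
      rw [hW, Finset.mem_erase, Finset.mem_Icc]
    have hV' : Finset.Icc 1 (2 * m + 1) = insert (m + 1) W :=
      (Finset.insert_erase (Finset.mem_Icc.2 (by omega))).symm
    have hV : Finset.Icc 1 (2 * (m + 1) + 1) =
        insert (m + 1) (insert (m + 3) (insert (m + 2) (W.image (NCInv.shift (m + 2))))) := by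
      ext x
      simp only [Finset.mem_insert, Finset.mem_image, Finset.mem_Icc, hWm]
      constructor
      · intro hx
        rcases Nat.lt_or_ge x (m + 1) with h | h
        · exact Or.inr (Or.inr (Or.inr ⟨x, by omega, if_pos (by omega)⟩))
        · by_cases h4 : m + 4 ≤ x
          · refine Or.inr (Or.inr (Or.inr ⟨x - 2, by omega, ?_⟩))
            rw [NCInv.shift, if_neg (by omega)]
            omega
          · omega
      · rintro (h | h | h | ⟨t, ht, rfl⟩)
        · omega
        · omega
        · omega
        · rw [NCInv.shift]
          split_ifs <;> omega
    have hn : ∀ x, x = m + 1 ∨ x = m + 2 ∨ x = m + 3 → x ∉ W.image (NCInv.shift (m + 2)) := by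
      intro x hx h
      have := mem_image_shift_ne (hW ▸ Finset.Subset.refl W) h
      omega
    have hinj : Function.Injective (NCInv.shift (m + 2)) := fun a b h => NCInv.shift_inj.1 h
    have e0 : ∑ T ∈ W.powersetCard (m + 1 + 1), β.ind (insert 0 (T.image (NCInv.shift (m + 2)))) *
        minor S.Ω (col (S.xi (m + 1))) (T.image (NCInv.shift (m + 2))) = 0 := by
      refine Finset.sum_eq_zero fun T hT => ?_
      have hTW := (Finset.mem_powersetCard.1 hT).1
      rw [S.minor_eq_zero_of_lam fun x hx => S.lam_col_xi_top hTW hx, mul_zero]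
    rw [screened, screened, hV, hV', sum_powersetCard_image_insert hinj (by simp [hn])
      (by simp [hn]) _ hz, e0, zero_add, ← add_assoc, ← Finset.sum_add_distrib,
      sum_powersetCard_insert (Finset.notMem_erase _ _)]
    refine congrArg₂ _ (Finset.sum_congr rfl fun T hT => ?_) (Finset.sum_congr rfl fun T hT => ?_)
    · rw [Finset.mem_powersetCard] at hT
      exact S.ind_mul_minor_single β hk hb hT.1 hT.2
    · rw [Finset.mem_powersetCard] at hT
      exact S.ind_mul_minor_double β hk hb hT.1 hT.2

end MinorSystem

theorem sum_pushforward {ι κ : Type*} [Fintype ι] [Fintype κ] (P : κ → Prop) (Q : ι → Prop)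
    (f : ι → κ) (Z : ι → ℝ) [DecidablePred P] [∀ γ α, Decidable (Q γ ∧ f γ = α)]
    [∀ γ, Decidable (Q γ ∧ P (f γ))] :
    ∑ α, (if P α then ∑ γ, (if Q γ ∧ f γ = α then Z γ else 0) else 0) =
      ∑ γ, if Q γ ∧ P (f γ) then Z γ else 0 := by
  classical
  have h : ∀ α, (if P α then ∑ γ, (if Q γ ∧ f γ = α then Z γ else 0) else 0) =
      ∑ γ, if f γ = α then (if Q γ ∧ P (f γ) then Z γ else 0) else 0 := by
    intro α
    split_ifs with hP
    · refine Finset.sum_congr rfl fun γ _ => ?_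
      by_cases h1 : f γ = α <;> by_cases h2 : Q γ <;> simp [h1, h2, hP]
    · refine (Finset.sum_eq_zero fun γ _ => ?_).symm
      by_cases h1 : f γ = α <;> simp [h1, hP]
  simp_rw [h]
  rw [Finset.sum_comm]
  simp

namespace NCInv

theorem conn_e_iff {N : ℕ} (γ β : NCInv (N + 1)) (hN : 1 ≤ N) {k : ℕ} (hk) :
    (γ k ≠ k + 1 ∧ (γ.e k hk).Conn β) ↔ (β k ≠ k + 1 ∧ γ.Conn (β.e k hk)) := by
  rw [conn_comm γ, ← cup_cap, ← cup_cap]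
  by_cases h1 : γ k = k + 1 <;> by_cases h2 : β k = k + 1
  · simp [h1, h2]
  · simp [h1, not_conn_cup _ γ hN hk h1]
  · simp [h2, not_conn_cup _ β hN hk h2]
  · rw [conn_cup _ _ hk h1, conn_cup _ _ hk h2, conn_comm]
    simp [h1, h2]

end NCInv

namespace MinorSystem

variable {E : Type*} [AddCommGroup E] [Module ℝ E] {m n : ℕ}

theorem screened_xi_step (S : MinorSystem E (m + 1)) (β : NCInv (m + 1 + 1)) {k : ℕ} (h1 : 1 ≤ k)
    (h2 : k ≤ m + 1) (hk : 1 ≤ k ∧ k + 1 ≤ 2 * (m + 1 + 1)) :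
    screened β S.Ω (col (S.xi (k - 1))) = screened β S.Ω (col (S.xi k)) +
      S.ratio k * (if β.toFun k = k + 1 then 0 else
        screened (β.e k hk) S.Ω (col (S.xi k))) := by
  have hx : S.φ k = S.chi k + S.ratio k • col (S.xi k) k := by
    rw [col, S.xi_of_lt (by omega), S.xi_of_le (by omega), S.chi_eq h1, sub_add_cancel]
  refine screened_columns_add_smul β S.Ω hk (by omega) ?_ ?_ ?_
  · rw [col, Nat.sub_add_cancel h1, S.xi_of_lt (by omega), hx, S.xi_of_le (by omega)]
    conv_rhs => rw [col, Nat.sub_add_cancel h1, S.xi_of_le le_rfl, S.xi_of_le (by omega)]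
    abel
  · rw [col, Nat.add_sub_cancel, S.xi_of_lt (by omega), S.xi_of_lt (by omega), hx]
    conv_rhs => rw [col, Nat.add_sub_cancel, S.xi_of_le le_rfl, S.xi_of_lt (by omega)]
    abel
  · intro x hx1 hx2
    have h : ∀ y, y ≠ k → S.xi (k - 1) y = S.xi k y := by
      intro y hy
      rcases Nat.lt_or_gt_of_ne hy with h | h
      · rw [S.xi_of_le (by omega), S.xi_of_le (by omega)]
      · rw [S.xi_of_lt (by omega), S.xi_of_lt (by omega)]
    rw [col, col, h _ (by omega), h _ (by omega)]

open Classical in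
theorem exists_xi_solution (S : MinorSystem E (m + 1))
    (h : ∃ Z : NCInv (m + 1) → ℝ, (∀ α, 0 < Z α) ∧
      ∀ β, screened β S.next.Ω (col S.next.φ) = ∑ α, if α.Conn β then Z α else 0)
    (t : ℕ) (ht : t ≤ m + 1) :
    ∃ Z : NCInv (m + 1 + 1) → ℝ, (∀ α, 0 ≤ Z α) ∧
      (∀ α j, m + 2 - t ≤ j → j ≤ m + 2 → α j = j + 1 → 0 < Z α) ∧
      ∀ β, screened β S.Ω (col (S.xi (m + 1 - t))) = ∑ α, if α.Conn β then Z α else 0 := by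
  induction t with
  | zero =>
    obtain ⟨Z, hZ, hs⟩ := h
    have hk : 1 ≤ m + 2 ∧ m + 2 + 1 ≤ 2 * (m + 1 + 1) := by omega
    have hnn : ∀ α : NCInv (m + 1 + 1), ∀ γ : NCInv (m + 1),
        0 ≤ if True ∧ γ.cup (m + 2) hk = α then Z γ else 0 := by
      intro α γ
      split_ifs
      exacts [(hZ γ).le, le_rfl]
    refine ⟨fun α => ∑ γ, if True ∧ γ.cup (m + 2) hk = α then Z γ else 0,
      fun α => Finset.sum_nonneg fun γ _ => hnn α γ, fun α j h1 h2 h3 => ?_, fun β => ?_⟩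
    · obtain rfl : j = m + 2 := by omega
      refine Finset.sum_pos' (fun γ _ => hnn α γ) ⟨α.cap (m + 2) hk, Finset.mem_univ _, ?_⟩
      rw [if_pos ⟨trivial, α.exists_cup_eq hk h3⟩]
      exact hZ _
    · have hpush := sum_pushforward (fun α => NCInv.Conn α β) (fun _ => True)
        (fun γ => γ.cup (m + 2) hk) Z
      beta_reduce at hpush ⊢
      rw [hpush, Nat.sub_zero, S.screened_xi_top β hk]
      split_ifs with hb
      · refine (Finset.sum_eq_zero fun γ _ => if_neg fun h => ?_).symm
        exact NCInv.not_conn_cup _ _ (by omega) hk hb h.2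
      · rw [hs]
        refine Finset.sum_congr rfl fun γ _ => ?_
        simp only [NCInv.conn_cup γ β hk hb, true_and]
  | succ t ih =>
    obtain ⟨Z, hZ, hp, hs⟩ := ih (by omega)
    obtain ⟨k, hkt⟩ : ∃ k, m + 1 - t = k := ⟨_, rfl⟩
    have hk : 1 ≤ k ∧ k + 1 ≤ 2 * (m + 1 + 1) := by omega
    have hr := S.ratio_pos hk.1 (by omega)
    rw [hkt] at hs
    have hnn : ∀ α γ : NCInv (m + 1 + 1),
        0 ≤ if γ k ≠ k + 1 ∧ γ.e k hk = α then Z γ else 0 := by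
      intro α γ
      split_ifs
      exacts [hZ γ, le_rfl]
    refine ⟨fun α => Z α + S.ratio k * ∑ γ, if γ k ≠ k + 1 ∧ γ.e k hk = α then Z γ else 0,
      fun α => add_nonneg (hZ α) (mul_nonneg hr.le (Finset.sum_nonneg fun γ _ => hnn α γ)),
      fun α j h1 h2 h3 => ?_, fun β => ?_⟩
    · rcases Nat.lt_or_ge j (m + 2 - t) with h | h
      · obtain rfl : j = k := by omega
        refine add_pos_of_nonneg_of_pos (hZ α) (mul_pos hr ?_)
        have hk' : 1 ≤ j + 1 ∧ j + 1 + 1 ≤ 2 * (m + 1 + 1) := by omega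
        set γ := (α.cap j hk).cup (j + 1) hk'
        have hγ : γ (j + 1) = j + 1 + 1 := NCInv.cup_self _ _ _
        have hne : γ j ≠ j + 1 := fun h => by
          have := γ.invol j
          rw [h, hγ] at this
          omega
        refine Finset.sum_pos' (fun γ _ => hnn α γ) ⟨γ, Finset.mem_univ _, ?_⟩
        rw [if_pos ⟨hne, by rw [NCInv.e_cup_succ, α.exists_cup_eq hk h3]⟩]
        exact hp γ (j + 1) (by omega) (by omega) hγ
      · exact add_pos_of_pos_of_nonneg (hp α j h h2 h3)
          (mul_nonneg hr.le (Finset.sum_nonneg fun γ _ => hnn α γ))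
    · rw [show m + 1 - (t + 1) = k - 1 by omega, S.screened_xi_step β hk.1 (by omega) hk, hs]
      have hsum : ∀ α, (if α.Conn β then Z α +
          S.ratio k * ∑ γ, (if γ k ≠ k + 1 ∧ γ.e k hk = α then Z γ else 0) else 0) =
          (if α.Conn β then Z α else 0) + S.ratio k *
          (if α.Conn β then ∑ γ, (if γ k ≠ k + 1 ∧ γ.e k hk = α then Z γ else 0) else 0) := by
        intro α
        split_ifs <;> simp
      simp_rw [hsum]
      rw [Finset.sum_add_distrib, ← Finset.mul_sum]
      have hpush := sum_pushforward (fun α => NCInv.Conn α β) (fun γ => γ k ≠ k + 1)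
        (fun γ => γ.e k hk) Z
      beta_reduce at hpush
      rw [hpush]
      congr 2
      split_ifs with hb
      · refine (Finset.sum_eq_zero fun γ _ => if_neg fun h => ?_).symm
        exact ((γ.conn_e_iff β (by omega) hk).1 h).1 hb
      · rw [hs]
        refine Finset.sum_congr rfl fun γ _ => ?_
        have := γ.conn_e_iff β (by omega) hk
        simp only [this, ne_eq, hb, not_false_eq_true, true_and]

open Classical in
theorem exists_solution (S : MinorSystem E n) :
    ∃ Z : NCInv (n + 1) → ℝ, (∀ α, 0 < Z α) ∧
      ∀ β, screened β S.Ω (col S.φ) = ∑ α, if α.Conn β then Z α else 0 := by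
  induction n with
  | zero =>
    have hp := S.tp ∅ (by simp) rfl
    have hw : col S.φ 1 = S.φ 2 := by
      rw [col, S.φ_zero, add_zero]
    have key : ∀ β : NCInv 1, screened β S.Ω (col S.φ) = minor S.Ω (col S.φ) {1} := by
      intro β
      have ho : β.openers = {1} := by
        have h1 := β.card_openers
        have h2 : β.openers ⊆ {1} := by
          intro x hx
          rw [NCInv.openers, Finset.mem_filter, Finset.mem_Icc] at hx
          have := β.mem_range hx.1
          rw [Finset.mem_singleton]
          omega
        exact Finset.eq_of_subset_of_card_le h2 (by simp [h1])
      have h3 := β.ind_openers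
      rw [ho] at h3
      have h4 : (Finset.Icc 1 (2 * 0 + 1)).powersetCard (0 + 1) = {{1}} := by decide
      rw [screened, h4, Finset.sum_singleton, h3, one_mul]
    have hpos : 0 < minor S.Ω (col S.φ) {1} := by
      rw [← insert_empty_eq, minor_insert _ _ (Finset.notMem_empty _), hw]
      simpa using hp
    refine ⟨fun _ => minor S.Ω (col S.φ) {1}, fun _ => hpos, fun β => ?_⟩
    rw [key, Finset.sum_eq_single β (fun b _ hb => absurd (NCInv.eq_of_size_one b β) hb) (by simp),
      if_pos (NCInv.conn_size_one _ _)]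
  | succ m ih =>
    obtain ⟨Z, -, hp, hs⟩ := S.exists_xi_solution (ih S.next) (m + 1) le_rfl
    refine ⟨Z, fun α => ?_, fun β => ?_⟩
    · obtain ⟨k, h1, h2, h3⟩ := α.exists_innermost
      exact hp α k (by omega) (by omega) h3
    · rw [← hs, Nat.sub_self, S.xi_zero]

end MinorSystem

section Integrability

variable {ι : Type*} [Fintype ι]

/-- The inverse square root of the distance, localized near the origin. -/
noncomputable def localSing (δ u : ℝ) : ℝ :=
  (Set.Ioc (-δ) δ).indicator (fun v => |v| ^ (-(2 : ℝ)⁻¹)) u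

theorem localSing_nonneg (δ u : ℝ) : 0 ≤ localSing δ u :=
  Set.indicator_nonneg (fun v _ => Real.rpow_nonneg (abs_nonneg v) _) u

theorem integrable_localSing {δ : ℝ} (hδ : 0 < δ) : Integrable (localSing δ) := by
  have h : IntervalIntegrable (fun v : ℝ => (v : ℂ) ^ ((-(2 : ℝ)⁻¹ : ℝ) : ℂ)) volume (-δ) δ :=
    intervalIntegral.intervalIntegrable_cpow' (by norm_num)
  have h2 := (intervalIntegrable_iff_integrableOn_Ioc_of_le (by linarith)).1 h.norm
  simp only [Complex.norm_cpow_real, Complex.norm_real, Real.norm_eq_abs] at h2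
  exact (integrable_indicator_iff measurableSet_Ioc).2 h2

/-- The weight `∏ |u - y i| ^ (-1/2)`. -/
noncomputable def weight (y : ι → ℝ) (u : ℝ) : ℝ := ∏ i, |u - y i| ^ (-(2 : ℝ)⁻¹)

theorem weight_nonneg (y : ι → ℝ) (u : ℝ) : 0 ≤ weight y u :=
  Finset.prod_nonneg fun _ _ => Real.rpow_nonneg (abs_nonneg _) _

theorem weight_pos {y : ι → ℝ} {u : ℝ} (h : ∀ i, u ≠ y i) : 0 < weight y u :=
  Finset.prod_pos fun i _ => Real.rpow_pos_of_pos (abs_pos.2 (sub_ne_zero.2 (h i))) _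

theorem measurable_weight (y : ι → ℝ) : Measurable (weight y) := by
  unfold weight
  fun_prop

theorem prod_one_add_of_mul_eq_zero {κ : Type*} {s : Finset κ} {f : κ → ℝ}
    (h : ∀ i j, i ≠ j → f i * f j = 0) : ∏ i ∈ s, (1 + f i) = 1 + ∑ i ∈ s, f i := by
  classical
  induction s using Finset.induction_on with
  | empty => simp
  | insert a s ha ih =>
    have : f a * ∑ i ∈ s, f i = 0 := by
      rw [Finset.mul_sum]
      exact Finset.sum_eq_zero fun i hi => h a i fun e => ha (e ▸ hi)
    rw [Finset.prod_insert ha, Finset.sum_insert ha, ih]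
    linear_combination this

theorem exists_separation {y : ι → ℝ} (hy : Function.Injective y) :
    ∃ δ : ℝ, 0 < δ ∧ ∀ i j, i ≠ j → 2 * δ < |y i - y j| := by
  have h : ∀ᶠ δ : ℝ in nhdsWithin 0 (Set.Ioi 0), ∀ i j, i ≠ j → 2 * δ < |y i - y j| := by
    rw [Filter.eventually_all]
    intro i
    rw [Filter.eventually_all]
    intro j
    rcases eq_or_ne i j with rfl | hij
    · exact Filter.Eventually.of_forall fun _ h => absurd rfl h
    have hp : 0 < |y i - y j| := abs_pos.2 (sub_ne_zero.2 (hy.ne hij))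
    filter_upwards [nhdsWithin_le_nhds (Iio_mem_nhds (half_pos hp))] with δ hδ _
    rw [Set.mem_Iio] at hδ
    linarith
  obtain ⟨δ, h1, h2⟩ := (h.and self_mem_nhdsWithin).exists
  exact ⟨δ, h2, h1⟩

theorem exists_weight_le {y : ι → ℝ} (hy : Function.Injective y) :
    ∃ δ : ℝ, 0 < δ ∧ ∃ C : ℝ, 0 < C ∧ ∀ u, weight y u ≤
      C * (1 + |u|) ^ (-(Fintype.card ι : ℝ) / 2) * (1 + ∑ i, localSing δ (u - y i)) := by
  obtain ⟨δ, hδ, hsep⟩ := exists_separation hy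
  set K : ℝ := ∑ i, ((1 + |y i|) / δ + 1) + 1 + δ with hK
  have hKi : ∀ i, (1 + |y i|) / δ + 1 ≤ K := by
    intro i
    have := Finset.single_le_sum (f := fun i => (1 + |y i|) / δ + 1)
      (fun i _ => by positivity) (Finset.mem_univ i)
    linarith
  have hK0 : 0 < K := by
    have : 0 ≤ ∑ i, ((1 + |y i|) / δ + 1) := Finset.sum_nonneg fun i _ => by positivity
    linarith
  set L : ℝ := K + (1 + ∑ i, |y i| + δ) with hL
  have hyL : ∀ i, 1 + |y i| + δ ≤ L := by
    intro i
    have := Finset.single_le_sum (f := fun i => |y i|)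
      (fun i _ => abs_nonneg _) (Finset.mem_univ i)
    linarith
  have hL0 : 0 < L := by
    have : 0 ≤ ∑ i, |y i| := Finset.sum_nonneg fun i _ => abs_nonneg _
    linarith
  have hbase : ∀ u i, |u - y i| ^ (-(2 : ℝ)⁻¹) ≤
      L ^ (2 : ℝ)⁻¹ * (1 + |u|) ^ (-(2 : ℝ)⁻¹) * (1 + localSing δ (u - y i)) := by
    intro u i
    have hu : 0 < 1 + |u| := by positivity
    have htri : |u| ≤ |u - y i| + |y i| := by
      have := abs_add_le (u - y i) (y i)
      rwa [sub_add_cancel] at this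
    by_cases hin : u - y i ∈ Set.Ioc (-δ) δ
    · rw [localSing, Set.indicator_of_mem hin]
      have h1 : 1 + |u| ≤ L := by
        have := abs_le.2 ⟨hin.1.le, hin.2⟩
        linarith [hyL i]
      have h2 : 1 ≤ L ^ (2 : ℝ)⁻¹ * (1 + |u|) ^ (-(2 : ℝ)⁻¹) := by
        rw [Real.rpow_neg hu.le, ← div_eq_mul_inv, le_div_iff₀ (by positivity), one_mul]
        exact Real.rpow_le_rpow hu.le h1 (by norm_num)
      have h3 : 0 ≤ |u - y i| ^ (-(2 : ℝ)⁻¹) := Real.rpow_nonneg (abs_nonneg _) _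
      nlinarith
    · rw [localSing, Set.indicator_of_notMem hin, add_zero, mul_one]
      have hge : δ ≤ |u - y i| := by
        by_contra! hlt
        exact hin ⟨(abs_lt.1 hlt).1, (abs_lt.1 hlt).2.le⟩
      have h0 : 0 < |u - y i| := hδ.trans_le hge
      have h1 : 1 + |u| ≤ L * |u - y i| := by
        have h2 : (1 + |y i|) ≤ (1 + |y i|) / δ * |u - y i| := by
          rw [div_mul_eq_mul_div, le_div_iff₀ hδ]
          exact mul_le_mul_of_nonneg_left hge (by positivity)
        have h3 : ((1 + |y i|) / δ + 1) * |u - y i| ≤ L * |u - y i| := by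
          refine mul_le_mul_of_nonneg_right ((hKi i).trans ?_) h0.le
          have : 0 ≤ ∑ i, |y i| := Finset.sum_nonneg fun i _ => abs_nonneg _
          linarith
        linarith
      rw [Real.rpow_neg h0.le, Real.rpow_neg hu.le, ← div_eq_mul_inv, inv_eq_one_div,
        div_le_div_iff₀ (by positivity) (by positivity), one_mul, ← Real.mul_rpow hL0.le h0.le]
      exact Real.rpow_le_rpow hu.le h1 (by norm_num)
  have hmul : ∀ u i j, i ≠ j → localSing δ (u - y i) * localSing δ (u - y j) = 0 := by
    intro u i j hij
    by_contra hne
    rw [← ne_eq, mul_ne_zero_iff] at hne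
    have h1 := Set.mem_of_indicator_ne_zero hne.1
    have h2 := Set.mem_of_indicator_ne_zero hne.2
    refine absurd (hsep i j hij) (not_lt.2 ?_)
    rw [abs_le]
    constructor <;> linarith [h1.1, h1.2, h2.1, h2.2]
  refine ⟨δ, hδ, (L ^ (2 : ℝ)⁻¹) ^ Fintype.card ι, by positivity, fun u => ?_⟩
  have hu : 0 < 1 + |u| := by positivity
  calc weight y u ≤ ∏ i, (L ^ (2 : ℝ)⁻¹ * (1 + |u|) ^ (-(2 : ℝ)⁻¹) *
        (1 + localSing δ (u - y i))) :=
        Finset.prod_le_prod (fun i _ => Real.rpow_nonneg (abs_nonneg _) _) fun i _ => hbase u i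
    _ = _ := by
      rw [Finset.prod_mul_distrib, prod_one_add_of_mul_eq_zero (hmul u), Finset.prod_const,
        Finset.card_univ, mul_pow, ← Real.rpow_natCast ((1 + |u|) ^ (-(2 : ℝ)⁻¹)),
        ← Real.rpow_mul hu.le]
      congr 3
      ring

theorem integrable_pow_mul_weight {y : ι → ℝ} (hy : Function.Injective y) {d : ℕ}
    (hd : 2 * d + 4 ≤ Fintype.card ι) : Integrable fun u => (1 + |u|) ^ d * weight y u := by
  obtain ⟨δ, hδ, C, hC, hle⟩ := exists_weight_le hy
  have h1 : Integrable fun u : ℝ => (1 + ‖u‖) ^ (-(2 : ℝ)) := integrable_one_add_norm (by simp)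
  have h2 : Integrable fun u : ℝ => ∑ i, localSing δ (u - y i) :=
    integrable_finsetSum _ fun i _ => (integrable_localSing hδ).comp_sub_right (y i)
  refine ((h1.add h2).const_mul C).mono'
    ((by fun_prop : Measurable fun u : ℝ => (1 + |u|) ^ d).mul
      (measurable_weight y)).aestronglyMeasurable (Filter.Eventually.of_forall fun u => ?_)
  have hu : 1 ≤ 1 + |u| := by linarith [abs_nonneg u]
  have hs : 0 ≤ ∑ i, localSing δ (u - y i) := Finset.sum_nonneg fun i _ => localSing_nonneg _ _
  rw [Real.norm_of_nonneg (mul_nonneg (by positivity) (weight_nonneg y u)), Pi.add_apply,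
    Real.norm_eq_abs]
  have hp : (1 + |u|) ^ d * (1 + |u|) ^ (-(Fintype.card ι : ℝ) / 2) ≤ (1 + |u|) ^ (-(2 : ℝ)) := by
    rw [← Real.rpow_natCast, ← Real.rpow_add (by linarith)]
    refine Real.rpow_le_rpow_of_exponent_le hu ?_
    have : (2 * d + 4 : ℝ) ≤ Fintype.card ι := by exact_mod_cast hd
    linarith
  have hp1 : (1 + |u|) ^ (-(2 : ℝ)) ≤ 1 := Real.rpow_le_one_of_one_le_of_nonpos hu (by norm_num)
  calc (1 + |u|) ^ d * weight y u ≤ (1 + |u|) ^ d *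
        (C * (1 + |u|) ^ (-(Fintype.card ι : ℝ) / 2) * (1 + ∑ i, localSing δ (u - y i))) :=
        mul_le_mul_of_nonneg_left (hle u) (by positivity)
    _ = C * (((1 + |u|) ^ d * (1 + |u|) ^ (-(Fintype.card ι : ℝ) / 2)) *
        (1 + ∑ i, localSing δ (u - y i))) := by ring
    _ ≤ C * ((1 + |u|) ^ (-(2 : ℝ)) * (1 + ∑ i, localSing δ (u - y i))) := by gcongr
    _ ≤ _ := by
      refine mul_le_mul_of_nonneg_left ?_ hC.le
      rw [mul_add, mul_one]
      gcongr
      exact mul_le_of_le_one_left hs hp1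

theorem integrableOn_pow_mul_weight {y : ι → ℝ} (hy : Function.Injective y) (d : ℕ) (a b : ℝ) :
    IntegrableOn (fun u => u ^ d * weight y u) (Set.Ioo a b) := by
  obtain ⟨δ, hδ, C, hC, hle⟩ := exists_weight_le hy
  have h2 : Integrable fun u : ℝ => ∑ i, localSing δ (u - y i) :=
    integrable_finsetSum _ fun i _ => (integrable_localSing hδ).comp_sub_right (y i)
  have h1 : IntegrableOn (fun u : ℝ => 1 + ∑ i, localSing δ (u - y i)) (Set.Ioo a b) :=
    (integrableOn_const (by simp)).add h2.integrableOn
  set R := max |a| |b|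
  refine (h1.const_mul (R ^ d * C)).mono'
    ((by fun_prop : Measurable fun u : ℝ => u ^ d).mul
      (measurable_weight y)).aestronglyMeasurable
    ((ae_restrict_mem measurableSet_Ioo).mono fun u hu => ?_)
  have huR : |u| ≤ R := abs_le_max_abs_abs hu.1.le hu.2.le
  have hs : 0 ≤ ∑ i, localSing δ (u - y i) := Finset.sum_nonneg fun i _ => localSing_nonneg _ _
  rw [norm_mul, norm_pow, Real.norm_eq_abs, Real.norm_of_nonneg (weight_nonneg y u), mul_assoc]
  refine mul_le_mul (pow_le_pow_left₀ (abs_nonneg u) huR d) ((hle u).trans ?_) (weight_nonneg y u)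
    (by positivity)
  refine mul_le_mul_of_nonneg_right ?_ (by linarith)
  refine mul_le_of_le_one_right hC.le ?_
  refine Real.rpow_le_one_of_one_le_of_nonpos (by linarith [abs_nonneg u]) ?_
  have : (0 : ℝ) ≤ Fintype.card ι := by positivity
  linarith

end Integrability

section HalfPlane

open Complex

theorem integral_horizontal_eq_zero {f : ℂ → ℂ} {ε C : ℝ} (hε : 0 ≤ ε) (hf : ∀ z : ℂ, ε ≤ z.im →
    DifferentiableAt ℂ f z) (hb : ∀ z : ℂ, ε ≤ z.im → ‖f z‖ ≤ C * (1 + ‖z‖) ^ (-(2 : ℝ))) :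
    ∫ u : ℝ, f (u + ε * I) = 0 := by
  have hC : 0 ≤ C := by
    have := (norm_nonneg _).trans (hb (ε * I) (by simp))
    by_contra! h
    have hp : 0 < (1 + ‖(ε : ℂ) * I‖) ^ (-(2 : ℝ)) := by positivity
    nlinarith
  have hmono : ∀ (r : ℝ) (z : ℂ), 0 ≤ r → r ≤ ‖z‖ → ε ≤ z.im →
      ‖f z‖ ≤ C * (1 + r) ^ (-(2 : ℝ)) := by
    intro r z hr hz hz'
    refine (hb z hz').trans (mul_le_mul_of_nonneg_left ?_ hC)
    exact Real.rpow_le_rpow_of_nonpos (by linarith) (by linarith) (by norm_num)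
  have hcont : Continuous fun u : ℝ => f (u + ε * I) := by
    rw [continuous_iff_continuousAt]
    intro u
    have h1 : ContinuousAt f (u + ε * I) := (hf _ (by simp)).continuousAt
    exact ContinuousAt.comp (f := fun u : ℝ => (u + ε * I : ℂ)) h1 (by fun_prop)
  have hInt : Integrable fun u : ℝ => f (u + ε * I) := by
    have h1 : Integrable fun u : ℝ => (1 + ‖u‖) ^ (-(2 : ℝ)) := integrable_one_add_norm (by simp)
    refine (h1.const_mul C).mono' hcont.aestronglyMeasurable (Filter.Eventually.of_forall fun u => ?_)
    refine hmono _ _ (norm_nonneg u) ?_ (by simp)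
    have := abs_re_le_norm ((u : ℂ) + ε * I)
    simpa using this
  have hlim := intervalIntegral_tendsto_integral hInt Filter.tendsto_neg_atTop_atBot
    Filter.tendsto_id
  refine tendsto_nhds_unique hlim ?_
  rw [tendsto_zero_iff_norm_tendsto_zero]
  have hz : Filter.Tendsto (fun R : ℝ => 4 * C * R⁻¹) Filter.atTop (nhds 0) := by
    simpa using tendsto_inv_atTop_zero.const_mul (4 * C)
  refine tendsto_of_tendsto_of_tendsto_of_le_of_le' tendsto_const_nhds hz
    (Filter.Eventually.of_forall fun _ => norm_nonneg _) ?_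
  filter_upwards [Filter.eventually_gt_atTop 0] with R hR
  have hrect := integral_boundary_rect_eq_zero_of_differentiableOn f (-R + ε * I)
    (R + (ε + R : ℝ) * I) (by
      intro z hz
      refine (hf z ?_).differentiableWithinAt
      have := hz.2
      simp only [add_im, neg_im, ofReal_im, mul_im, ofReal_re, I_im, I_re, Set.mem_preimage] at this
      rw [Set.uIcc_of_le (by linarith)] at this
      linarith [this.1])
  simp only [add_im, neg_im, ofReal_im, mul_im, ofReal_re, I_im, I_re, add_re, neg_re, mul_re,
    mul_zero, mul_one, sub_zero, add_zero, neg_zero, zero_add, smul_eq_mul] at hrect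
  have hB : ∀ z : ℂ, ε ≤ z.im → R ≤ ‖z‖ → ‖f z‖ ≤ C * (R⁻¹ * R⁻¹) := by
    intro z h1 h2
    refine (hmono R z hR.le h2 h1).trans (mul_le_mul_of_nonneg_left ?_ hC)
    rw [Real.rpow_neg (by linarith), ← mul_inv, Real.rpow_two]
    gcongr
    nlinarith
  have hR2 : C * (R⁻¹ * R⁻¹) * |R - -R| = 2 * (C * R⁻¹) := by
    rw [abs_of_pos (by linarith)]
    field_simp
    ring
  have hR1 : C * (R⁻¹ * R⁻¹) * |ε + R - ε| = C * R⁻¹ := by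
    rw [abs_of_pos (by linarith)]
    field_simp
    ring
  have htop : ‖∫ x in (-R)..R, f (x + (ε + R : ℝ) * I)‖ ≤ 2 * (C * R⁻¹) := by
    rw [← hR2]
    refine intervalIntegral.norm_integral_le_of_norm_le_const fun x _ => hB _ (by simp; linarith) ?_
    have := (le_abs_self _).trans (abs_im_le_norm ((x : ℂ) + (ε + R : ℝ) * I))
    simp only [add_im, ofReal_im, mul_im, ofReal_re, I_im, I_re, mul_zero, mul_one, add_zero,
      zero_add] at this
    linarith
  have hside : ∀ s : ℝ, |s| = R → ‖∫ y in ε..(ε + R), f (s + y * I)‖ ≤ C * R⁻¹ := by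
    intro s hs
    rw [← hR1]
    refine intervalIntegral.norm_integral_le_of_norm_le_const fun y hy => hB _ ?_ ?_
    · rw [Set.uIoc_of_le (by linarith)] at hy
      simpa using hy.1.le
    · have := abs_re_le_norm ((s : ℂ) + y * I)
      simpa [hs] using this
  have h1 := hside R (abs_of_pos hR)
  have h2 := hside (-R) (by rw [abs_neg, abs_of_pos hR])
  push_cast at h2 htop hrect
  simp only [id]
  rw [show (∫ x in (-R)..R, f (x + ε * I)) = (∫ x in (-R)..R, f (x + (ε + R) * I)) -
    I * (∫ y in ε..(ε + R), f (R + y * I)) + I * (∫ y in ε..(ε + R), f (-R + y * I)) by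
      linear_combination hrect]
  refine (norm_add_le _ _).trans ?_
  refine (add_le_add_left (norm_sub_le _ _) _).trans ?_
  rw [norm_mul, norm_mul, norm_I, one_mul, one_mul]
  linarith

/-- The branch of `(-i z) ^ (-1/2)` that is holomorphic in the upper half plane. -/
noncomputable def invSqrt (z : ℂ) : ℂ := (-I * z) ^ ((-(2 : ℝ)⁻¹ : ℝ) : ℂ)

theorem norm_invSqrt (z : ℂ) : ‖invSqrt z‖ = ‖z‖ ^ (-(2 : ℝ)⁻¹) := by
  rw [invSqrt, norm_cpow_real, norm_mul, norm_neg, norm_I, one_mul]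

theorem differentiableAt_invSqrt {z : ℂ} (hz : 0 < z.im ∨ z.re ≠ 0) :
    DifferentiableAt ℂ invSqrt z := by
  unfold invSqrt
  refine DifferentiableAt.cpow_const (by fun_prop) ?_
  rw [mem_slitPlane_iff]
  simpa using hz

theorem measurable_invSqrt : Measurable invSqrt := by
  unfold invSqrt
  fun_prop

theorem invSqrt_of_pos {u : ℝ} (hu : 0 < u) :
    invSqrt u = ((|u| ^ (-(2 : ℝ)⁻¹) : ℝ) : ℂ) * exp (Real.pi / 4 * I) := by
  rw [invSqrt, cpow_def_of_ne_zero (by simp [hu.ne']), mul_comm, mul_comm (-I),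
    log_ofReal_mul hu (by simp), log_neg_I, abs_of_pos hu, Real.rpow_def_of_pos hu, ofReal_exp,
    ← exp_add]
  congr 1
  push_cast
  ring

theorem invSqrt_of_neg {u : ℝ} (hu : u < 0) :
    invSqrt u = ((|u| ^ (-(2 : ℝ)⁻¹) : ℝ) : ℂ) * exp (-(Real.pi / 4 * I)) := by
  have h : -I * (u : ℂ) = ((-u : ℝ) : ℂ) * I := by
    push_cast
    ring
  have hu' : 0 < -u := neg_pos.2 hu
  rw [invSqrt, h, cpow_def_of_ne_zero (by simp [hu.ne]), mul_comm,
    log_ofReal_mul hu' (by simp), log_I, abs_of_neg hu, Real.rpow_def_of_pos hu', ofReal_exp,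
    ← exp_add]
  congr 1
  push_cast
  ring

variable {ι : Type*} [Fintype ι]

/-- The holomorphic counterpart of `weight`. -/
noncomputable def holWeight (y : ι → ℝ) (z : ℂ) : ℂ := ∏ i, invSqrt (z - y i)

theorem norm_holWeight_ofReal (y : ι → ℝ) (u : ℝ) : ‖holWeight y u‖ = weight y u := by
  simp only [holWeight, weight, norm_prod, norm_invSqrt, ← ofReal_sub, norm_real, Real.norm_eq_abs]

theorem measurable_holWeight (y : ι → ℝ) : Measurable (holWeight y) := by
  unfold holWeight
  exact Finset.measurable_prod _ fun i _ => measurable_invSqrt.comp (by fun_prop)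

theorem differentiableAt_holWeight {y : ι → ℝ} {z : ℂ} (hz : 0 < z.im ∨ ∀ i, z.re ≠ y i) :
    DifferentiableAt ℂ (holWeight y) z := by
  unfold holWeight
  refine DifferentiableAt.fun_finsetProd fun i _ => ?_
  refine (differentiableAt_invSqrt ?_).comp (𝕜 := ℂ) z
    (f := fun z : ℂ => z - y i) (by fun_prop)
  simp only [sub_im, ofReal_im, sub_zero, sub_re, ofReal_re, ne_eq, sub_eq_zero]
  exact hz.imp_right fun h => h i

theorem exists_norm_holWeight_le (y : ι → ℝ) {ε : ℝ} (hε : 0 < ε) : ∃ C : ℝ, 0 < C ∧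
    ∀ z : ℂ, ε ≤ z.im → ‖holWeight y z‖ ≤ C * (1 + ‖z‖) ^ (-(Fintype.card ι : ℝ) / 2) := by
  set L : ℝ := ∑ i, ((1 + |y i|) / ε + 1) + 1
  have hLi : ∀ i, (1 + |y i|) / ε + 1 ≤ L := by
    intro i
    have := Finset.single_le_sum (f := fun i => (1 + |y i|) / ε + 1)
      (fun i _ => by positivity) (Finset.mem_univ i)
    linarith
  have hL0 : 0 < L := by
    have : 0 ≤ ∑ i, ((1 + |y i|) / ε + 1) := Finset.sum_nonneg fun i _ => by positivity
    linarith
  refine ⟨(L ^ (2 : ℝ)⁻¹) ^ Fintype.card ι, by positivity, fun z hz => ?_⟩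
  have hu : 0 < 1 + ‖z‖ := by positivity
  have hbase : ∀ i, ‖z - y i‖ ^ (-(2 : ℝ)⁻¹) ≤ L ^ (2 : ℝ)⁻¹ * (1 + ‖z‖) ^ (-(2 : ℝ)⁻¹) := by
    intro i
    have htri : ‖z‖ ≤ ‖z - y i‖ + |y i| := by
      have := norm_add_le (z - y i) (y i)
      rwa [sub_add_cancel, norm_real, Real.norm_eq_abs] at this
    have hge : ε ≤ ‖z - y i‖ := by
      have := (le_abs_self _).trans (abs_im_le_norm (z - y i))
      simp only [sub_im, ofReal_im, sub_zero] at this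
      linarith
    have h0 : 0 < ‖z - y i‖ := hε.trans_le hge
    have h1 : 1 + ‖z‖ ≤ L * ‖z - y i‖ := by
      have h2 : (1 + |y i|) ≤ (1 + |y i|) / ε * ‖z - y i‖ := by
        rw [div_mul_eq_mul_div, le_div_iff₀ hε]
        exact mul_le_mul_of_nonneg_left hge (by positivity)
      have h3 := mul_le_mul_of_nonneg_right (hLi i) h0.le
      linarith
    rw [Real.rpow_neg h0.le, Real.rpow_neg hu.le, ← div_eq_mul_inv, inv_eq_one_div,
      div_le_div_iff₀ (by positivity) (by positivity), one_mul, ← Real.mul_rpow hL0.le h0.le]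
    exact Real.rpow_le_rpow hu.le h1 (by norm_num)
  rw [holWeight, norm_prod]
  calc ∏ i, ‖invSqrt (z - y i)‖ ≤ ∏ i : ι, (L ^ (2 : ℝ)⁻¹ * (1 + ‖z‖) ^ (-(2 : ℝ)⁻¹)) :=
        Finset.prod_le_prod (fun i _ => norm_nonneg _) fun i _ => by
          rw [norm_invSqrt]
          exact hbase i
    _ = _ := by
      rw [Finset.prod_const, Finset.card_univ, mul_pow,
        ← Real.rpow_natCast ((1 + ‖z‖) ^ (-(2 : ℝ)⁻¹)), ← Real.rpow_mul hu.le]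
      congr 2
      ring

theorem integral_mul_holWeight_eq_zero {y : ι → ℝ} (hy : Function.Injective y) {d : ℕ}
    (hd : 2 * d + 4 ≤ Fintype.card ι) {q : ℂ → ℂ} (hq : Differentiable ℂ q) {K : ℝ}
    (hK : ∀ z, ‖q z‖ ≤ K * (1 + ‖z‖) ^ d) : ∫ u : ℝ, q u * holWeight y u = 0 := by
  have hK0 : 0 ≤ K := by
    have := (norm_nonneg _).trans (hK 0)
    simpa using this
  have hε : ∀ ε : ℝ, 0 < ε → ∫ u : ℝ, q (u + ε * I) * holWeight y (u + ε * I) = 0 := by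
    intro ε hε
    obtain ⟨C, hC, hle⟩ := exists_norm_holWeight_le y hε
    refine integral_horizontal_eq_zero (f := fun z => q z * holWeight y z) (C := K * C) hε.le
      (fun z hz => ?_) fun z hz => ?_
    · exact hq.differentiableAt.mul (differentiableAt_holWeight (Or.inl (hε.trans_le hz)))
    · have hp : (1 + ‖z‖) ^ d * (1 + ‖z‖) ^ (-(Fintype.card ι : ℝ) / 2) ≤
          (1 + ‖z‖) ^ (-(2 : ℝ)) := by
        rw [← Real.rpow_natCast, ← Real.rpow_add (by positivity)]
        refine Real.rpow_le_rpow_of_exponent_le (by linarith [norm_nonneg z]) ?_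
        have : (2 * d + 4 : ℝ) ≤ Fintype.card ι := by exact_mod_cast hd
        linarith
      rw [norm_mul]
      calc ‖q z‖ * ‖holWeight y z‖ ≤ (K * (1 + ‖z‖) ^ d) *
            (C * (1 + ‖z‖) ^ (-(Fintype.card ι : ℝ) / 2)) :=
            mul_le_mul (hK z) (hle z hz) (norm_nonneg _) (by positivity)
        _ = K * C * ((1 + ‖z‖) ^ d * (1 + ‖z‖) ^ (-(Fintype.card ι : ℝ) / 2)) := by ring
        _ ≤ _ := mul_le_mul_of_nonneg_left hp (by positivity)
  have hlim : Filter.Tendsto (fun ε : ℝ => ∫ u : ℝ, q (u + ε * I) * holWeight y (u + ε * I))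
      (nhdsWithin 0 (Set.Ioi 0)) (nhds (∫ u : ℝ, q u * holWeight y u)) := by
    refine tendsto_integral_filter_of_dominated_convergence
      (fun u => K * 2 ^ d * ((1 + |u|) ^ d * weight y u)) ?_ ?_ ?_ ?_
    · refine Filter.Eventually.of_forall fun ε => Measurable.aestronglyMeasurable ?_
      exact (hq.continuous.measurable.comp (by fun_prop)).mul
        ((measurable_holWeight y).comp (by fun_prop))
    · have h1 : ∀ᶠ ε : ℝ in nhdsWithin 0 (Set.Ioi 0), ε < 1 :=
        nhdsWithin_le_nhds (Iio_mem_nhds one_pos)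
      filter_upwards [h1, self_mem_nhdsWithin] with ε h1 h0
      rw [Set.mem_Ioi] at h0
      have hne : ∀ᵐ u : ℝ, u ∉ Set.range y := 
        measure_eq_zero_iff_ae_notMem.1 ((Set.finite_range y).measure_zero _)
      filter_upwards [hne] with u hu
      have hw : ‖holWeight y (u + ε * I)‖ ≤ weight y u := by
        rw [holWeight, norm_prod, weight]
        refine Finset.prod_le_prod (fun i _ => norm_nonneg _) fun i _ => ?_
        rw [norm_invSqrt]
        refine Real.rpow_le_rpow_of_nonpos (abs_pos.2 (sub_ne_zero.2 fun h => hu ⟨i, h.symm⟩)) ?_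
          (by norm_num)
        have := abs_re_le_norm ((u : ℂ) + ε * I - y i)
        simpa using this
      have hn : ‖(u : ℂ) + ε * I‖ ≤ |u| + 1 := by
        refine (norm_add_le _ _).trans ?_
        rw [norm_mul, norm_I, mul_one, norm_real, norm_real, Real.norm_eq_abs, Real.norm_eq_abs,
          abs_of_pos h0]
        linarith
      rw [norm_mul]
      calc ‖q (u + ε * I)‖ * ‖holWeight y (u + ε * I)‖ ≤
          (K * (2 * (1 + |u|)) ^ d) * weight y u := by
            refine mul_le_mul ((hK _).trans ?_) hw (norm_nonneg _) (by positivity)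
            gcongr
            linarith [abs_nonneg u]
        _ = _ := by
          rw [mul_pow]
          ring
    · exact (integrable_pow_mul_weight hy hd).const_mul _
    · have hne : ∀ᵐ u : ℝ, u ∉ Set.range y := 
        measure_eq_zero_iff_ae_notMem.1 ((Set.finite_range y).measure_zero _)
      filter_upwards [hne] with u hu
      have hc : ContinuousAt (fun z : ℂ => q z * holWeight y z) u := by
        refine (hq.differentiableAt.mul (differentiableAt_holWeight (Or.inr fun i h => ?_))).continuousAt
        exact hu ⟨i, h.symm⟩
      have hpath : Filter.Tendsto (fun ε : ℝ => (u + ε * I : ℂ)) (nhdsWithin 0 (Set.Ioi 0))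
          (nhds u) := by
        have : Continuous fun ε : ℝ => (u + ε * I : ℂ) := by fun_prop
        have h := this.tendsto 0
        simp only [ofReal_zero, zero_mul, add_zero] at h
        exact h.mono_left nhdsWithin_le_nhds
      exact hc.tendsto.comp hpath
  refine tendsto_nhds_unique (hlim.congr' ?_) tendsto_const_nhds
  filter_upwards [self_mem_nhdsWithin] with ε h0
  exact hε ε h0

end HalfPlane

section Gaps

open Complex

/-- The `2N` marked points of a configuration, as a finite family. -/
def marked (N : ℕ) (x : ℕ → ℝ) (i : Finset.Icc 1 (2 * N)) : ℝ := x i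

/-- The `k`-th complementary interval of the marked points. -/
def gap (N : ℕ) (x : ℕ → ℝ) (k : ℕ) : Set ℝ :=
  {u | ∀ i ∈ Finset.Icc 1 (2 * N), (i ≤ k → x i < u) ∧ (k < i → u < x i)}

/-- The monomial `u ^ j` times the weight, restricted to the `k`-th gap. -/
noncomputable def gapWeight (N : ℕ) (x : ℕ → ℝ) (k j : ℕ) : ℝ → ℝ :=
  (gap N x k).indicator fun u => u ^ j * weight (marked N x) u

/-- The moments of the weight over the gaps. -/
noncomputable def gapMoment (N : ℕ) (x : ℕ → ℝ) (k j : ℕ) : ℝ := ∫ u, gapWeight N x k j u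

variable {N : ℕ} {x : ℕ → ℝ}

theorem card_marked : Fintype.card (Finset.Icc 1 (2 * N)) = 2 * N := by simp

theorem IsChamber.injective_marked (hx : IsChamber N x) : Function.Injective (marked N x) := by
  rintro ⟨i, hi⟩ ⟨j, hj⟩ h
  rw [Finset.mem_Icc] at hi hj
  rw [Subtype.mk.injEq]
  change x i = x j at h
  rcases lt_trichotomy i j with hij | hij | hij
  · exact absurd h (hx i j hi.1 hij hj.2).ne
  · exact hij
  · exact absurd h (hx j i hj.1 hij hi.2).ne'

theorem measurableSet_gap (N : ℕ) (x : ℕ → ℝ) (k : ℕ) : MeasurableSet (gap N x k) := by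
  have : gap N x k = ⋂ i ∈ Finset.Icc 1 (2 * N),
      ({u | i ≤ k → x i < u} ∩ {u | k < i → u < x i}) := by
    ext u
    simp [gap]
  rw [this]
  refine Finset.measurableSet_biInter _ fun i _ => MeasurableSet.inter ?_ ?_
  · by_cases h : i ≤ k
    · simp only [h, true_imp_iff]
      exact measurableSet_Ioi
    · simp [h]
  · by_cases h : k < i
    · simp only [h, true_imp_iff]
      exact measurableSet_Iio
    · simp [h]

theorem exists_mem_gap (hx : IsChamber N x) {u : ℝ} (hu : ∀ i, u ≠ marked N x i) :
    ∃ k ≤ 2 * N, u ∈ gap N x k := by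
  classical
  refine ⟨Nat.findGreatest (fun i => x i < u) (2 * N), Nat.findGreatest_le _, fun i hi =>
    ⟨fun h => ?_, fun h => ?_⟩⟩
  · rw [Finset.mem_Icc] at hi
    have h1 : x (Nat.findGreatest (fun i => x i < u) (2 * N)) < u :=
      Nat.findGreatest_of_ne_zero (P := fun i => x i < u) rfl (by omega)
    rcases h.lt_or_eq with h | h
    · exact (hx _ _ hi.1 h (Nat.findGreatest_le _)).trans h1
    · rw [h]
      exact h1
  · have h1 := Nat.findGreatest_is_greatest h (Finset.mem_Icc.1 hi).2
    exact lt_of_le_of_ne (not_lt.1 h1) (hu ⟨i, hi⟩)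

theorem eq_of_mem_gap {k l : ℕ} {u : ℝ} (hk : k ≤ 2 * N) (hl : l ≤ 2 * N) (hu : u ∈ gap N x k)
    (hu' : u ∈ gap N x l) : k = l := by
  by_contra hne
  rcases Nat.lt_or_gt_of_ne hne with h | h
  · have hm : l ∈ Finset.Icc 1 (2 * N) := Finset.mem_Icc.2 ⟨by omega, hl⟩
    exact lt_asymm ((hu l hm).2 h) ((hu' l hm).1 le_rfl)
  · have hm : k ∈ Finset.Icc 1 (2 * N) := Finset.mem_Icc.2 ⟨by omega, hk⟩
    exact lt_asymm ((hu' k hm).2 h) ((hu k hm).1 le_rfl)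

theorem lt_of_mem_gap {k l : ℕ} {u v : ℝ} (hkl : k < l) (hl : l ≤ 2 * N) (hu : u ∈ gap N x k)
    (hv : v ∈ gap N x l) : u < v := by
  have hm : l ∈ Finset.Icc 1 (2 * N) := Finset.mem_Icc.2 ⟨by omega, hl⟩
  exact ((hu l hm).2 hkl).trans ((hv l hm).1 le_rfl)

theorem gap_eq_Ioo (hx : IsChamber N x) {k : ℕ} (h1 : 1 ≤ k) (h2 : k + 1 ≤ 2 * N) :
    gap N x k = Set.Ioo (x k) (x (k + 1)) := by
  ext u
  constructor
  · intro h
    exact ⟨(h k (Finset.mem_Icc.2 ⟨h1, by omega⟩)).1 le_rfl,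
      (h (k + 1) (Finset.mem_Icc.2 ⟨by omega, h2⟩)).2 (by omega)⟩
  · intro h i hi
    rw [Finset.mem_Icc] at hi
    refine ⟨fun h' => ?_, fun h' => ?_⟩
    · rcases h'.lt_or_eq with h' | h'
      · exact (hx _ _ hi.1 h' (by omega)).trans h.1
      · rw [h']
        exact h.1
    · rcases (Nat.succ_le_of_lt h').lt_or_eq with h' | h'
      · exact h.2.trans (hx _ _ (by omega) h' hi.2)
      · rw [← h']
        exact h.2

/-- The global phase relating `holWeight` to `weight`. -/
noncomputable def phase (N : ℕ) : ℂ := exp (-(Real.pi / 4 * I)) ^ (2 * N)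

theorem phase_ne_zero (N : ℕ) : phase N ≠ 0 := pow_ne_zero _ (exp_ne_zero _)

theorem holWeight_of_mem_gap {k : ℕ} (hk : k ≤ 2 * N) {u : ℝ} (hu : u ∈ gap N x k) :
    holWeight (marked N x) u = phase N * (I ^ k * weight (marked N x) u) := by
  have h1 : ∀ i : Finset.Icc 1 (2 * N), invSqrt (u - marked N x i) =
      ((|u - marked N x i| ^ (-(2 : ℝ)⁻¹) : ℝ) : ℂ) *
        (exp (-(Real.pi / 4 * I)) * if (i : ℕ) ≤ k then I else 1) := by
    rintro ⟨i, hi⟩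
    rw [← ofReal_sub]
    by_cases h : i ≤ k
    · rw [invSqrt_of_pos (show 0 < u - marked N x ⟨i, hi⟩ from sub_pos.2 ((hu i hi).1 h)), if_pos h]
      congr 1
      have h2 : I = exp (Real.pi / 2 * I) := by rw [exp_pi_div_two_mul_I]
      conv_rhs => rw [h2]
      rw [← exp_add, exp_pi_div_two_mul_I]
      congr 1
      ring
    · rw [invSqrt_of_neg (show u - marked N x ⟨i, hi⟩ < 0 from
        sub_neg.2 ((hu i hi).2 (not_le.1 h))), if_neg h, mul_one]
  have h3 : ∏ i : Finset.Icc 1 (2 * N), (if (i : ℕ) ≤ k then I else 1) = I ^ k := by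
    rw [Finset.prod_coe_sort (Finset.Icc 1 (2 * N)) fun i => if i ≤ k then I else 1,
      Finset.prod_ite, Finset.prod_const, Finset.prod_const_one, mul_one]
    congr 1
    have : (Finset.Icc 1 (2 * N)).filter (fun i => i ≤ k) = Finset.Icc 1 k := by
      ext i
      simp only [Finset.mem_filter, Finset.mem_Icc]
      omega
    rw [this]
    simp
  rw [holWeight, Finset.prod_congr rfl fun i _ => h1 i, Finset.prod_mul_distrib,
    Finset.prod_mul_distrib, h3, Finset.prod_const, Finset.card_univ, card_marked, phase, weight]
  push_cast
  ring

theorem ae_ne_marked (N : ℕ) (x : ℕ → ℝ) : ∀ᵐ u : ℝ, ∀ i, u ≠ marked N x i :=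
  ae_all_iff.2 fun i => by
    have := (measure_eq_zero_iff_ae_notMem (μ := volume)).1
      (Real.volume_singleton (a := marked N x i))
    filter_upwards [this] with u hu
    simpa using hu

theorem pow_mul_holWeight_eq_sum (hx : IsChamber N x) {u : ℝ} (hu : ∀ i, u ≠ marked N x i)
    (j : ℕ) : (u : ℂ) ^ j * holWeight (marked N x) u =
      phase N * ∑ k ∈ Finset.range (2 * N + 1), I ^ k * (gapWeight N x k j u : ℂ) := by
  obtain ⟨k, hk, hm⟩ := exists_mem_gap hx hu
  rw [holWeight_of_mem_gap hk hm, Finset.sum_eq_single_of_mem k (Finset.mem_range.2 (by omega))]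
  · rw [gapWeight, Set.indicator_of_mem hm]
    push_cast
    ring
  · intro l hl hne
    rw [gapWeight, Set.indicator_of_notMem, ofReal_zero, mul_zero]
    exact fun h => hne (eq_of_mem_gap (by have := Finset.mem_range.1 hl; omega) hk h hm)

theorem integrable_pow_weight (hx : IsChamber N x) {j : ℕ} (hj : j + 2 ≤ N) :
    Integrable fun u => u ^ j * weight (marked N x) u := by
  refine (integrable_pow_mul_weight hx.injective_marked (d := j)
    (by rw [card_marked]; omega)).mono' ?_ (Filter.Eventually.of_forall fun u => ?_)
  · exact ((measurable_id.pow_const j).mul (measurable_weight _)).aestronglyMeasurable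
  · rw [norm_mul, norm_pow, Real.norm_eq_abs, Real.norm_of_nonneg (weight_nonneg _ _)]
    gcongr
    · exact weight_nonneg _ _
    · linarith

theorem integrable_gapWeight (hx : IsChamber N x) {j : ℕ} (hj : j + 2 ≤ N) (k : ℕ) :
    Integrable (gapWeight N x k j) :=
  (integrable_pow_weight hx hj).indicator (measurableSet_gap N x k)

theorem sum_I_pow_mul_gapMoment (hx : IsChamber N x) {j : ℕ} (hj : j + 2 ≤ N) :
    ∑ k ∈ Finset.range (2 * N + 1), I ^ k * (gapMoment N x k j : ℂ) = 0 := by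
  have h := integral_mul_holWeight_eq_zero hx.injective_marked (d := j)
    (by rw [card_marked]; omega) (q := fun z => z ^ j) (by fun_prop) (K := 1) (fun z => by
      rw [norm_pow, one_mul]
      gcongr
      linarith)
  rw [integral_congr_ae ((ae_ne_marked N x).mono fun u hu => pow_mul_holWeight_eq_sum hx hu j),
    integral_const_mul, integral_finsetSum _ fun k _ =>
      ((integrable_gapWeight hx hj k).ofReal).const_mul _] at h
  have h2 := (mul_eq_zero.1 h).resolve_left (phase_ne_zero N)
  rw [← h2]
  refine Finset.sum_congr rfl fun k _ => ?_
  rw [integral_const_mul, integral_complex_ofReal, gapMoment]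

theorem holWeight_sumElim_sub (x : ℕ → ℝ) (τ u : ℝ) :
    holWeight (Sum.elim (marked N x) fun i => marked N x i - τ) u =
      holWeight (marked N x) u * holWeight (marked N x) ((u + τ : ℝ) : ℂ) := by
  simp only [holWeight, Fintype.prod_sum_type, Sum.elim_inl, Sum.elim_inr]
  congr 1
  refine Finset.prod_congr rfl fun i _ => ?_
  congr 1
  push_cast
  ring

theorem ae_integral_mul_shift_eq_zero (hx : IsChamber N x) {p q : ℕ} (hp : p + 2 ≤ N)
    (hq : q + 2 ≤ N) : ∀ᵐ τ : ℝ, ∫ u : ℝ, ((u : ℂ) ^ p * holWeight (marked N x) u) *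
      (((u + τ : ℝ) : ℂ) ^ q * holWeight (marked N x) ((u + τ : ℝ) : ℂ)) = 0 := by
  have h : ∀ᵐ τ : ℝ, ∀ i j, τ ≠ marked N x j - marked N x i := by
    refine ae_all_iff.2 fun i => ae_all_iff.2 fun j => ?_
    have := (measure_eq_zero_iff_ae_notMem (μ := volume)).1
      (Real.volume_singleton (a := marked N x j - marked N x i))
    filter_upwards [this] with u hu
    simpa using hu
  filter_upwards [h] with τ hτ
  have hy : Function.Injective (Sum.elim (marked N x) fun i => marked N x i - τ) := by
    refine hx.injective_marked.sumElim ?_ ?_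
    · intro i j hij
      exact hx.injective_marked (sub_left_injective hij)
    · intro i j hij
      exact hτ i j (by linarith)
  have := integral_mul_holWeight_eq_zero hy (d := p + q)
    (by rw [Fintype.card_sum, card_marked]; omega)
    (q := fun z => z ^ p * (z + τ) ^ q) (by fun_prop) (K := (1 + |τ|) ^ q) (fun z => by
      rw [norm_mul, norm_pow, norm_pow, pow_add, mul_comm, mul_comm ((1 + ‖z‖) ^ p), ← mul_assoc,
        ← mul_pow]
      have h1 : ‖z + τ‖ ≤ (1 + |τ|) * (1 + ‖z‖) := by
        have := norm_add_le z (τ : ℂ)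
        rw [norm_real, Real.norm_eq_abs] at this
        nlinarith [norm_nonneg z, abs_nonneg τ]
      have h2 : ‖z‖ ≤ 1 + ‖z‖ := by linarith
      gcongr)
  rw [← this]
  refine integral_congr_ae (Filter.Eventually.of_forall fun u => ?_)
  dsimp only
  rw [holWeight_sumElim_sub x]
  push_cast
  ring

theorem integrable_pow_mul_holWeight (hx : IsChamber N x) {j : ℕ} (hj : j + 2 ≤ N) :
    Integrable fun u : ℝ => (u : ℂ) ^ j * holWeight (marked N x) u := by
  refine (integrable_pow_weight hx hj).mono ?_ (Filter.Eventually.of_forall fun u => ?_)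
  · exact ((measurable_ofReal.pow_const j).mul
      ((measurable_holWeight _).comp measurable_ofReal)).aestronglyMeasurable
  · rw [norm_mul, norm_mul, norm_holWeight_ofReal, Real.norm_of_nonneg (weight_nonneg _ _),
      norm_pow, norm_pow, norm_real]

theorem measurableSet_ordered : MeasurableSet {z : ℝ × ℝ | z.1 < z.2} :=
  measurableSet_lt measurable_fst measurable_snd

theorem integral_ordered_eq_zero (hx : IsChamber N x) {p q : ℕ} (hp : p + 2 ≤ N)
    (hq : q + 2 ≤ N) : ∫ z : ℝ × ℝ, {z : ℝ × ℝ | z.1 < z.2}.indicator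
      (fun z => ((z.1 : ℂ) ^ p * holWeight (marked N x) z.1) *
        ((z.2 : ℂ) ^ q * holWeight (marked N x) z.2)) z = 0 := by
  have hi : Integrable ({z : ℝ × ℝ | z.1 < z.2}.indicator
      (fun z => ((z.1 : ℂ) ^ p * holWeight (marked N x) z.1) *
        ((z.2 : ℂ) ^ q * holWeight (marked N x) z.2))) (volume.prod volume) :=
    ((integrable_pow_mul_holWeight hx hp).mul_prod
      (integrable_pow_mul_holWeight hx hq)).indicator measurableSet_ordered
  have hm := measurePreserving_prod_add (volume : Measure ℝ) (volume : Measure ℝ)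
  have he : MeasurableEmbedding fun z : ℝ × ℝ => (z.1, z.1 + z.2) :=
    (MeasurableEquiv.shearAddRight ℝ).measurableEmbedding
  have hc := hm.integrable_comp_of_integrable hi
  simp only [Function.comp_def] at hc
  rw [Measure.volume_eq_prod, ← hm.integral_comp he, integral_prod_symm _ hc]
  refine integral_eq_zero_of_ae ?_
  filter_upwards [ae_integral_mul_shift_eq_zero hx hp hq] with τ hτ
  by_cases h : 0 < τ
  · rw [Pi.zero_apply, ← hτ]
    refine integral_congr_ae (Filter.Eventually.of_forall fun u => ?_)
    dsimp only
    rw [Set.indicator_of_mem (by simpa using h)]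
  · refine integral_eq_zero_of_ae (Filter.Eventually.of_forall fun u => ?_)
    dsimp only
    rw [Set.indicator_of_notMem (by simpa using h), Pi.zero_apply]

theorem integral_ordered_gaps (x : ℕ → ℝ) (p q : ℕ) {k l : ℕ}
    (hk : k ≤ 2 * N) (hl : l ≤ 2 * N) (hkl : k ≠ l) :
    ∫ z : ℝ × ℝ, {z : ℝ × ℝ | z.1 < z.2}.indicator
      (fun z => gapWeight N x k p z.1 * gapWeight N x l q z.2) z =
      if k < l then gapMoment N x k p * gapMoment N x l q else 0 := by
  split_ifs with h
  · rw [gapMoment, gapMoment, ← integral_prod_mul, Measure.volume_eq_prod]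
    refine integral_congr_ae (Filter.Eventually.of_forall fun z => ?_)
    dsimp only
    rw [Set.indicator_apply_eq_self]
    intro hz
    by_cases h1 : z.1 ∈ gap N x k
    · by_cases h2 : z.2 ∈ gap N x l
      · exact absurd (lt_of_mem_gap h hl h1 h2) hz
      · rw [gapWeight, gapWeight, Set.indicator_of_notMem h2, mul_zero]
    · rw [gapWeight, Set.indicator_of_notMem h1, zero_mul]
  · refine integral_eq_zero_of_ae (Filter.Eventually.of_forall fun z => ?_)
    rw [Pi.zero_apply, Set.indicator_apply_eq_zero]
    intro hz
    by_cases h1 : z.1 ∈ gap N x k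
    · by_cases h2 : z.2 ∈ gap N x l
      · exact absurd (lt_of_mem_gap (by omega) hk h2 h1) (lt_asymm hz)
      · rw [gapWeight, gapWeight, Set.indicator_of_notMem h2, mul_zero]
    · rw [gapWeight, Set.indicator_of_notMem h1, zero_mul]

theorem sum_ordered_gapMoment (hx : IsChamber N x) {p q : ℕ} (hp : p + 2 ≤ N) (hq : q + 2 ≤ N) :
    ∑ k ∈ Finset.range (2 * N + 1), ∑ l ∈ Finset.range (2 * N + 1),
      (if k < l then (I ^ (k + l)).im * (gapMoment N x k p * gapMoment N x l q) else 0) = 0 := by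
  set D : ℕ → ℕ → ℝ := fun k l => ∫ z : ℝ × ℝ, {z : ℝ × ℝ | z.1 < z.2}.indicator
      (fun z => gapWeight N x k p z.1 * gapWeight N x l q z.2) z with hD
  have hInt : ∀ k l, Integrable ({z : ℝ × ℝ | z.1 < z.2}.indicator
      (fun z => gapWeight N x k p z.1 * gapWeight N x l q z.2)) := fun k l =>
    ((integrable_gapWeight hx hp k).mul_prod (integrable_gapWeight hx hq l)).indicator
      measurableSet_ordered
  have hsum : ∑ k ∈ Finset.range (2 * N + 1), ∑ l ∈ Finset.range (2 * N + 1),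
      I ^ (k + l) * (D k l : ℂ) = 0 := by
    have h := integral_ordered_eq_zero hx hp hq
    have hae : ∀ᵐ z : ℝ × ℝ, (∀ i, z.1 ≠ marked N x i) ∧ ∀ i, z.2 ≠ marked N x i := by
      rw [Measure.volume_eq_prod]
      exact (Measure.quasiMeasurePreserving_fst.ae (ae_ne_marked N x)).and
        (Measure.quasiMeasurePreserving_snd.ae (ae_ne_marked N x))
    rw [integral_congr_ae (g := fun z => phase N ^ 2 * ∑ k ∈ Finset.range (2 * N + 1),
      ∑ l ∈ Finset.range (2 * N + 1), I ^ (k + l) * (({z : ℝ × ℝ | z.1 < z.2}.indicator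
        (fun z => gapWeight N x k p z.1 * gapWeight N x l q z.2) z : ℝ) : ℂ)) ?_,
      integral_const_mul, integral_finsetSum] at h
    · have h2 := (mul_eq_zero.1 h).resolve_left (pow_ne_zero 2 (phase_ne_zero N))
      rw [← h2]
      refine Finset.sum_congr rfl fun k _ => ?_
      rw [integral_finsetSum _ fun l _ => ((hInt k l).ofReal).const_mul _]
      refine Finset.sum_congr rfl fun l _ => ?_
      rw [integral_const_mul, integral_complex_ofReal]
    · exact fun k _ => integrable_finsetSum _ fun l _ => ((hInt k l).ofReal).const_mul _
    · filter_upwards [hae] with z hz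
      by_cases hlt : z.1 < z.2
      · have hm : z ∈ {z : ℝ × ℝ | z.1 < z.2} := hlt
        simp only [Set.indicator_of_mem hm]
        rw [pow_mul_holWeight_eq_sum hx hz.1, pow_mul_holWeight_eq_sum hx hz.2, mul_mul_mul_comm,
          Finset.sum_mul_sum, ← pow_two]
        congr 1
        refine Finset.sum_congr rfl fun k _ => Finset.sum_congr rfl fun l _ => ?_
        push_cast
        ring
      · have hm : z ∉ {z : ℝ × ℝ | z.1 < z.2} := hlt
        simp [Set.indicator_of_notMem hm]
  have him := congrArg im hsum
  simp only [im_sum, zero_im, im_mul_ofReal] at him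
  refine Eq.trans ?_ him
  refine Finset.sum_congr rfl fun k hk => Finset.sum_congr rfl fun l hl => ?_
  rw [Finset.mem_range] at hk hl
  rcases eq_or_ne k l with rfl | hkl
  · rw [if_neg (lt_irrefl _), ← two_mul, pow_mul, I_sq]
    rcases neg_one_pow_eq_or ℂ k with h | h <;> simp [h]
  · rw [hD]
    dsimp only
    rw [integral_ordered_gaps x p q (by omega) (by omega) hkl]
    split_ifs <;> simp

end Gaps

section Moments

theorem integrable_pi_prod_pow_mul {d : ℕ} {s : Fin d → Set ℝ} {w : ℝ → ℝ}
    (hInt : ∀ r j, j < d → IntegrableOn (fun u => u ^ j * w u) (s r)) (σ : Equiv.Perm (Fin d)) :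
    IntegrableOn (fun u : Fin d → ℝ => ∏ r, (u r ^ (σ r : ℕ) * w (u r))) (Set.univ.pi s) := by
  rw [IntegrableOn, volume_pi, Measure.restrict_pi_pi]
  exact Integrable.fintype_prod (f := fun r u => u ^ (σ r : ℕ) * w u)
    fun r => hInt r (σ r) (σ r).2

theorem sum_sign_prod_pow_mul {d : ℕ} (u : Fin d → ℝ) (w : ℝ → ℝ) :
    ∑ σ : Equiv.Perm (Fin d), ((Equiv.Perm.sign σ : ℤ) : ℝ) * ∏ r, (u r ^ (σ r : ℕ) * w (u r)) =
      (∏ p ∈ (Finset.univ ×ˢ Finset.univ : Finset (Fin d × Fin d)).filter fun p => p.1 < p.2,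
        (u p.2 - u p.1)) * ∏ r, w (u r) := by
  have h1 := Matrix.det_vandermonde u
  rw [← Matrix.det_transpose, Matrix.det_apply'] at h1
  have h2 : ∏ p ∈ (Finset.univ ×ˢ Finset.univ : Finset (Fin d × Fin d)).filter
      (fun p => p.1 < p.2), (u p.2 - u p.1) = ∏ i, ∏ j ∈ Finset.Ioi i, (u j - u i) := by
    rw [Finset.prod_filter, Finset.prod_product]
    refine Finset.prod_congr rfl fun i _ => ?_
    rw [← Finset.prod_filter]
    refine Finset.prod_congr ?_ fun _ _ => rfl
    ext j
    simp
  rw [h2, ← h1, Finset.sum_mul]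
  refine Finset.sum_congr rfl fun σ _ => ?_
  rw [Finset.prod_mul_distrib, mul_assoc]
  rfl

theorem det_moments_eq {d : ℕ} {s : Fin d → Set ℝ} {w : ℝ → ℝ}
    (hInt : ∀ r j, j < d → IntegrableOn (fun u => u ^ j * w u) (s r)) :
    (Matrix.of fun r j : Fin d => ∫ u in s r, u ^ (j : ℕ) * w u).det =
      ∫ u : Fin d → ℝ in Set.univ.pi s,
        (∏ p ∈ (Finset.univ ×ˢ Finset.univ : Finset (Fin d × Fin d)).filter fun p => p.1 < p.2,
          (u p.2 - u p.1)) * ∏ r, w (u r) := by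
  rw [← Matrix.det_transpose, Matrix.det_apply']
  simp only [← sum_sign_prod_pow_mul]
  rw [integral_finsetSum _ fun σ _ => (integrable_pi_prod_pow_mul hInt σ).const_mul _]
  refine Finset.sum_congr rfl fun σ _ => ?_
  rw [integral_const_mul, volume_pi, Measure.restrict_pi_pi]
  congr 1
  rw [integral_fintype_prod_eq_prod (f := fun r u => u ^ (σ r : ℕ) * w u)]
  rfl

theorem det_moments_pos {d : ℕ} {s : Fin d → Set ℝ} {w : ℝ → ℝ}
    (hInt : ∀ r j, j < d → IntegrableOn (fun u => u ^ j * w u) (s r))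
    (hs : ∀ r, MeasurableSet (s r)) (hw : ∀ r, ∀ u ∈ s r, 0 < w u)
    (hord : ∀ r t, r < t → ∀ u ∈ s r, ∀ v ∈ s t, u < v) (hvol : ∀ r, volume (s r) ≠ 0) :
    0 < (Matrix.of fun r j : Fin d => ∫ u in s r, u ^ (j : ℕ) * w u).det := by
  rw [det_moments_eq hInt]
  have hm : MeasurableSet (Set.univ.pi s) := MeasurableSet.univ_pi hs
  have hpos : ∀ u ∈ Set.univ.pi s, 0 < (∏ p ∈ (Finset.univ ×ˢ Finset.univ :
      Finset (Fin d × Fin d)).filter fun p => p.1 < p.2, (u p.2 - u p.1)) * ∏ r, w (u r) := by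
    intro u hu
    refine mul_pos (Finset.prod_pos fun p hp => ?_)
      (Finset.prod_pos fun r _ => hw r _ (hu r (Set.mem_univ r)))
    exact sub_pos.2 (hord _ _ (Finset.mem_filter.1 hp).2 _ (hu _ (Set.mem_univ _)) _
      (hu _ (Set.mem_univ _)))
  rw [setIntegral_pos_iff_support_of_nonneg_ae]
  · rw [Set.inter_eq_right.2 fun u hu => Function.mem_support.2 (hpos u hu).ne', volume_pi_pi]
    exact pos_iff_ne_zero.2 (Finset.prod_ne_zero_iff.2 fun r _ => hvol r)
  · filter_upwards [ae_restrict_mem hm] with u hu using (hpos u hu).le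
  · simp only [← sum_sign_prod_pow_mul]
    exact integrable_finsetSum _ fun σ _ => (integrable_pi_prod_pow_mul hInt σ).const_mul _

variable {N : ℕ} {x : ℕ → ℝ}

theorem gapMoment_eq (N : ℕ) (x : ℕ → ℝ) (k j : ℕ) :
    gapMoment N x k j = ∫ u in gap N x k, u ^ j * weight (marked N x) u :=
  integral_indicator (measurableSet_gap N x k)

theorem weight_pos_of_mem_gap {k : ℕ} {u : ℝ} (hu : u ∈ gap N x k) :
    0 < weight (marked N x) u := by
  refine weight_pos fun i => ?_
  rcases le_or_gt (i : ℕ) k with h | h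
  · exact ((hu i i.2).1 h).ne'
  · exact ((hu i i.2).2 h).ne

theorem volume_gap_ne_zero (hx : IsChamber N x) {k : ℕ} (hk : k ≤ 2 * N) :
    volume (gap N x k) ≠ 0 := by
  rcases Nat.eq_zero_or_pos k with rfl | h0
  · have h : Set.Iio (x 1) ⊆ gap N x 0 := fun u hu i hi => by
      rw [Finset.mem_Icc] at hi
      refine ⟨fun h => by omega, fun _ => ?_⟩
      rcases hi.1.lt_or_eq with h | h
      · exact lt_trans hu (hx 1 i le_rfl h hi.2)
      · rw [← h]
        exact hu
    refine fun h' => ?_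
    have := measure_mono_null h h'
    simp at this
  rcases hk.lt_or_eq with h | rfl
  · rw [gap_eq_Ioo hx h0 h, Real.volume_Ioo]
    simpa using hx k (k + 1) h0 (by omega) h
  · have h : Set.Ioi (x (2 * N)) ⊆ gap N x (2 * N) := fun u hu i hi => by
      rw [Finset.mem_Icc] at hi
      refine ⟨fun _ => ?_, fun h => by omega⟩
      rcases hi.2.lt_or_eq with h | h
      · exact lt_trans (hx i _ hi.1 h le_rfl) hu
      · rw [h]
        exact hu
    refine fun h' => ?_
    have := measure_mono_null h h'
    simp at this

theorem det_gapMoment_pos_of_integrableOn (hx : IsChamber N x) {d : ℕ}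
    {k : Fin d → ℕ} (hk : StrictMono k) (hk' : ∀ r, k r ≤ 2 * N)
    (hInt : ∀ r j, j < d → IntegrableOn (fun u => u ^ j * weight (marked N x) u)
      (gap N x (k r))) :
    0 < (Matrix.of fun r j : Fin d => gapMoment N x (k r) j).det := by
  simp only [gapMoment_eq]
  exact det_moments_pos (s := fun r => gap N x (k r)) hInt (fun r => measurableSet_gap _ _ _)
    (fun r u hu => weight_pos_of_mem_gap hu)
    (fun r t hrt u hu v hv => lt_of_mem_gap (hk hrt) (hk' t) hu hv)
    fun r => volume_gap_ne_zero hx (hk' r)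

theorem det_gapMoment_pos (hx : IsChamber N x) {d : ℕ} (hd : d + 1 ≤ N) {k : Fin d → ℕ}
    (hk : StrictMono k) (hk' : ∀ r, k r ≤ 2 * N) :
    0 < (Matrix.of fun r j : Fin d => gapMoment N x (k r) j).det :=
  det_gapMoment_pos_of_integrableOn hx hk hk' fun _ _ hj =>
    (integrable_pow_weight hx (by omega)).integrableOn

theorem integrableOn_gap (hx : IsChamber N x) {k : ℕ} (h1 : 1 ≤ k) (h2 : k + 1 ≤ 2 * N) (j : ℕ) :
    IntegrableOn (fun u => u ^ j * weight (marked N x) u) (gap N x k) := by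
  rw [gap_eq_Ioo hx h1 h2]
  exact integrableOn_pow_mul_weight hx.injective_marked j _ _

theorem rho_eq (hx : IsChamber N x) {k : Fin N → ℕ} (hk : ∀ r, 1 ≤ k r ∧ k r + 1 ≤ 2 * N) :
    rho N k x = (∏ p ∈ (Finset.Icc 1 (2 * N) ×ˢ Finset.Icc 1 (2 * N)).filter
      fun p => p.1 < p.2, (x p.2 - x p.1) ^ ((4 : ℝ)⁻¹)) *
        (Matrix.of fun r j : Fin N => gapMoment N x (k r) j).det := by
  simp only [gapMoment_eq]
  rw [det_moments_eq (s := fun r => gap N x (k r)) fun r j _ =>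
    integrableOn_gap hx (hk r).1 (hk r).2 j, rho]
  have h1 : (fun r => Set.Ioo (x (k r)) (x (k r + 1))) = fun r => gap N x (k r) :=
    funext fun r => (gap_eq_Ioo hx (hk r).1 (hk r).2).symm
  have h2 : ∀ u : ℝ, ∏ i ∈ Finset.Icc 1 (2 * N), |u - x i| ^ (-(2 : ℝ)⁻¹) =
      weight (marked N x) u := fun u => by
    rw [← Finset.prod_coe_sort, weight]
    rfl
  simp only [h1, h2]

theorem prefactor_pos (hx : IsChamber N x) : 0 < ∏ p ∈ (Finset.Icc 1 (2 * N) ×ˢ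
    Finset.Icc 1 (2 * N)).filter fun p => p.1 < p.2, (x p.2 - x p.1) ^ ((4 : ℝ)⁻¹) := by
  refine Finset.prod_pos fun p hp => ?_
  rw [Finset.mem_filter, Finset.mem_product, Finset.mem_Icc, Finset.mem_Icc] at hp
  exact Real.rpow_pos_of_pos (sub_pos.2 (hx _ _ hp.1.1.1 hp.2 hp.1.2.2)) _

end Moments

section FoldSeq

variable {V : Type*} [AddCommGroup V]

/-- The sequence `ψ` with `ψ 0 = 0` and `ψ (k + 1) + ψ (k - 1) = a k`. -/
def foldSeq (a : ℕ → V) : ℕ → V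
  | 0 => 0
  | 1 => a 0
  | k + 2 => a (k + 1) - foldSeq a k

theorem col_foldSeq (a : ℕ → V) (k : ℕ) : foldSeq a (k + 1) + foldSeq a (k - 1) = a k := by
  cases k with
  | zero => simp [foldSeq]
  | succ k => simp [foldSeq]

theorem foldSeq_odd (a : ℕ → ℝ) (m : ℕ) :
    foldSeq a (2 * m + 1) = (-1) ^ m * ∑ j ∈ Finset.range (m + 1), (-1) ^ j * a (2 * j) := by
  induction m with
  | zero => simp [foldSeq]
  | succ m ih =>
    rw [show 2 * (m + 1) + 1 = (2 * m + 1) + 2 by ring, foldSeq, ih,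
      Finset.sum_range_succ _ (m + 1), show 2 * m + 1 + 1 = 2 * (m + 1) by ring, pow_succ]
    have : (-1 : ℝ) ^ m * (-1) ^ m = 1 := by rw [← mul_pow]; simp
    linear_combination (-a (2 * (m + 1))) * this

theorem foldSeq_even (a : ℕ → ℝ) (m : ℕ) :
    foldSeq a (2 * m) = -(-1) ^ m * ∑ j ∈ Finset.range m, (-1) ^ j * a (2 * j + 1) := by
  induction m with
  | zero => simp [foldSeq]
  | succ m ih =>
    rw [show 2 * (m + 1) = 2 * m + 2 by ring, foldSeq, ih, Finset.sum_range_succ, pow_succ]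
    have : (-1 : ℝ) ^ m * (-1) ^ m = 1 := by rw [← mul_pow]; simp
    linear_combination (-a (2 * m + 1)) * this

theorem foldSeq_apply {κ : Type*} (a : ℕ → κ → ℝ) (k : ℕ) (p : κ) :
    foldSeq a k p = foldSeq (fun k => a k p) k := by
  induction k using Nat.strong_induction_on with
  | h k ih =>
    match k with
    | 0 => rfl
    | 1 => rfl
    | k + 2 => simp only [foldSeq, Pi.sub_apply, ih k (by omega)]

theorem sum_range_parity {V : Type*} [AddCommMonoid V] (f : ℕ → V) (N : ℕ) :
    ∑ k ∈ Finset.range (2 * N + 1), f k =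
      ∑ j ∈ Finset.range (N + 1), f (2 * j) + ∑ m ∈ Finset.range N, f (2 * m + 1) := by
  induction N with
  | zero => simp
  | succ N ih =>
    rw [show 2 * (N + 1) + 1 = 2 * N + 1 + 1 + 1 by ring, Finset.sum_range_succ,
      Finset.sum_range_succ _ (2 * N + 1), ih, Finset.sum_range_succ _ (N + 1),
      Finset.sum_range_succ (fun m => f (2 * m + 1)) N, show 2 * N + 1 + 1 = 2 * (N + 1) by ring]
    ac_rfl

theorem sum_range_ite_le (f : ℕ → ℝ) {m N : ℕ} (h : m < N) :
    ∑ j ∈ Finset.range N, (if j ≤ m then f j else 0) = ∑ j ∈ Finset.range (m + 1), f j := by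
  rw [← Finset.sum_filter]
  congr 1
  ext j
  simp only [Finset.mem_filter, Finset.mem_range]
  omega

theorem I_pow_two_mul (s : ℕ) : Complex.I ^ (2 * s) = (((-1) ^ s : ℝ) : ℂ) := by
  rw [pow_mul, Complex.I_sq]
  push_cast
  rfl

theorem I_pow_two_mul_add_one (s : ℕ) :
    Complex.I ^ (2 * s + 1) = (((-1) ^ s : ℝ) : ℂ) * Complex.I := by
  rw [pow_succ, I_pow_two_mul]

theorem alternating_sums_of_sum_I_pow {a : ℕ → ℝ} {N : ℕ}
    (h : ∑ k ∈ Finset.range (2 * N + 1), Complex.I ^ k * (a k : ℂ) = 0) :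
    ∑ j ∈ Finset.range (N + 1), (-1) ^ j * a (2 * j) = 0 ∧
      ∑ m ∈ Finset.range N, (-1) ^ m * a (2 * m + 1) = 0 := by
  rw [sum_range_parity] at h
  simp only [I_pow_two_mul, I_pow_two_mul_add_one] at h
  have hr := congrArg Complex.re h
  have hi := congrArg Complex.im h
  rw [Complex.add_re, Complex.re_sum, Complex.re_sum] at hr
  rw [Complex.add_im, Complex.im_sum, Complex.im_sum] at hi
  simp only [mul_right_comm _ Complex.I, ← Complex.ofReal_mul, Complex.ofReal_re,
    Complex.re_ofReal_mul, Complex.I_re, Complex.ofReal_im, Complex.im_ofReal_mul, Complex.I_im,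
    mul_zero, mul_one, Finset.sum_const_zero, add_zero, zero_add, Complex.zero_re,
    Complex.zero_im] at hr hi
  exact ⟨hr, hi⟩

theorem sum_partial_sums_eq {a b : ℕ → ℝ} {N : ℕ}
    (hb : ∑ j ∈ Finset.range (N + 1), (-1) ^ j * b (2 * j) = 0)
    (hord : ∑ k ∈ Finset.range (2 * N + 1), ∑ l ∈ Finset.range (2 * N + 1),
      (if k < l then (Complex.I ^ (k + l)).im * (a k * b l) else 0) = 0) :
    ∑ m ∈ Finset.range N, (-1) ^ m *
      (a (2 * m + 1) * ∑ j ∈ Finset.range (m + 1), (-1) ^ j * b (2 * j) -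
        (∑ j ∈ Finset.range (m + 1), (-1) ^ j * a (2 * j)) * b (2 * m + 1)) = 0 := by
  have him : ∀ s, (Complex.I ^ (2 * s)).im = 0 := fun s => by
    rw [I_pow_two_mul, Complex.ofReal_im]
  have him' : ∀ s, (Complex.I ^ (2 * s + 1)).im = (-1) ^ s := fun s => by
    rw [I_pow_two_mul_add_one, Complex.im_ofReal_mul, Complex.I_im, mul_one]
  have e1 : ∀ i j, 2 * i + 2 * j = 2 * (i + j) := fun i j => by ring
  have e2 : ∀ i j, 2 * i + (2 * j + 1) = 2 * (i + j) + 1 := fun i j => by ring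
  have e3 : ∀ i j, 2 * i + 1 + 2 * j = 2 * (i + j) + 1 := fun i j => by ring
  have e4 : ∀ i j, 2 * i + 1 + (2 * j + 1) = 2 * (i + j + 1) := fun i j => by ring
  have l1 : ∀ i j, 2 * i < 2 * j + 1 ↔ i ≤ j := fun i j => by omega
  have l2 : ∀ i j, 2 * i + 1 < 2 * j ↔ i < j := fun i j => by omega
  rw [sum_range_parity] at hord
  simp only [sum_range_parity _ N, e1, e2, e3, e4, him, him', l1, l2, zero_mul, ite_self,
    Finset.sum_const_zero, zero_add, add_zero] at hord
  rw [Finset.sum_comm, ← Finset.sum_add_distrib] at hord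
  rw [← neg_eq_zero, ← hord, ← Finset.sum_neg_distrib]
  refine Finset.sum_congr rfl fun m hm => ?_
  rw [Finset.mem_range] at hm
  have h1 : ∑ j ∈ Finset.range (N + 1),
      (if j ≤ m then (-1) ^ (j + m) * (a (2 * j) * b (2 * m + 1)) else 0) =
      (-1) ^ m * ((∑ j ∈ Finset.range (m + 1), (-1) ^ j * a (2 * j)) * b (2 * m + 1)) := by
    rw [sum_range_ite_le _ (by omega), Finset.sum_mul, Finset.mul_sum]
    refine Finset.sum_congr rfl fun j _ => ?_
    ring
  have h2 : ∑ j ∈ Finset.range (N + 1),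
      (if m < j then (-1) ^ (m + j) * (a (2 * m + 1) * b (2 * j)) else 0) =
      -((-1) ^ m * (a (2 * m + 1) * ∑ j ∈ Finset.range (m + 1), (-1) ^ j * b (2 * j))) := by
    rw [← sum_range_ite_le (fun j => (-1) ^ j * b (2 * j)) (show m < N + 1 by omega),
      ← mul_assoc, Finset.mul_sum, ← sub_eq_zero, sub_neg_eq_add, ← Finset.sum_add_distrib]
    calc _ = (-1) ^ m * a (2 * m + 1) * ∑ j ∈ Finset.range (N + 1), (-1) ^ j * b (2 * j) := by
          rw [Finset.mul_sum]
          refine Finset.sum_congr rfl fun j _ => ?_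
          by_cases h : j ≤ m
          · rw [if_neg (by omega), if_pos h, zero_add]
          · rw [if_pos (by omega), if_neg h, mul_zero, add_zero]
            ring
      _ = 0 := by rw [hb, mul_zero]
  rw [h1, h2]
  ring

theorem lag_foldSeq {a b a' b' : ℕ → ℝ} {n : ℕ} {c d : ℝ}
    (ha0 : a' 0 = a 0 + c) (hb0 : b' 0 = b 0 + d) (ha : ∀ k, k ≠ 0 → a' k = a k)
    (hb : ∀ k, k ≠ 0 → b' k = b k)
    (hao : ∑ m ∈ Finset.range (n + 1), (-1) ^ m * a (2 * m + 1) = 0)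
    (hbo : ∑ m ∈ Finset.range (n + 1), (-1) ^ m * b (2 * m + 1) = 0)
    (ha' : foldSeq a' (2 * n + 1) = 0) (hb' : foldSeq b' (2 * n + 1) = 0)
    (h : ∑ m ∈ Finset.range (n + 1), (-1) ^ m *
      (a (2 * m + 1) * ∑ j ∈ Finset.range (m + 1), (-1) ^ j * b (2 * j) -
        (∑ j ∈ Finset.range (m + 1), (-1) ^ j * a (2 * j)) * b (2 * m + 1)) = 0) :
    ∑ j ∈ Finset.range (2 * n + 1), (-1) ^ j *
      (foldSeq a' j * foldSeq b' (j + 1) - foldSeq a' (j + 1) * foldSeq b' j) = 0 := by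
  have hs : ∀ (a a' : ℕ → ℝ) (c : ℝ), a' 0 = a 0 + c → (∀ k, k ≠ 0 → a' k = a k) → ∀ m,
      foldSeq a' (2 * m + 1) =
        (-1) ^ m * (∑ j ∈ Finset.range (m + 1), (-1) ^ j * a (2 * j) + c) := by
    intro a a' c h0 h1 m
    rw [foldSeq_odd, Finset.sum_range_succ', Finset.sum_range_succ']
    simp only [mul_zero, pow_zero, one_mul, h0]
    rw [Finset.sum_congr rfl fun j _ => by rw [h1 _ (by omega)], add_assoc]
  have e : ∀ (a : ℕ → ℝ) m, foldSeq a (2 * m) = a (2 * m + 1) - foldSeq a (2 * m + 2) :=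
    fun a m => by
      rw [foldSeq]
      ring
  have hlast : ∑ j ∈ Finset.range (2 * n + 1), (-1) ^ j *
      (foldSeq a' j * foldSeq b' (j + 1) - foldSeq a' (j + 1) * foldSeq b' j) =
      ∑ m ∈ Finset.range (n + 1), (a (2 * m + 1) * foldSeq b' (2 * m + 1) -
        foldSeq a' (2 * m + 1) * b (2 * m + 1)) := by
    rw [sum_range_parity, Finset.sum_range_succ, Finset.sum_range_succ _ n, ha', hb']
    simp only [mul_zero, zero_mul, sub_zero, add_zero]
    rw [← Finset.sum_add_distrib]
    refine Finset.sum_congr rfl fun m _ => ?_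
    rw [e a', e b', ha _ (by omega), hb _ (by omega), pow_succ, pow_mul]
    ring
  have key : ∑ m ∈ Finset.range (n + 1), (a (2 * m + 1) * foldSeq b' (2 * m + 1) -
        foldSeq a' (2 * m + 1) * b (2 * m + 1)) =
      ∑ m ∈ Finset.range (n + 1), (-1) ^ m *
      (a (2 * m + 1) * ∑ j ∈ Finset.range (m + 1), (-1) ^ j * b (2 * j) -
        (∑ j ∈ Finset.range (m + 1), (-1) ^ j * a (2 * j)) * b (2 * m + 1)) +
      d * ∑ m ∈ Finset.range (n + 1), (-1) ^ m * a (2 * m + 1) -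
      c * ∑ m ∈ Finset.range (n + 1), (-1) ^ m * b (2 * m + 1) := by
    rw [Finset.mul_sum, Finset.mul_sum, ← Finset.sum_add_distrib, ← Finset.sum_sub_distrib]
    refine Finset.sum_congr rfl fun m _ => ?_
    rw [hs a a' c ha0 ha, hs b b' d hb0 hb]
    ring
  rw [hlast, key, h, hao, hbo]
  ring

end FoldSeq

section Determinants

theorem exchange_det (n : ℕ) : Exchange (Matrix.detRowAlternating (R := ℝ) (n := Fin (n + 1))) := by
  intro w q R
  set L : (Fin (n + 1) → ℝ) →ₗ[ℝ] ℝ :=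
    { toFun := fun v => (Matrix.detRowAlternating (R := ℝ)).curryLeft v R
      map_add' := fun u v => by rw [map_add]; rfl
      map_smul' := fun c v => by rw [map_smul]; rfl } with hL
  have hLv : ∀ v, Matrix.detRowAlternating (R := ℝ) (Matrix.vecCons v R) = L v := fun v => rfl
  have h : (Matrix.of w).det • q =
      ∑ i, Matrix.detRowAlternating (R := ℝ) (Function.update w i q) • w i := by
    rw [← Matrix.det_transpose, ← Matrix.mulVec_cramer]
    ext j
    simp only [Matrix.mulVec, dotProduct, Matrix.cramer_transpose_apply, Finset.sum_apply,
      Pi.smul_apply, smul_eq_mul]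
    exact Finset.sum_congr rfl fun i _ => mul_comm _ _
  have h2 := congrArg L h
  rw [map_smul, map_sum] at h2
  simp only [map_smul, smul_eq_mul] at h2
  simp only [hLv]
  exact h2

theorem det_last_row (n : ℕ) (w : Fin (n + 1) → ℝ) (hw : w = Pi.single (Fin.last n) 1)
    (v : Fin n → Fin (n + 1) → ℝ) :
    (Matrix.detRowAlternating (R := ℝ)).curryLeft w v =
      (-1) ^ n * (Matrix.of fun r j : Fin n => v r j.castSucc).det := by
  rw [AlternatingMap.curryLeft_apply_apply]
  change Matrix.det (Matrix.of (Matrix.vecCons w v)) = _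
  rw [Matrix.det_succ_row_zero, Finset.sum_eq_single (Fin.last n)]
  · rw [hw]
    simp [Matrix.submatrix]
  · intro j _ hj
    rw [hw]
    simp [hj]
  · simp

end Determinants

section MomentSystem

variable {n : ℕ} {x : ℕ → ℝ}

/-- The moments over the gaps, the two outer gaps being merged into one. -/
noncomputable def cyclicMoment (n : ℕ) (x : ℕ → ℝ) (k : ℕ) (j : Fin n) : ℝ :=
  gapMoment (n + 1) x k j + if k = 0 then (-1) ^ (n + 1) * gapMoment (n + 1) x (2 * n + 2) j else 0

theorem cyclicMoment_zero (n : ℕ) (x : ℕ → ℝ) (j : Fin n) : cyclicMoment n x 0 j =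
    gapMoment (n + 1) x 0 j + (-1) ^ (n + 1) * gapMoment (n + 1) x (2 * n + 2) j := by
  simp [cyclicMoment]

theorem cyclicMoment_of_ne_zero {k : ℕ} (hk : k ≠ 0) (j : Fin n) :
    cyclicMoment n x k j = gapMoment (n + 1) x k j := by
  simp [cyclicMoment, hk]

theorem alternating_gapMoment (hx : IsChamber (n + 1) x) (p : Fin n) :
    ∑ j ∈ Finset.range (n + 1 + 1), (-1) ^ j * gapMoment (n + 1) x (2 * j) p = 0 ∧
      ∑ m ∈ Finset.range (n + 1), (-1) ^ m * gapMoment (n + 1) x (2 * m + 1) p = 0 :=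
  alternating_sums_of_sum_I_pow (a := fun k => gapMoment (n + 1) x k p) (sum_I_pow_mul_gapMoment hx (j := p) (by omega))

theorem foldSeq_cyclicMoment_last (hx : IsChamber (n + 1) x) (p : Fin n) :
    foldSeq (fun k => cyclicMoment n x k p) (2 * n + 1) = 0 := by
  have h := (alternating_gapMoment hx p).1
  rw [Finset.sum_range_succ, Finset.sum_range_succ'] at h
  rw [foldSeq_odd, Finset.sum_range_succ', cyclicMoment_zero,
    Finset.sum_congr rfl fun j _ => by rw [cyclicMoment_of_ne_zero (by omega)]]
  rw [mul_eq_zero]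
  right
  rw [← h]
  simp only [mul_zero, pow_zero, one_mul, show 2 * (n + 1) = 2 * n + 2 by ring]
  ring

theorem foldSeq_cyclicMoment_top (hx : IsChamber (n + 1) x) (p : Fin n) :
    foldSeq (fun k => cyclicMoment n x k p) (2 * n + 2) = 0 := by
  rw [show 2 * n + 2 = 2 * (n + 1) by ring, foldSeq_even,
    Finset.sum_congr rfl fun j _ => by rw [cyclicMoment_of_ne_zero (by omega)],
    (alternating_gapMoment hx p).2, mul_zero]

theorem lag_cyclicMoment (hx : IsChamber (n + 1) x) (p q : Fin n) :
    ∑ j ∈ Finset.range (2 * n + 1), (-1) ^ j *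
      (foldSeq (cyclicMoment n x) j p * foldSeq (cyclicMoment n x) (j + 1) q -
        foldSeq (cyclicMoment n x) (j + 1) p * foldSeq (cyclicMoment n x) j q) = 0 := by
  simp only [foldSeq_apply]
  exact lag_foldSeq (a := fun k => gapMoment (n + 1) x k p) (b := fun k => gapMoment (n + 1) x k q)
    (cyclicMoment_zero n x p) (cyclicMoment_zero n x q)
    (fun k hk => cyclicMoment_of_ne_zero hk p) (fun k hk => cyclicMoment_of_ne_zero hk q)
    (alternating_gapMoment hx p).2 (alternating_gapMoment hx q).2
    (foldSeq_cyclicMoment_last hx p) (foldSeq_cyclicMoment_last hx q)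
    (sum_partial_sums_eq (alternating_gapMoment hx q).1
      (sum_ordered_gapMoment hx (p := p) (q := q) (by omega) (by omega)))

theorem det_cyclicMoment_pos (hx : IsChamber (n + 1) x) {k : Fin n → ℕ} (hk : StrictMono k)
    (hk' : ∀ r, k r < 2 * n + 2) : 0 < (Matrix.of fun r j : Fin n => cyclicMoment n x (k r) j).det := by
  by_cases h0 : ∀ r, k r ≠ 0
  · simp only [cyclicMoment_of_ne_zero (h0 _)]
    exact det_gapMoment_pos hx le_rfl hk fun r => (hk' r).le
  push Not at h0
  obtain ⟨r, hr⟩ := h0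
  cases n with
  | zero => exact r.elim0
  | succ d =>
    have hk0 : k 0 = 0 := by
      have := hk.monotone (Fin.zero_le r)
      omega
    have hks : ∀ i : Fin d, k i.succ ≠ 0 := fun i => by
      have := hk (Fin.succ_pos i)
      omega
    set M : Matrix (Fin (d + 1)) (Fin (d + 1)) ℝ :=
      Matrix.of fun r j => gapMoment (d + 2) x (k r) j with hM
    set v : Fin (d + 1) → ℝ := fun j => gapMoment (d + 2) x (2 * d + 4) j with hv
    have h1 : (Matrix.of fun r j : Fin (d + 1) => cyclicMoment (d + 1) x (k r) j) =
        M.updateRow 0 (M 0 + (-1 : ℝ) ^ d • v) := by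
      ext i j
      refine Fin.cases ?_ (fun i => ?_) i
      · rw [Matrix.updateRow_self, Matrix.of_apply, hk0, cyclicMoment_zero]
        simp [hM, hv, hk0, pow_succ, mul_add]
      · rw [Matrix.updateRow_ne (Fin.succ_ne_zero i), Matrix.of_apply,
          cyclicMoment_of_ne_zero (hks i)]
        rfl
    set k' : Fin (d + 1) → ℕ := Fin.snoc (α := fun _ => ℕ) (fun i : Fin d => k i.succ) (2 * d + 4)
      with hk2
    have hmono : StrictMono k' := by
      intro i j hij
      induction j using Fin.lastCases with
      | last =>
        induction i using Fin.lastCases with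
        | last => exact absurd hij (lt_irrefl _)
        | cast i =>
          simp only [hk2, Fin.snoc_castSucc, Fin.snoc_last]
          have := hk' i.succ
          omega
      | cast j =>
        induction i using Fin.lastCases with
        | last => exact absurd (hij.trans (Fin.castSucc_lt_last j)) (lt_irrefl _)
        | cast i =>
          simp only [hk2, Fin.snoc_castSucc]
          exact hk (Fin.succ_lt_succ_iff.2 (Fin.castSucc_lt_castSucc_iff.1 hij))
    have h2 : (Matrix.of fun r j : Fin (d + 1) => gapMoment (d + 2) x (k' r) j) =
        (M.updateRow 0 v).submatrix (finRotate (d + 1)) id := by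
      ext i j
      induction i using Fin.lastCases with
      | last => simp [hk2, hv]
      | cast i =>
        simp [hk2, hM]
    have h3 : 0 < (-1 : ℝ) ^ d * (M.updateRow 0 v).det := by
      have := det_gapMoment_pos hx (d := d + 1) le_rfl hmono (fun i => by
        induction i using Fin.lastCases with
        | last =>
          simp only [hk2, Fin.snoc_last]
          omega
        | cast i =>
          simp only [hk2, Fin.snoc_castSucc]
          have := hk' i.succ
          omega)
      rw [h2, Matrix.det_permute, sign_finRotate] at this
      simpa using this
    rw [h1, Matrix.det_updateRow_add, Matrix.updateRow_eq_self, Matrix.det_updateRow_smul]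
    exact add_pos (det_gapMoment_pos hx le_rfl hk fun r => (hk' r).le) h3

/-- The vectors of the minor system built from the moments. -/
noncomputable def momentSeq (n : ℕ) (x : ℕ → ℝ) (j : ℕ) : Fin (n + 1) → ℝ :=
  if j ≤ 2 * n + 1 then Fin.snoc (α := fun _ => ℝ) (foldSeq (cyclicMoment n x) j) 0
  else Pi.single (Fin.last n) 1

theorem momentSeq_castSucc (hx : IsChamber (n + 1) x) {j : ℕ} (hj : j ≤ 2 * n + 2) (p : Fin n) :
    momentSeq n x j p.castSucc = foldSeq (cyclicMoment n x) j p := by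
  rcases hj.lt_or_eq with h | rfl
  · rw [momentSeq, if_pos (by omega), Fin.snoc_castSucc]
  · rw [momentSeq, if_neg (by omega), Pi.single_apply, if_neg (Fin.castSucc_lt_last p).ne,
      foldSeq_apply, foldSeq_cyclicMoment_top hx]

theorem momentSeq_last {j : ℕ} :
    momentSeq n x j (Fin.last n) = if j ≤ 2 * n + 1 then 0 else 1 := by
  rw [momentSeq]
  split_ifs <;> simp

theorem col_momentSeq_castSucc (hx : IsChamber (n + 1) x) {k : ℕ} (hk : k ≤ 2 * n + 1)
    (p : Fin n) : col (momentSeq n x) k p.castSucc = cyclicMoment n x k p := by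
  rw [col, Pi.add_apply, momentSeq_castSucc hx (by omega), momentSeq_castSucc hx (by omega),
    ← Pi.add_apply, col_foldSeq]

theorem col_momentSeq_last {k : ℕ} (hk : k ≤ 2 * n + 1) :
    col (momentSeq n x) k (Fin.last n) = if k = 2 * n + 1 then 1 else 0 := by
  rw [col, Pi.add_apply, momentSeq_last, momentSeq_last, if_pos (show k - 1 ≤ 2 * n + 1 by omega)]
  by_cases h : k = 2 * n + 1
  · rw [if_neg (by omega), if_pos h, add_zero]
  · rw [if_pos (by omega), if_neg h, add_zero]

/-- The minor system of the moments of the weight attached to a point of the chamber. -/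
noncomputable def momentSystem (hx : IsChamber (n + 1) x) : MinorSystem (Fin (n + 1) → ℝ) n where
  Ω := Matrix.detRowAlternating
  φ := momentSeq n x
  φ_zero := by
    ext i
    induction i using Fin.lastCases with
    | last => simp [momentSeq_last]
    | cast i => simp [momentSeq_castSucc hx, foldSeq]
  φ_last := by
    ext i
    induction i using Fin.lastCases with
    | last => simp [momentSeq_last]
    | cast i => simp [momentSeq_castSucc hx, foldSeq_apply, foldSeq_cyclicMoment_last hx]
  φ_top := by
    rw [momentSeq, momentSeq, if_neg (by omega), if_neg (by omega)]
  exch := exchange_det n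
  lag f := by
    ext i
    rw [Finset.sum_apply, Pi.zero_apply]
    induction i using Fin.lastCases with
    | last =>
      refine Finset.sum_eq_zero fun j hj => ?_
      rw [Finset.mem_range] at hj
      rw [Pi.smul_apply, Pi.sub_apply, Pi.smul_apply, Pi.smul_apply, momentSeq_last,
        momentSeq_last, if_pos (by omega), if_pos (by omega)]
      simp
    | cast q =>
      have hf : ∀ j ≤ 2 * n + 1, f (momentSeq n x j) =
          ∑ p : Fin n, foldSeq (cyclicMoment n x) j p * f (Pi.single p.castSucc 1) := by
        intro j hj
        rw [LinearMap.pi_apply_eq_sum_univ f, Fin.sum_univ_castSucc, momentSeq_last, if_pos hj,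
          zero_smul, add_zero]
        refine Finset.sum_congr rfl fun p _ => ?_
        rw [momentSeq_castSucc hx (by omega), smul_eq_mul]
        congr 2
        ext i
        simp [Pi.single_apply, eq_comm]
      calc _ = ∑ j ∈ Finset.range (2 * n + 1), ∑ p : Fin n, f (Pi.single p.castSucc 1) *
            ((-1) ^ j * (foldSeq (cyclicMoment n x) j p * foldSeq (cyclicMoment n x) (j + 1) q -
              foldSeq (cyclicMoment n x) (j + 1) p * foldSeq (cyclicMoment n x) j q)) := by
            refine Finset.sum_congr rfl fun j hj => ?_
            rw [Finset.mem_range] at hj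
            rw [Pi.smul_apply, Pi.sub_apply, Pi.smul_apply, Pi.smul_apply,
              momentSeq_castSucc hx (by omega), momentSeq_castSucc hx (by omega),
              hf j (by omega), hf (j + 1) (by omega)]
            simp only [smul_eq_mul, Finset.sum_mul]
            rw [← Finset.sum_sub_distrib, Finset.mul_sum]
            refine Finset.sum_congr rfl fun p _ => ?_
            ring
        _ = 0 := by
            rw [Finset.sum_comm]
            refine Finset.sum_eq_zero fun p _ => ?_
            rw [← Finset.mul_sum, lag_cyclicMoment hx, mul_zero]
  tp J hJ hc := by
    have hlt : ∀ r, J.orderEmbOfFin hc r < 2 * n + 2 := fun r =>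
      Finset.mem_range.1 (hJ (Finset.orderEmbOfFin_mem _ _ _))
    rw [minor, dif_pos hc, det_last_row n _ (by rw [momentSeq, if_neg (by omega)]), ← mul_assoc,
      ← mul_pow, neg_one_mul, neg_neg, one_pow, one_mul]
    have : (Matrix.of fun r j : Fin n => col (momentSeq n x) (J.orderEmbOfFin hc r) j.castSucc) =
        Matrix.of fun r j : Fin n => cyclicMoment n x (J.orderEmbOfFin hc r) j := by
      ext r j
      have := hlt r
      exact col_momentSeq_castSucc hx (by omega) j
    rw [this]
    exact det_cyclicMoment_pos hx (J.orderEmbOfFin hc).strictMono hlt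

end MomentSystem

namespace LinkPattern

variable {N : ℕ}

theorem a_ne_b (β : LinkPattern N) (r s : Fin N) : β.a r ≠ β.b s := fun h => by
  have := @β.inj (r, false) (s, true) (by simpa using h)
  simp at this

theorem b_injective (β : LinkPattern N) : Function.Injective β.b := fun r s h => by
  have := @β.inj (r, true) (s, true) (by simpa using h)
  simpa using this

theorem a_mem (β : LinkPattern N) (r : Fin N) : 1 ≤ β.a r ∧ β.a r ≤ 2 * N :=
  (β.cover _).1 ⟨(r, false), by simp⟩

theorem linked_symm (β : LinkPattern N) {p q : ℕ} (h : β.Linked p q) : β.Linked q p := by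
  obtain ⟨r, h | h⟩ := h
  · exact ⟨r, Or.inr h⟩
  · exact ⟨r, Or.inl h⟩

theorem linked_unique (β : LinkPattern N) {p q q' : ℕ} (h : β.Linked p q) (h' : β.Linked p q') :
    q = q' := by
  obtain ⟨r, ⟨rfl, rfl⟩ | ⟨rfl, rfl⟩⟩ := h <;> obtain ⟨s, ⟨h1, rfl⟩ | ⟨rfl, h1⟩⟩ := h'
  · rw [β.a_mono.injective h1]
  · exact absurd h1.symm (β.a_ne_b r s)
  · exact absurd h1 (β.a_ne_b s r)
  · rw [β.b_injective h1]

theorem exists_linked_iff (β : LinkPattern N) {p : ℕ} :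
    (∃ q, β.Linked p q) ↔ 1 ≤ p ∧ p ≤ 2 * N := by
  rw [← β.cover p]
  constructor
  · rintro ⟨q, r, ⟨h, -⟩ | ⟨-, h⟩⟩
    · exact ⟨(r, false), by simpa using h⟩
    · exact ⟨(r, true), by simpa using h⟩
  · rintro ⟨⟨r, c⟩, h⟩
    cases c with
    | false => exact ⟨β.b r, r, Or.inl ⟨by simpa using h, rfl⟩⟩
    | true => exact ⟨β.a r, r, Or.inr ⟨rfl, by simpa using h⟩⟩

open Classical in
/-- The partner of a point in a link pattern. -/
noncomputable def partner (β : LinkPattern N) (p : ℕ) : ℕ :=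
  if h : ∃ q, β.Linked p q then h.choose else p

theorem linked_partner (β : LinkPattern N) {p : ℕ} (hp : 1 ≤ p ∧ p ≤ 2 * N) :
    β.Linked p (β.partner p) := by
  have h := β.exists_linked_iff.2 hp
  rw [partner, dif_pos h]
  exact h.choose_spec

theorem partner_of_linked (β : LinkPattern N) {p q : ℕ} (h : β.Linked p q) : β.partner p = q :=
  β.linked_unique (β.linked_partner (β.exists_linked_iff.1 ⟨q, h⟩)) h

theorem partner_of_not_mem (β : LinkPattern N) {p : ℕ} (hp : ¬ (1 ≤ p ∧ p ≤ 2 * N)) :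
    β.partner p = p := dif_neg (mt β.exists_linked_iff.1 hp)

theorem partner_a (β : LinkPattern N) (r : Fin N) : β.partner (β.a r) = β.b r :=
  β.partner_of_linked ⟨r, Or.inl ⟨rfl, rfl⟩⟩

theorem exists_of_lt_partner (β : LinkPattern N) {p : ℕ} (h : p < β.partner p) :
    ∃ r, β.a r = p ∧ β.b r = β.partner p := by
  have hp : 1 ≤ p ∧ p ≤ 2 * N := by
    by_contra hp
    rw [β.partner_of_not_mem hp] at h
    exact lt_irrefl _ h
  obtain ⟨r, h1 | h1⟩ := β.linked_partner hp
  · exact ⟨r, h1⟩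
  · have := β.a_lt_b r
    omega

/-- The involution attached to a link pattern. -/
noncomputable def toNCInv (β : LinkPattern N) : NCInv N where
  toFun := β.partner
  invol p := by
    by_cases hp : 1 ≤ p ∧ p ≤ 2 * N
    · exact β.partner_of_linked (β.linked_symm (β.linked_partner hp))
    · rw [β.partner_of_not_mem hp, β.partner_of_not_mem hp]
  fixed p := by
    constructor
    · exact fun h => by_contra fun hp => h (β.partner_of_not_mem hp)
    · intro hp h
      obtain ⟨r, h1 | h1⟩ := β.linked_partner hp <;>
      · have := β.a_lt_b r
        omega
  nc p q h1 h2 h3 := by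
    obtain ⟨r, hr, hr'⟩ := β.exists_of_lt_partner (h1.trans h2)
    obtain ⟨s, hs, hs'⟩ := β.exists_of_lt_partner (h2.trans h3)
    exact β.noncross r s ⟨by omega, by omega, by omega⟩

theorem toNCInv_apply (β : LinkPattern N) (p : ℕ) : β.toNCInv p = β.partner p := rfl

theorem openers_toNCInv (β : LinkPattern N) : β.toNCInv.openers = Finset.univ.image β.a := by
  ext p
  rw [NCInv.openers, Finset.mem_filter, Finset.mem_Icc, toNCInv_apply, Finset.mem_image]
  simp only [Finset.mem_univ, true_and]
  constructor
  · rintro ⟨-, h⟩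
    obtain ⟨r, hr, -⟩ := β.exists_of_lt_partner h
    exact ⟨r, hr⟩
  · rintro ⟨r, rfl⟩
    exact ⟨β.a_mem r, by rw [partner_a]; exact β.a_lt_b r⟩

theorem toNCInv_injective : Function.Injective (toNCInv : LinkPattern N → NCInv N) := by
  intro α β h
  have ha : α.a = β.a := by
    have h1 := congrArg NCInv.openers h
    rw [openers_toNCInv, openers_toNCInv] at h1
    have h2 : Finset.univ.map ⟨α.a, α.a_mono.injective⟩ =
        Finset.univ.map ⟨β.a, β.a_mono.injective⟩ := by
      rwa [Finset.map_eq_image, Finset.map_eq_image]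
    refine (α.a_mono.range_inj β.a_mono).1 ?_
    ext p
    simpa using Finset.ext_iff.1 h1 p
  have hb : α.b = β.b := by
    funext r
    rw [← partner_a, ← toNCInv_apply, h, toNCInv_apply, ha, partner_a]
  cases α
  cases β
  simp only at ha hb
  subst ha hb
  rfl

theorem toNCInv_surjective : Function.Surjective (toNCInv : LinkPattern N → NCInv N) := by
  intro π
  set a : Fin N → ℕ := fun r => π.openers.orderEmbOfFin π.card_openers r with ha
  have hmem : ∀ r, (1 ≤ a r ∧ a r ≤ 2 * N) ∧ a r < π (a r) := fun r => by
    have h := Finset.mem_filter.1 (Finset.orderEmbOfFin_mem π.openers π.card_openers r)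
    exact ⟨Finset.mem_Icc.1 h.1, h.2⟩
  have hmono : StrictMono a := (π.openers.orderEmbOfFin π.card_openers).strictMono
  have hne : ∀ r s, a r ≠ π (a s) := fun r s h => by
    have h1 := (hmem r).2
    have h2 := (hmem s).2
    rw [h, π.invol] at h1
    omega
  have hsurj : ∀ p, 1 ≤ p ∧ p ≤ 2 * N → p < π p → ∃ r, a r = p := fun p hp h => by
    have h1 : p ∈ Set.range (π.openers.orderEmbOfFin π.card_openers) := by
      rw [Finset.range_orderEmbOfFin]
      simp [NCInv.openers, hp, h]
    exact h1
  refine ⟨⟨a, fun r => π (a r), fun r => (hmem r).2, hmono, ?_, ?_, ?_⟩, ?_⟩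
  · rintro ⟨r, c⟩ ⟨s, d⟩ h
    cases c <;> cases d <;> simp only [Bool.false_eq_true, if_true, if_false] at h
    · rw [hmono.injective h]
    · exact absurd h (hne r s)
    · exact absurd h.symm (hne s r)
    · rw [hmono.injective (π.inj h)]
  · intro p
    constructor
    · rintro ⟨⟨r, c⟩, rfl⟩
      cases c
      · exact (hmem r).1
      · exact π.mem_range (hmem r).1
    · intro hp
      rcases lt_or_gt_of_ne ((π.fixed p).2 hp) with h | h
      · obtain ⟨r, hr⟩ := hsurj (π p) (π.mem_range hp) (by rwa [π.invol])
        exact ⟨(r, true), by simp [hr, π.invol]⟩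
      · obtain ⟨r, hr⟩ := hsurj p hp h
        exact ⟨(r, false), by simp [hr]⟩
  · exact fun r s h => π.nc _ _ h.1 h.2.1 h.2.2
  · refine NCInv.ext' fun p => ?_
    rw [toNCInv_apply]
    by_cases hp : 1 ≤ p ∧ p ≤ 2 * N
    · refine partner_of_linked _ ?_
      rcases lt_or_gt_of_ne ((π.fixed p).2 hp) with h | h
      · obtain ⟨r, hr⟩ := hsurj (π p) (π.mem_range hp) (by rwa [π.invol])
        exact ⟨r, Or.inr ⟨hr, by simp [hr, π.invol]⟩⟩
      · obtain ⟨r, hr⟩ := hsurj p hp h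
        exact ⟨r, Or.inl ⟨hr, by simp [hr]⟩⟩
    · rw [partner_of_not_mem _ hp]
      exact (by_contra fun h => hp ((π.fixed p).1 fun h' => h h'.symm))

/-- Link patterns are the same as noncrossing involutions. -/
noncomputable def equivNCInv : LinkPattern N ≃ NCInv N :=
  Equiv.ofBijective toNCInv ⟨toNCInv_injective, toNCInv_surjective⟩

theorem meanderOne_iff_conn (α β : LinkPattern N) :
    MeanderOne N α β ↔ α.toNCInv.Conn β.toNCInv := by
  constructor
  · rintro h S hS ⟨p, hp, hp1, hp2⟩ q hq1 hq2
    have h1 := h p q hp1 hp2 hq1 hq2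
    clear hq1 hq2
    induction h1 with
    | refl => exact hp
    | tail _ hl ih =>
      rcases hl with hl | hl
      · rw [← α.partner_of_linked hl]
        exact (hS _ ih).1
      · rw [← β.partner_of_linked hl]
        exact (hS _ ih).2
  · intro h p q hp1 hp2 hq1 hq2
    refine h {q | Relation.ReflTransGen (fun u v => α.Linked u v ∨ β.Linked u v) p q} ?_
      ⟨p, Relation.ReflTransGen.refl, hp1, hp2⟩ q hq1 hq2
    intro u hu
    by_cases hu' : 1 ≤ u ∧ u ≤ 2 * N
    · exact ⟨hu.tail (Or.inl (α.linked_partner hu')), hu.tail (Or.inr (β.linked_partner hu'))⟩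
    · refine ⟨?_, ?_⟩
      · rw [toNCInv_apply, partner_of_not_mem _ hu']
        exact hu
      · rw [toNCInv_apply, partner_of_not_mem _ hu']
        exact hu

end LinkPattern

theorem NCInv.two_mul_card_openers_Ioc {N : ℕ} (π : NCInv N) {x y : ℕ} (hxy : x ≤ y) (hy : y ≤ 2 * N)
    (h : π.cov x = π.cov y) :
    2 * ((Finset.Ioc x y).filter fun z => z < π z).card = y - x := by
  have hst : ∀ z, x < z → z ≤ y → x < π z ∧ π z ≤ y ∧ π z ≠ z := fun z h1 h2 => by
    have h3 := π.cov_eq_iff.1 h z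
    have h4 := (π.fixed z).2 (by omega)
    unfold NCInv.Covers at h3
    omega
  have h1 : ((Finset.Ioc x y).filter fun z => ¬ z < π z).card =
      ((Finset.Ioc x y).filter fun z => z < π z).card := by
    refine Finset.card_nbij' π π ?_ ?_ (fun x _ => π.invol x) (fun x _ => π.invol x)
    · intro z hz
      simp only [Finset.coe_filter, Finset.mem_Ioc, Set.mem_ofPred_eq] at hz ⊢
      have := hst z hz.1.1 hz.1.2
      rw [π.invol]
      omega
    · intro z hz
      simp only [Finset.coe_filter, Finset.mem_Ioc, Set.mem_ofPred_eq] at hz ⊢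
      have := hst z hz.1.1 hz.1.2
      rw [π.invol]
      omega
  have h2 := Finset.card_filter_add_card_filter_not (s := Finset.Ioc x y) (fun z => z < π z)
  rw [h1, Nat.card_Ioc] at h2
  omega

namespace LinkPattern

variable {N : ℕ}

theorem mem_cov_iff (β : LinkPattern N) (r : Fin N) (x : ℕ) :
    β.a r ∈ β.toNCInv.cov x ↔ β.a r ≤ x ∧ x < β.b r := by
  have := β.a_lt_b r
  change ((β.a r ≤ x ∧ x < β.partner (β.a r)) ∨ (β.partner (β.a r) ≤ x ∧ x < β.a r)) ↔ _
  rw [partner_a]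
  omega

open Classical in
/-- The incidence matrix between gaps and links. -/
noncomputable def incidence (β : LinkPattern N) (k : Fin N → ℕ) : Matrix (Fin N) (Fin N) ℂ :=
  Matrix.of fun s r => if β.a r ∈ β.toNCInv.cov (k s) then 1 else 0

theorem linkCoeff_eq_det (β : LinkPattern N) (k : Fin N → ℕ) : linkCoeff N β k =
    Complex.I ^ ((∑ r, (k r : ℤ)) - ∑ r, (β.a r : ℤ)) * (β.incidence k).det := by
  rw [linkCoeff, Matrix.det_apply']
  congr 1
  refine Finset.sum_congr rfl fun σ _ => ?_
  congr 1
  refine Finset.prod_congr rfl fun r _ => ?_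
  rw [incidence, Matrix.of_apply]
  simp only [mem_cov_iff]

theorem det_incidence_a (β : LinkPattern N) : (β.incidence β.a).det = 1 := by
  rw [Matrix.det_of_isLowerTriangular]
  · refine Finset.prod_eq_one fun r _ => ?_
    rw [incidence, Matrix.of_apply, if_pos]
    exact (β.mem_cov_iff r _).2 ⟨le_rfl, β.a_lt_b r⟩
  · intro s r hsr
    rw [incidence, Matrix.of_apply, if_neg]
    intro h
    have h1 : s < r := OrderDual.toDual_lt_toDual.1 hsr
    exact absurd ((β.mem_cov_iff r _).1 h).1 (not_le.2 (β.a_mono h1))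

theorem det_incidence_of_cov_eq (β : LinkPattern N) {k : Fin N → ℕ} {s t : Fin N} (hst : s ≠ t)
    (h : β.toNCInv.cov (k s) = β.toNCInv.cov (k t)) : (β.incidence k).det = 0 := by
  refine Matrix.det_zero_of_row_eq hst ?_
  funext r
  simp only [incidence, Matrix.of_apply]
  rw [h]

theorem det_incidence_of_cov_eq_zero (β : LinkPattern N) {k : Fin N → ℕ} {s : Fin N}
    (h : β.toNCInv.cov (k s) = β.toNCInv.cov 0) : (β.incidence k).det = 0 := by
  refine Matrix.det_eq_zero_of_row_eq_zero s fun r => ?_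
  simp [incidence, h, NCInv.cov_zero]

theorem det_incidence_of_not_sep (β : LinkPattern N) {k : Fin N → ℕ}
    (h : ¬ β.toNCInv.Sep (insert 0 (Finset.univ.image k))) : (β.incidence k).det = 0 := by
  rw [NCInv.Sep, Set.InjOn] at h
  push Not at h
  obtain ⟨x, hx, y, hy, hxy, hne⟩ := h
  simp only [Finset.coe_insert, Finset.coe_image, Finset.coe_univ, Set.image_univ,
    Set.mem_insert_iff, Set.mem_range] at hx hy
  rcases hx with rfl | ⟨s, rfl⟩ <;> rcases hy with rfl | ⟨t, rfl⟩
  · exact absurd rfl hne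
  · exact β.det_incidence_of_cov_eq_zero hxy.symm
  · exact β.det_incidence_of_cov_eq_zero hxy
  · exact β.det_incidence_of_cov_eq (fun h => hne (by rw [h])) hxy

theorem exists_perm_of_sep (β : LinkPattern N) {k : Fin N → ℕ} (hk : StrictMono k)
    (hk0 : ∀ r, k r ≠ 0) (h : β.toNCInv.Sep (insert 0 (Finset.univ.image k))) :
    ∃ τ : Equiv.Perm (Fin N), ∀ s, β.toNCInv.cov (β.a (τ s)) = β.toNCInv.cov (k s) ∧
      β.a (τ s) ≤ k s := by
  have hmem : ∀ s, k s ∈ insert 0 (Finset.univ.image k) := fun s => by simp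
  have h1 : ∀ s, ∃ t, β.toNCInv.cov (β.a t) = β.toNCInv.cov (k s) ∧ β.a t ≤ k s := by
    intro s
    obtain ⟨o, ho, h2, h3⟩ := β.toNCInv.exists_opener (k s)
    rw [Finset.mem_insert, openers_toNCInv, Finset.mem_image] at ho
    rcases ho with rfl | ⟨t, -, rfl⟩
    · exact absurd (h (by simp) (hmem s) h2).symm (hk0 s)
    · exact ⟨t, h2, h3⟩
  choose τ hτ using h1
  have hinj : Function.Injective τ := fun s t hst => by
    refine hk.injective (h (hmem s) (hmem t) ?_)
    rw [← (hτ s).1, ← (hτ t).1, hst]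
  exact ⟨Equiv.ofBijective τ (Finite.injective_iff_bijective.1 hinj), hτ⟩

theorem card_inversions (β : LinkPattern N) {k : Fin N → ℕ} (hk : StrictMono k)
    (hk' : ∀ r, k r ≤ 2 * N) {τ : Equiv.Perm (Fin N)}
    (hτ : ∀ s, β.toNCInv.cov (β.a (τ s)) = β.toNCInv.cov (k s) ∧ β.a (τ s) ≤ k s) (s : Fin N) :
    2 * ((Finset.Iio s).filter fun t => ¬ τ t < τ s).card = k s - β.a (τ s) := by
  rw [← β.toNCInv.two_mul_card_openers_Ioc (hτ s).2 (hk' s) (hτ s).1]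
  congr 1
  refine Finset.card_bij (fun t _ => β.a (τ t)) ?_ ?_ ?_
  · intro t ht
    rw [Finset.mem_filter, Finset.mem_Iio] at ht
    rw [Finset.mem_filter, Finset.mem_Ioc, toNCInv_apply, partner_a]
    refine ⟨⟨β.a_mono (lt_of_le_of_ne (not_lt.1 ht.2) fun h => ht.1.ne (τ.injective h.symm)),
      (hτ t).2.trans (hk ht.1).le⟩, β.a_lt_b _⟩
  · intro t _ u _ h
    exact τ.injective (β.a_mono.injective h)
  · intro z hz
    rw [Finset.mem_filter, Finset.mem_Ioc, toNCInv_apply] at hz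
    obtain ⟨r, rfl, hr⟩ := β.exists_of_lt_partner hz.2
    obtain ⟨t, rfl⟩ := τ.surjective r
    refine ⟨t, ?_, rfl⟩
    rw [Finset.mem_filter, Finset.mem_Iio]
    refine ⟨hk.lt_iff_lt.1 ?_, not_lt.2 (β.a_mono.lt_iff_lt.1 hz.1.1).le⟩
    have h1 : β.a (τ t) ∈ β.toNCInv.cov (k t) := by
      rw [← (hτ t).1, mem_cov_iff]
      exact ⟨le_rfl, β.a_lt_b _⟩
    have h2 : β.a (τ t) ∉ β.toNCInv.cov (k s) := by
      rw [← (hτ s).1, mem_cov_iff]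
      omega
    rw [mem_cov_iff] at h1 h2
    omega

theorem linkCoeff_eq_ind (β : LinkPattern N) {k : Fin N → ℕ} (hk : StrictMono k)
    (hk' : ∀ r, 1 ≤ k r ∧ k r ≤ 2 * N) :
    linkCoeff N β k = (β.toNCInv.ind (insert 0 (Finset.univ.image k)) : ℂ) := by
  rw [linkCoeff_eq_det]
  by_cases h : β.toNCInv.Sep (insert 0 (Finset.univ.image k))
  swap
  · rw [β.det_incidence_of_not_sep h, NCInv.ind_of_not_sep _ h]
    simp
  obtain ⟨τ, hτ⟩ := β.exists_perm_of_sep hk (fun r => by have := hk' r; omega) h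
  have hdet : (β.incidence k).det = ((Equiv.Perm.sign τ : ℤ) : ℂ) := by
    have : β.incidence k = (β.incidence β.a).submatrix τ id := by
      ext s r
      simp only [incidence, Matrix.of_apply, Matrix.submatrix_apply, id]
      rw [(hτ s).1]
    rw [this, Matrix.det_permute, det_incidence_a, mul_one]
  set m : Fin N → ℕ := fun s => ((Finset.Iio s).filter fun t => ¬ τ t < τ s).card with hm
  have hmk : ∀ s, (k s : ℤ) - β.a (τ s) = 2 * m s := fun s => by
    have h1 := β.card_inversions hk (fun r => (hk' r).2) hτ s
    have h2 := (hτ s).2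
    change (k s : ℤ) - β.a (τ s) =
      2 * (((Finset.Iio s).filter fun t => ¬ τ t < τ s).card : ℤ)
    omega
  have hexp : (∑ r, (k r : ℤ)) - ∑ r, (β.a r : ℤ) = ((2 * ∑ s, m s : ℕ) : ℤ) := by
    rw [← Equiv.sum_comp τ fun r => (β.a r : ℤ), ← Finset.sum_sub_distrib,
      Finset.sum_congr rfl fun s _ => hmk s, ← Finset.mul_sum]
    push_cast
    rfl
  have hsign : ((Equiv.Perm.sign τ : ℤ) : ℂ) = (-1) ^ ∑ s, m s := by
    rw [Equiv.Perm.sign_eq_prod_prod_Iio, Finset.prod_congr rfl fun j _ => by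
      rw [Finset.prod_ite, Finset.prod_const_one, one_mul, Finset.prod_const],
      Finset.prod_pow_eq_pow_sum]
    simp [hm]
  rw [hexp, zpow_natCast, hdet, hsign, pow_mul, Complex.I_sq, ← mul_pow, NCInv.ind_of_sep _ h]
  simp

end LinkPattern

section CauchyBinet

/-- The strictly increasing tuples with entries in `V`. -/
def increasing (d : ℕ) (V : Finset ℕ) : Finset (Fin d → ℕ) :=
  (Fintype.piFinset fun _ : Fin d => V).filter fun k => ∀ r s : Fin d, r < s → k r < k s

theorem mem_increasing {d : ℕ} {V : Finset ℕ} {k : Fin d → ℕ} :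
    k ∈ increasing d V ↔ (∀ r, k r ∈ V) ∧ StrictMono k := by
  rw [increasing, Finset.mem_filter, Fintype.mem_piFinset]
  exact and_congr_right fun _ => ⟨fun h r s hrs => h r s hrs, fun h r s hrs => h hrs⟩

theorem sum_increasing {R : Type*} [AddCommMonoid R] (d : ℕ) (V : Finset ℕ) (f : Finset ℕ → R) :
    ∑ k ∈ increasing d V, f (Finset.univ.image k) = ∑ K ∈ V.powersetCard d, f K := by
  refine Finset.sum_bij (fun k _ => Finset.univ.image k) ?_ ?_ ?_ fun _ _ => rfl
  · intro k hk
    rw [mem_increasing] at hk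
    rw [Finset.mem_powersetCard, Finset.card_image_of_injective _ hk.2.injective, Finset.card_fin]
    refine ⟨?_, rfl⟩
    intro z hz
    obtain ⟨r, -, rfl⟩ := Finset.mem_image.1 hz
    exact hk.1 r
  · intro k hk l hl h
    rw [mem_increasing] at hk hl
    refine (hk.2.range_inj hl.2).1 ?_
    ext p
    simpa using Finset.ext_iff.1 h p
  · intro K hK
    rw [Finset.mem_powersetCard] at hK
    refine ⟨K.orderEmbOfFin hK.2, ?_, ?_⟩
    · rw [mem_increasing]
      exact ⟨fun r => hK.1 (K.orderEmbOfFin_mem hK.2 r), (K.orderEmbOfFin hK.2).strictMono⟩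
    · ext z
      simp

theorem sum_injective_tuples {R : Type*} [AddCommMonoid R] (d : ℕ) (V : Finset ℕ)
    (F : (Fin d → ℕ) → R) (hF : ∀ l, ¬ Function.Injective l → F l = 0) :
    ∑ l ∈ Fintype.piFinset fun _ : Fin d => V, F l =
      ∑ k ∈ increasing d V, ∑ σ : Equiv.Perm (Fin d), F (k ∘ σ) := by
  classical
  rw [← Finset.sum_filter_of_ne (p := Function.Injective)
    fun l _ h => by_contra fun h' => h (hF l h'), ← Finset.sum_product']
  symm
  refine Finset.sum_bij (fun p _ => p.1 ∘ p.2) ?_ ?_ ?_ fun _ _ => rfl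
  · intro p hp
    rw [Finset.mem_product, mem_increasing] at hp
    rw [Finset.mem_filter, Fintype.mem_piFinset]
    exact ⟨fun r => hp.1.1 _, hp.1.2.injective.comp p.2.injective⟩
  · rintro ⟨k, σ⟩ hp ⟨l, τ⟩ hq h
    rw [Finset.mem_product, mem_increasing] at hp hq
    simp only at h hp hq
    have hkl : k = l := by
      refine (hp.1.2.range_inj hq.1.2).1 ?_
      rw [← σ.surjective.range_comp k, ← τ.surjective.range_comp l, h]
    subst hkl
    congr 1
    ext r
    rw [hp.1.2.injective (congrFun h r)]
  · intro l hl
    rw [Finset.mem_filter, Fintype.mem_piFinset] at hl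
    refine ⟨(l ∘ Tuple.sort l, (Tuple.sort l)⁻¹), ?_, ?_⟩
    · rw [Finset.mem_product, mem_increasing]
      exact ⟨⟨fun r => hl.1 _, (Tuple.monotone_sort l).strictMono_of_injective
        (hl.2.comp (Tuple.sort l).injective)⟩, Finset.mem_univ _⟩
    · ext r
      simp

/-- The Cauchy–Binet formula. -/
theorem det_sum_mul {R : Type*} [CommRing R] {d : ℕ} (V : Finset ℕ) (M : Fin d → ℕ → R)
    (B : ℕ → Fin d → R) :
    (Matrix.of fun r j => ∑ k ∈ V, M r k * B k j).det =
      ∑ k ∈ increasing d V, (∑ σ : Equiv.Perm (Fin d),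
        ((Equiv.Perm.sign σ : ℤ) : R) * ∏ r, M r (k (σ r))) *
          (Matrix.of fun r j => B (k r) j).det := by
  have h1 : (Matrix.of fun r j => ∑ k ∈ V, M r k * B k j).det =
      ∑ l ∈ Fintype.piFinset fun _ : Fin d => V,
        (∏ r, M r (l r)) * (Matrix.of fun r j => B (l r) j).det := by
    have h2 := (Matrix.detRowAlternating (n := Fin d) (R := R)).toMultilinearMap.map_sum_finset
      (fun r k => M r k • B k) (fun _ => V)
    have h3 : (Matrix.of fun r j => ∑ k ∈ V, M r k * B k j) =
        fun r => ∑ k ∈ V, M r k • B k := by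
      ext r j
      simp
    rw [h3]
    refine h2.trans (Finset.sum_congr rfl fun l _ => ?_)
    exact (Matrix.detRowAlternating (n := Fin d) (R := R)).toMultilinearMap.map_smul_univ
      (fun r => M r (l r)) (fun r => B (l r))
  rw [h1, sum_injective_tuples]
  · refine Finset.sum_congr rfl fun k _ => ?_
    rw [Finset.sum_mul]
    refine Finset.sum_congr rfl fun σ _ => ?_
    have : (Matrix.of fun r j => B ((k ∘ σ) r) j) =
        (Matrix.of fun r j => B (k r) j).submatrix σ id := rfl
    rw [this, Matrix.det_permute]
    simp only [Function.comp_apply]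
    ring
  · intro l hl
    rw [Function.Injective] at hl
    push Not at hl
    obtain ⟨r, s, h, hrs⟩ := hl
    rw [Matrix.det_zero_of_row_eq hrs (by funext j; simp [h]), mul_zero]

end CauchyBinet

namespace LinkPattern

variable {N : ℕ}

theorem neg_one_pow_b (β : LinkPattern N) (r : Fin N) : (-1 : ℂ) ^ β.b r = -(-1) ^ β.a r := by
  have h1 := β.a_lt_b r
  have h2 : Odd (β.a r + β.b r) := by
    have := β.toNCInv.odd_partner (k := β.a r) (by rw [toNCInv_apply, partner_a]; omega)
    rwa [toNCInv_apply, partner_a] at this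
  have h3 : (-1 : ℂ) ^ β.a r * (-1) ^ β.b r = -1 := by rw [← pow_add, h2.neg_one_pow]
  have h4 : (-1 : ℂ) ^ β.a r * (-1) ^ β.a r = 1 := by rw [← mul_pow]; simp
  linear_combination (-1 : ℂ) ^ β.a r * h3 - (-1) ^ β.b r * h4

theorem sum_points {R : Type*} [AddCommMonoid R] (β : LinkPattern N) (f : ℕ → R) :
    ∑ p ∈ Finset.Icc 1 (2 * N), f p = ∑ r, (f (β.a r) + f (β.b r)) := by
  have h1 : Finset.Icc 1 (2 * N) =
      Finset.univ.image fun p : Fin N × Bool => if p.2 then β.b p.1 else β.a p.1 := by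
    ext p
    rw [Finset.mem_Icc, ← β.cover p]
    simp only [Finset.mem_image, Finset.mem_univ, true_and]
  rw [h1, Finset.sum_image fun p _ q _ h => β.inj h, Fintype.sum_prod_type]
  refine Finset.sum_congr rfl fun r _ => ?_
  rw [Fintype.sum_bool, add_comm]
  rfl

theorem sum_Icc_neg_one_pow (k : ℕ) :
    ∑ p ∈ Finset.Icc 1 k, (-1 : ℂ) ^ p = if Odd k then -1 else 0 := by
  induction k with
  | zero => simp
  | succ k ih =>
    rw [Finset.sum_Icc_succ_top (by omega), ih]
    by_cases h : Odd k
    · rw [if_pos h, if_neg (Nat.not_odd_iff_even.2 h.add_one), h.add_one.neg_one_pow]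
      norm_num
    · have h' : Odd (k + 1) := (Nat.not_odd_iff_even.1 h).add_one
      rw [if_neg h, if_pos h', h'.neg_one_pow, zero_add]

theorem sum_covering (β : LinkPattern N) {k : ℕ} (hk : k ≤ 2 * N) :
    ∑ r, (-1 : ℂ) ^ β.a r * (if β.a r ≤ k ∧ k < β.b r then 1 else 0) =
      if Odd k then -1 else 0 := by
  rw [← sum_Icc_neg_one_pow]
  have h1 : ∑ p ∈ Finset.Icc 1 k, (-1 : ℂ) ^ p =
      ∑ p ∈ Finset.Icc 1 (2 * N), if p ≤ k then (-1 : ℂ) ^ p else 0 := by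
    rw [← Finset.sum_filter]
    refine Finset.sum_congr ?_ fun _ _ => rfl
    ext p
    rw [Finset.mem_filter, Finset.mem_Icc, Finset.mem_Icc]
    omega
  rw [h1, β.sum_points]
  refine Finset.sum_congr rfl fun r _ => ?_
  have h2 := β.a_lt_b r
  rw [neg_one_pow_b]
  by_cases h3 : β.a r ≤ k
  · by_cases h4 : β.b r ≤ k
    · rw [if_neg (by omega), if_pos h3, if_pos h4]
      ring
    · rw [if_pos (by omega), if_pos h3, if_neg h4]
      ring
  · rw [if_neg (by omega), if_neg h3, if_neg (by omega)]
    ring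

/-- The coefficients of the system of vectors attached to the links of `β`. -/
noncomputable def linkRow (β : LinkPattern N) (r : Fin N) (k : ℕ) : ℂ :=
  Complex.I ^ ((k : ℤ) - β.a r) * if β.a r ≤ k ∧ k < β.b r then 1 else 0

theorem I_zpow_sum {ι : Type*} (s : Finset ι) (f : ι → ℤ) :
    Complex.I ^ ∑ r ∈ s, f r = ∏ r ∈ s, Complex.I ^ f r := by
  classical
  induction s using Finset.induction_on with
  | empty => simp
  | insert a s ha ih =>
    rw [Finset.sum_insert ha, Finset.prod_insert ha, zpow_add₀ Complex.I_ne_zero, ih]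

theorem linkCoeff_eq_sum (β : LinkPattern N) (k : Fin N → ℕ) : linkCoeff N β k =
    ∑ σ : Equiv.Perm (Fin N), ((Equiv.Perm.sign σ : ℤ) : ℂ) * ∏ r, β.linkRow r (k (σ r)) := by
  rw [linkCoeff, Finset.mul_sum]
  refine Finset.sum_congr rfl fun σ _ => ?_
  simp only [linkRow]
  rw [Finset.prod_mul_distrib, ← I_zpow_sum, Finset.sum_sub_distrib,
    Equiv.sum_comp σ fun r => (k r : ℤ)]
  ring

theorem sum_mul_linkRow (β : LinkPattern N) {k : ℕ} (hk : k ≤ 2 * N) :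
    ∑ r, (Complex.I ^ (β.a r : ℤ) * (-1) ^ β.a r) * β.linkRow r k =
      if Odd k then -Complex.I ^ k else 0 := by
  have h := β.sum_covering hk
  have h1 : ∀ r, (Complex.I ^ (β.a r : ℤ) * (-1) ^ β.a r) * β.linkRow r k =
      Complex.I ^ k * ((-1 : ℂ) ^ β.a r * (if β.a r ≤ k ∧ k < β.b r then 1 else 0)) := fun r => by
    have : Complex.I ^ k = Complex.I ^ (β.a r : ℤ) * Complex.I ^ ((k : ℤ) - β.a r) := by
      rw [← zpow_add₀ Complex.I_ne_zero, ← zpow_natCast]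
      congr 1
      ring
    rw [linkRow, this]
    ring
  rw [Finset.sum_congr rfl fun r _ => h1 r, ← Finset.mul_sum, h]
  split_ifs <;> simp

end LinkPattern

section Screened

variable {n : ℕ}

theorem screened_eq_sum_linkCoeff (β : LinkPattern (n + 1)) (B : ℕ → Fin (n + 1) → ℝ) :
    ((screened β.toNCInv Matrix.detRowAlternating B : ℝ) : ℂ) =
      ∑ k ∈ increasing (n + 1) (Finset.Icc 1 (2 * n + 1)), linkCoeff (n + 1) β k *
        (((Matrix.of fun r j => B (k r) j).det : ℝ) : ℂ) := by
  rw [screened, ← sum_increasing, Complex.ofReal_sum]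
  refine Finset.sum_congr rfl fun k hk => ?_
  rw [mem_increasing] at hk
  rw [minor_eq_of_strictMono _ _ hk.2, β.linkCoeff_eq_ind hk.2 fun r => by
    have := Finset.mem_Icc.1 (hk.1 r)
    omega, Complex.ofReal_mul]
  rfl

theorem screened_eq_zero_of_alternating (β : LinkPattern (n + 1)) {B : ℕ → Fin (n + 1) → ℝ}
    (hB : ∀ j, ∑ m ∈ Finset.range (n + 1), (-1) ^ m * B (2 * m + 1) j = 0) :
    screened β.toNCInv Matrix.detRowAlternating B = 0 := by
  rw [← Complex.ofReal_eq_zero, screened_eq_sum_linkCoeff]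
  have h1 : ∀ k : Fin (n + 1) → ℕ, (((Matrix.of fun r j => B (k r) j).det : ℝ) : ℂ) =
      (Matrix.of fun r j => (B (k r) j : ℂ)).det := fun k =>
    Complex.ofRealHom.map_det _
  simp only [h1, LinkPattern.linkCoeff_eq_sum]
  rw [← det_sum_mul (Finset.Icc 1 (2 * n + 1)) β.linkRow fun k j => (B k j : ℂ),
    ← Matrix.exists_vecMul_eq_zero_iff]
  refine ⟨fun r => Complex.I ^ (β.a r : ℤ) * (-1) ^ β.a r, fun h => ?_, ?_⟩
  · have := congrFun h 0
    simp [Complex.I_ne_zero] at this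
  · funext j
    have h2 : ∑ k ∈ Finset.Icc 1 (2 * n + 1), (if Odd k then -Complex.I ^ k else 0) * (B k j : ℂ) =
        0 := by
      rw [Finset.sum_subset (s₂ := Finset.range (2 * (n + 1) + 1)), sum_range_parity,
        Finset.sum_eq_zero (s := Finset.range (n + 1 + 1)), zero_add]
      · have h3 := congrArg (fun t : ℝ => -Complex.I * (t : ℂ)) (hB j)
        simp only [Complex.ofReal_sum, Complex.ofReal_zero, mul_zero, Finset.mul_sum] at h3
        rw [← h3]
        refine Finset.sum_congr rfl fun m _ => ?_
        rw [if_pos ⟨m, rfl⟩, pow_succ, pow_mul, Complex.I_sq]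
        push_cast
        ring
      · intro m _
        rw [if_neg (by simp), zero_mul]
      · intro k hk
        rw [Finset.mem_Icc] at hk
        rw [Finset.mem_range]
        omega
      · intro k hk hk'
        rw [Finset.mem_range] at hk
        rw [Finset.mem_Icc] at hk'
        rw [if_neg (fun ⟨m, hm⟩ => by omega), zero_mul]
    rw [Pi.zero_apply, ← h2]
    simp only [Matrix.vecMul, dotProduct, Matrix.of_apply, Finset.mul_sum]
    rw [Finset.sum_comm]
    refine Finset.sum_congr rfl fun k hk => ?_
    rw [← β.sum_mul_linkRow (by have := Finset.mem_Icc.1 hk; omega), Finset.sum_mul]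
    simp only [mul_assoc]

end Screened

section Positivity

variable {n : ℕ} {x : ℕ → ℝ}

/-- The vectors of moments over the gaps. -/
noncomputable def gapVector (n : ℕ) (x : ℕ → ℝ) (k : ℕ) (j : Fin (n + 1)) : ℝ :=
  gapMoment (n + 1) x k j

theorem det_gapVector_pos (hx : IsChamber (n + 1) x) {k : Fin (n + 1) → ℕ} (hk : StrictMono k)
    (hk' : ∀ r, k r ∈ Finset.Icc 1 (2 * n + 1)) :
    0 < Matrix.detRowAlternating fun r => gapVector n x (k r) := by
  have h : ∀ r, 1 ≤ k r ∧ k r ≤ 2 * n + 1 := fun r => Finset.mem_Icc.1 (hk' r)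
  exact det_gapMoment_pos_of_integrableOn hx hk (fun r => by have := h r; omega) fun r j _ =>
    integrableOn_gap hx (h r).1 (by have := h r; omega) j

theorem screened_gapVector_pos (hx : IsChamber (n + 1) x) (β : NCInv (n + 1)) :
    0 < screened β Matrix.detRowAlternating (gapVector n x) := by
  have hpos : ∀ K ∈ (Finset.Icc 1 (2 * n + 1)).powersetCard (n + 1),
      0 < minor Matrix.detRowAlternating (gapVector n x) K := fun K hK => by
    rw [Finset.mem_powersetCard] at hK
    rw [minor, dif_pos hK.2]
    exact det_gapVector_pos hx (K.orderEmbOfFin hK.2).strictMono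
      fun r => hK.1 (K.orderEmbOfFin_mem hK.2 r)
  refine Finset.sum_pos' (fun K hK => mul_nonneg (β.ind_nonneg _) (hpos K hK).le)
    ⟨β.openers, ?_, ?_⟩
  · rw [Finset.mem_powersetCard]
    refine ⟨fun z hz => ?_, β.card_openers⟩
    obtain ⟨h1, h2⟩ := Finset.mem_filter.1 hz
    have h3 := Finset.mem_Icc.1 h1
    have h4 := β.mem_range h3
    rw [Finset.mem_Icc]
    omega
  · rw [β.ind_openers, one_mul]
    refine hpos _ ?_
    rw [Finset.mem_powersetCard]
    refine ⟨fun z hz => ?_, β.card_openers⟩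
    obtain ⟨h1, h2⟩ := Finset.mem_filter.1 hz
    have h3 := Finset.mem_Icc.1 h1
    have h4 := β.mem_range h3
    rw [Finset.mem_Icc]
    omega

/-- The constant relating the Coulomb gas integrals to the minor system of moments. -/
noncomputable def lastMoment (n : ℕ) (x : ℕ → ℝ) : ℝ :=
  ∑ m ∈ Finset.range (n + 1), (-1) ^ m * gapMoment (n + 1) x (2 * m + 1) n

theorem minor_add_smul_last {d : ℕ} {A C D : ℕ → Fin (d + 1) → ℝ} {c : ℝ} {J : Finset ℕ}
    (hC : ∀ k ∈ J, ∀ p : Fin d, C k p.castSucc = A k p.castSucc)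
    (hD : ∀ k ∈ J, ∀ p : Fin d, D k p.castSucc = A k p.castSucc)
    (hl : ∀ k ∈ J, A k (Fin.last d) = D k (Fin.last d) + c * C k (Fin.last d)) :
    minor Matrix.detRowAlternating A J =
      minor Matrix.detRowAlternating D J + c * minor Matrix.detRowAlternating C J := by
  by_cases h : J.card = d + 1
  swap
  · simp [minor_of_card_ne _ _ h]
  have hmem : ∀ r, J.orderEmbOfFin h r ∈ J := J.orderEmbOfFin_mem h
  rw [minor, minor, minor, dif_pos h, dif_pos h, dif_pos h]
  set M : Matrix (Fin (d + 1)) (Fin (d + 1)) ℝ := fun r => A (J.orderEmbOfFin h r) with hM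
  have hsame : ∀ E : ℕ → Fin (d + 1) → ℝ, (∀ k ∈ J, ∀ p : Fin d, E k p.castSucc = A k p.castSucc) →
      (fun r => E (J.orderEmbOfFin h r)) =
        M.updateCol (Fin.last d) fun r => E (J.orderEmbOfFin h r) (Fin.last d) := by
    intro E hE
    ext r j
    induction j using Fin.lastCases with
    | last => rw [Matrix.updateCol_self]
    | cast p => rw [Matrix.updateCol_ne (Fin.castSucc_lt_last p).ne, hE _ (hmem r)]
  change M.det = Matrix.det (fun r => D (J.orderEmbOfFin h r)) +
    c * Matrix.det (fun r => C (J.orderEmbOfFin h r))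
  rw [hsame D hD, hsame C hC, ← Matrix.det_updateCol_smul, ← Matrix.det_updateCol_add]
  congr 1
  refine (hsame A fun _ _ _ => rfl).trans ?_
  congr 1
  funext r
  exact hl _ (hmem r)

theorem screened_gapVector (hx : IsChamber (n + 1) x) (β : LinkPattern (n + 1)) :
    screened β.toNCInv Matrix.detRowAlternating (gapVector n x) = ((-1) ^ n * lastMoment n x) *
      screened β.toNCInv Matrix.detRowAlternating (col (momentSeq n x)) := by
  set c : ℝ := (-1) ^ n * lastMoment n x with hc
  set D : ℕ → Fin (n + 1) → ℝ := fun k => gapVector n x k -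
    Pi.single (Fin.last n) (if k = 2 * n + 1 then c else 0) with hD
  have hDc : ∀ k (p : Fin n), D k p.castSucc = gapVector n x k p.castSucc := fun k p => by
    rw [hD]
    simp [(Fin.castSucc_lt_last p).ne]
  have hDl : ∀ k, D k (Fin.last n) = gapVector n x k (Fin.last n) -
      if k = 2 * n + 1 then c else 0 := fun k => by
    rw [hD]
    simp
  have h0 : screened β.toNCInv Matrix.detRowAlternating D = 0 := by
    refine screened_eq_zero_of_alternating β fun j => ?_
    induction j using Fin.lastCases with
    | last =>
      simp only [hDl, mul_sub, Finset.sum_sub_distrib]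
      rw [Finset.sum_eq_single (s := Finset.range (n + 1)) (a := n)
        (f := fun m => (-1) ^ m * if 2 * m + 1 = 2 * n + 1 then c else 0)]
      · rw [if_pos rfl, hc, ← mul_assoc, ← mul_pow]
        simp [lastMoment, gapVector]
      · intro m _ hm
        rw [if_neg (by omega), mul_zero]
      · intro h
        simp at h
    | cast p =>
      simp only [hDc]
      exact (alternating_gapMoment hx p).2
  rw [← zero_add (c * _), ← h0, screened, screened, screened, Finset.mul_sum,
    ← Finset.sum_add_distrib]
  refine Finset.sum_congr rfl fun K hK => ?_
  have hK' : ∀ k ∈ K, 1 ≤ k ∧ k ≤ 2 * n + 1 := fun k hk =>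
    Finset.mem_Icc.1 ((Finset.mem_powersetCard.1 hK).1 hk)
  rw [minor_add_smul_last (A := gapVector n x) (C := col (momentSeq n x)) (D := D) (c := c)]
  · ring
  · intro k hk p
    rw [col_momentSeq_castSucc hx (hK' k hk).2,
      cyclicMoment_of_ne_zero (by have := hK' k hk; omega)]
    rfl
  · exact fun k _ p => hDc k p
  · intro k hk
    rw [hDl, col_momentSeq_last (hK' k hk).2]
    split_ifs <;> simp

theorem coulomb_eq (hx : IsChamber (n + 1) x) (β : LinkPattern (n + 1)) :
    coulomb (n + 1) β x = (((∏ p ∈ (Finset.Icc 1 (2 * (n + 1)) ×ˢ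
      Finset.Icc 1 (2 * (n + 1))).filter fun p => p.1 < p.2, (x p.2 - x p.1) ^ ((4 : ℝ)⁻¹)) *
        screened β.toNCInv Matrix.detRowAlternating (gapVector n x) : ℝ) : ℂ) := by
  rw [Complex.ofReal_mul, screened_eq_sum_linkCoeff, Finset.mul_sum]
  refine Finset.sum_congr rfl fun k hk => ?_
  have hk' := (mem_increasing.1 hk).1
  rw [rho_eq hx fun r => by
    have := Finset.mem_Icc.1 (hk' r)
    omega]
  simp only [gapVector]
  push_cast
  ring

open Classical in
theorem exists_pos_solution (hx : IsChamber (n + 1) x) (α₀ : LinkPattern (n + 1)) :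
    ∃ Y : NCInv (n + 1) → ℝ, (∀ α, 0 < Y α) ∧ ∀ β : LinkPattern (n + 1),
      coulomb (n + 1) β x = ((∑ α, if α.Conn β.toNCInv then Y α else 0 : ℝ) : ℂ) := by
  obtain ⟨Z, hZ, hZ'⟩ := (momentSystem hx).exists_solution
  set c : ℝ := (-1) ^ n * lastMoment n x with hc
  have hcpos : 0 < c := by
    have h1 := screened_gapVector_pos hx α₀.toNCInv
    rw [screened_gapVector hx] at h1
    refine pos_of_mul_pos_left h1 ?_
    have h2 := hZ' α₀.toNCInv
    refine le_of_le_of_eq ?_ h2.symm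
    refine Finset.sum_nonneg fun α _ => ?_
    split_ifs
    · exact (hZ α).le
    · exact le_rfl
  set w := ∏ p ∈ (Finset.Icc 1 (2 * (n + 1)) ×ˢ Finset.Icc 1 (2 * (n + 1))).filter
    fun p => p.1 < p.2, (x p.2 - x p.1) ^ ((4 : ℝ)⁻¹) with hw
  have hwpos : 0 < w := prefactor_pos hx
  refine ⟨fun α => w * c * Z α, fun α => mul_pos (mul_pos hwpos hcpos) (hZ α), fun β => ?_⟩
  rw [coulomb_eq hx, screened_gapVector hx]
  congr 1
  rw [← mul_assoc]
  refine (congrArg _ (hZ' β.toNCInv)).trans ?_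
  rw [Finset.mul_sum]
  refine Finset.sum_congr rfl fun α _ => ?_
  split_ifs
  · rfl
  · exact mul_zero _

end Positivity

theorem finsum_mem_meanderOne {N : ℕ} (f : LinkPattern N → ℂ) (β : LinkPattern N)
    [DecidablePred fun α : NCInv N => α.Conn β.toNCInv] :
    ∑ᶠ α ∈ {α : LinkPattern N | MeanderOne N α β}, f α =
      ∑ α : NCInv N, if α.Conn β.toNCInv then f (LinkPattern.equivNCInv.symm α) else 0 := by
  classical
  rw [finsum_mem_def, ← finsum_comp_equiv LinkPattern.equivNCInv.symm, finsum_eq_sum_of_fintype]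
  refine Finset.sum_congr rfl fun α _ => ?_
  obtain ⟨γ, rfl⟩ := LinkPattern.equivNCInv.surjective α
  rw [Equiv.symm_apply_apply, Set.indicator_apply]
  refine if_congr ?_ rfl rfl
  exact LinkPattern.meanderOne_iff_conn γ β

/-- **Positivity of the pure partition functions.** If `(Z_α)_{α ∈ LP_N}` satisfies the meander
relations at size `N`, then each `Z_α(x)` is a strictly positive real number on the chamber. -/
theorem purePartition_pos (N : ℕ) (hN : 1 ≤ N) (Z : LinkPattern N → (ℕ → ℝ) → ℂ)
    (hZ : MeanderRelations N Z) :
    ∀ (α : LinkPattern N) (x : ℕ → ℝ), IsChamber N x →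
      (Z α x).im = 0 ∧ 0 < (Z α x).re := by
  classical
  intro α x hx
  obtain ⟨n, rfl⟩ : ∃ n, N = n + 1 := ⟨N - 1, by omega⟩
  obtain ⟨Y, hY, hY'⟩ := exists_pos_solution hx α
  have h : ∀ β : LinkPattern (n + 1), ∑ γ : NCInv (n + 1), (if γ.Conn β.toNCInv then
      Z (LinkPattern.equivNCInv.symm γ) x - Y γ else 0) = 0 := fun β => by
    have h1 := hZ β x hx
    rw [hY', finsum_mem_meanderOne, Complex.ofReal_sum] at h1
    refine Eq.trans ?_ (sub_eq_zero.2 h1.symm)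
    rw [← Finset.sum_sub_distrib]
    refine Finset.sum_congr rfl fun γ _ => ?_
    split_ifs <;> simp
  have hre := NCInv.eq_zero_of_conn_sums n
    (fun γ => (Z (LinkPattern.equivNCInv.symm γ) x).re - Y γ) fun β => by
      obtain ⟨β, rfl⟩ := LinkPattern.toNCInv_surjective β
      have h1 := congrArg Complex.re (h β)
      rw [Complex.re_sum] at h1
      refine Eq.trans (Finset.sum_congr rfl fun γ _ => ?_) h1
      split_ifs <;> simp
  have him := NCInv.eq_zero_of_conn_sums n
    (fun γ => (Z (LinkPattern.equivNCInv.symm γ) x).im) fun β => by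
      obtain ⟨β, rfl⟩ := LinkPattern.toNCInv_surjective β
      have h1 := congrArg Complex.im (h β)
      rw [Complex.im_sum] at h1
      refine Eq.trans (Finset.sum_congr rfl fun γ _ => ?_) h1
      split_ifs <;> simp
  have h1 := hre (LinkPattern.equivNCInv α)
  have h2 := him (LinkPattern.equivNCInv α)
  rw [Equiv.symm_apply_apply] at h1 h2
  exact ⟨h2, by rw [sub_eq_zero.1 h1]; exact hY _⟩
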